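/- Assume the standing conditions on H, f, m₀, u_T, that 2 < γ' ≤ N+2 and α < min{ γ'/N, (γ'−2)/(N+2−γ') } (with the convention (γ'−2)/(N+2−γ') = +∞ when γ' = N+2), and for each η ∈ (0,1] let (u_η, m_η) be a classical solution of the penalized MFG system such that (m_η, −m_η∇H_η(∇u_η)) minimises the penalized energy E_η over K. Then there exists C > 0, independent of η ∈ (0,1], such that ‖m_η‖_{L^∞(Q)} ≤ C. -/

import Mathlib

open MeasureTheory Set Filter Topology

noncomputable section

/-- Points of `ℝ^N`.  `ℤ^N`-periodic functions on `RN N` model functions on the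
flat torus `T^N`. -/
abbrev RN (N : ℕ) := Fin N → ℝ

/-- The Euclidean norm on `ℝ^N`. -/
def euclNorm {N : ℕ} (p : RN N) : ℝ := Real.sqrt (∑ i, p i ^ 2)

/-- The Euclidean inner product on `ℝ^N`. -/
def dotp {N : ℕ} (p q : RN N) : ℝ := ∑ i, p i * q i

/-- `ℤ^N`-periodicity: such functions are exactly the functions on the flat torus `T^N`. -/
def ZPeriodic {N : ℕ} {β : Type*} (u : RN N → β) : Prop :=
  ∀ (x : RN N) (z : Fin N → ℤ), u (fun i => x i + (z i : ℝ)) = u x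

/-- Partial derivative in the `i`-th coordinate direction. -/
def pd {N : ℕ} (i : Fin N) (u : RN N → ℝ) (x : RN N) : ℝ := fderiv ℝ u x (Pi.single i 1)

/-- Spatial gradient. -/
def grad {N : ℕ} (u : RN N → ℝ) (x : RN N) : RN N := fun i => pd i u x

/-- Divergence of a vector field. -/
def dive {N : ℕ} (w : RN N → RN N) (x : RN N) : ℝ := ∑ i, pd i (fun y => w y i) x

/-- Laplacian. -/
def lap {N : ℕ} (u : RN N → ℝ) (x : RN N) : ℝ := ∑ i, pd i (pd i u) x

/-- The unit cube, a fundamental domain for the torus `T^N` (of total measure `1`,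
so that the measure on the torus is the normalized one). -/
def cube (N : ℕ) : Set (RN N) := Set.Icc 0 1

/-- The space-time cylinder `Q = T^N × (0,T)`. -/
def QQ (N : ℕ) (T : ℝ) : Set (RN N × ℝ) := cube N ×ˢ Ioo 0 T

/-- Integral over `Q = T^N × (0,T)`. -/
def intQ (N : ℕ) (T : ℝ) (f : RN N → ℝ → ℝ) : ℝ := ∫ q in QQ N T, f q.1 q.2

/-- Smooth space-periodic test functions on `T^N × [0,T]`. -/
def IsTest (N : ℕ) (φ : RN N → ℝ → ℝ) : Prop :=
  ContDiff ℝ (⊤ : ℕ∞) (fun q : RN N × ℝ => φ q.1 q.2) ∧ ∀ t, ZPeriodic fun x => φ x t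

/-- The Legendre transform `L(q) = sup_p (p·q - H(p))`. -/
def Leg {N : ℕ} (H : RN N → ℝ) (q : RN N) : ℝ := sSup ((fun p => dotp p q - H p) '' Set.univ)

/-- `m L(-w/m)`, with the convention that it vanishes when `m ≤ 0` (recall that in `K`
one has `w = 0` a.e. on `{m = 0}`). -/
def mLag {N : ℕ} (L : RN N → ℝ) (mv : ℝ) (wv : RN N) : ℝ :=
  if 0 < mv then mv * L ((-mv⁻¹) • wv) else 0

/-- `|w|^{γ'} m^{1-γ'}`, with the convention that it vanishes when `m ≤ 0`. -/
def kinQ {N : ℕ} (γ' : ℝ) (mv : ℝ) (wv : RN N) : ℝ :=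
  if 0 < mv then euclNorm wv ^ γ' * mv ^ (1 - γ') else 0

/-- `F(x,m) = ∫_0^m f(x,σ) dσ`. -/
def Fint {N : ℕ} (f : RN N → ℝ → ℝ) (x : RN N) (mv : ℝ) : ℝ := ∫ σ in (0:ℝ)..mv, f x σ

/-- The convexifying term `G(x,t,m)`, as a function of `m̄(x,t)` (argument `mb`) and `m`. -/
def Gcvx (c_f α mb mv : ℝ) : ℝ :=
  ((c_f + 1) / (α * (α + 1))) * ((mv + 1) ^ (α + 1) - (mb + 1) ^ (α + 1))
    - ((c_f + 1) / α) * (mb + 1) ^ α * (mv - mb)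

/-- `g = ∂_m G`, as a function of `m̄(x,t)` (argument `mb`) and `m`. -/
def gcvx (c_f α mb mv : ℝ) : ℝ := ((c_f + 1) / α) * ((mv + 1) ^ α - (mb + 1) ^ α)

/-- The penalised Lagrangian `L_η(q) = L(q) + (η/(N+3)) |q|^{N+3}`. -/
def Lpen {N : ℕ} (L : RN N → ℝ) (η : ℝ) (q : RN N) : ℝ :=
  L q + (η / ((N : ℝ) + 3)) * euclNorm q ^ ((N : ℝ) + 3)

/-- The penalised Hamiltonian `H_η`, the Legendre transform of `L_η`. -/
def Hpen {N : ℕ} (L : RN N → ℝ) (η : ℝ) : RN N → ℝ := Leg (Lpen L η)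

/-- `g` is the weak spatial gradient of `m` on `Q`. -/
def HasWeakGradQ (N : ℕ) (T : ℝ) (m : RN N → ℝ → ℝ) (g : RN N → ℝ → RN N) : Prop :=
  ∀ Φ : RN N → ℝ → RN N, ContDiff ℝ (⊤ : ℕ∞) (fun q : RN N × ℝ => Φ q.1 q.2) →
    (∀ t, ZPeriodic fun x => Φ x t) →
    intQ N T (fun x t => m x t * dive (fun y => Φ y t) x)
      = -intQ N T (fun x t => dotp (g x t) (Φ x t))

/-- `m` is `θ`-Hölder continuous on `T^N × [0,T]` with constant `C`. -/
def HolderOnQ (N : ℕ) (T C θ : ℝ) (m : RN N → ℝ → ℝ) : Prop :=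
  ∀ x t x' t', t ∈ Icc (0:ℝ) T → t' ∈ Icc (0:ℝ) T →
    |m x t - m x' t'| ≤
      C * Real.sqrt (euclNorm (fun i => x i - x' i) ^ 2 + (t - t') ^ 2) ^ θ

/-- Membership in the constraint set `K`: `(m,w) ∈ L^{α+1}(Q) × L¹(Q;ℝ^N)`, `m ≥ 0`,
`|w|^{γ'} m^{1-γ'} ∈ L¹(Q)`, together with the weak Fokker–Planck constraint
(with initial datum `m₀`); the field `traceId` states that `m(·,T)` is the time-`T`
trace of `m` determined by the constraint. -/
structure MemK (N : ℕ) (T α γ' : ℝ) (m₀ : RN N → ℝ)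
    (m : RN N → ℝ → ℝ) (w : RN N → ℝ → RN N) : Prop where
  per_m : ∀ t, ZPeriodic fun x => m x t
  per_w : ∀ t, ZPeriodic fun x => w x t
  nonneg : ∀ x t, 0 ≤ m x t
  lp_m : IntegrableOn (fun q : RN N × ℝ => m q.1 q.2 ^ (α + 1)) (QQ N T)
  l1_w : IntegrableOn (fun q : RN N × ℝ => w q.1 q.2) (QQ N T)
  vanish : ∀ᵐ q ∂(volume.restrict (QQ N T)), m q.1 q.2 = 0 → w q.1 q.2 = 0
  kin_int : IntegrableOn (fun q : RN N × ℝ => kinQ γ' (m q.1 q.2) (w q.1 q.2)) (QQ N T)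
  traceInt : IntegrableOn (fun x => m x T) (cube N)
  fp : ∀ φ : RN N → ℝ → ℝ, IsTest N φ → (∀ x, φ x T = 0) →
    intQ N T (fun x t => m x t * deriv (φ x) t + dotp (w x t) (grad (fun y => φ y t) x)
        + m x t * lap (fun y => φ y t) x)
      + (∫ x in cube N, m₀ x * φ x 0) = 0
  traceId : ∀ φ : RN N → ℝ → ℝ, IsTest N φ →
    intQ N T (fun x t => m x t * deriv (φ x) t + dotp (w x t) (grad (fun y => φ y t) x)
        + m x t * lap (fun y => φ y t) x)
      + (∫ x in cube N, m₀ x * φ x 0) - (∫ x in cube N, m x T * φ x T) = 0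

/-- The energy functional `E` on `K`, with Lagrangian `L` and coupling antiderivative `F`. -/
def energyF (N : ℕ) (T : ℝ) (L : RN N → ℝ) (F : RN N → ℝ → ℝ) (uT : RN N → ℝ)
    (m : RN N → ℝ → ℝ) (w : RN N → ℝ → RN N) : ℝ :=
  intQ N T (fun x t => mLag L (m x t) (w x t) - F x (m x t)) + ∫ x in cube N, uT x * m x T

/-- `(m,w)` belongs to `K` and minimises the energy over `K`. -/
def MinimisesE (N : ℕ) (T α γ' : ℝ) (m₀ : RN N → ℝ) (L : RN N → ℝ) (F : RN N → ℝ → ℝ)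
    (uT : RN N → ℝ) (m : RN N → ℝ → ℝ) (w : RN N → ℝ → RN N) : Prop :=
  MemK N T α γ' m₀ m w ∧
    ∀ m' w', MemK N T α γ' m₀ m' w' → energyF N T L F uT m w ≤ energyF N T L F uT m' w'

/-- Classical solution of the MFG system `-∂_t u - Δu + H(∇u) = fc(x,t,m)`,
`∂_t m - Δm - div(∇H(∇u) m) = 0`, `m(·,0) = m₀`, `u(·,T) = u_T`:
`u, m` are continuous on `T^N × [0,T]` together with `∂_t u, ∂_t m` and all first and
second space derivatives, and the equations hold pointwise. -/
structure ClassicalSol (N : ℕ) (T : ℝ) (H : RN N → ℝ) (fc : RN N → ℝ → ℝ → ℝ)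
    (m₀ uT : RN N → ℝ) (u m : RN N → ℝ → ℝ) : Prop where
  per_u : ∀ t, ZPeriodic fun x => u x t
  per_m : ∀ t, ZPeriodic fun x => m x t
  cont_u : ContinuousOn (fun q : RN N × ℝ => u q.1 q.2) ((Set.univ : Set (RN N)) ×ˢ Icc 0 T)
  cont_m : ContinuousOn (fun q : RN N × ℝ => m q.1 q.2) ((Set.univ : Set (RN N)) ×ˢ Icc 0 T)
  cont_ut : ContinuousOn (fun q : RN N × ℝ => deriv (u q.1) q.2)
    ((Set.univ : Set (RN N)) ×ˢ Icc 0 T)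
  cont_mt : ContinuousOn (fun q : RN N × ℝ => deriv (m q.1) q.2)
    ((Set.univ : Set (RN N)) ×ˢ Icc 0 T)
  cont_du : ∀ i, ContinuousOn (fun q : RN N × ℝ => pd i (fun y => u y q.2) q.1)
    ((Set.univ : Set (RN N)) ×ˢ Icc 0 T)
  cont_dm : ∀ i, ContinuousOn (fun q : RN N × ℝ => pd i (fun y => m y q.2) q.1)
    ((Set.univ : Set (RN N)) ×ˢ Icc 0 T)
  cont_ddu : ∀ i j, ContinuousOn (fun q : RN N × ℝ => pd i (pd j fun y => u y q.2) q.1)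
    ((Set.univ : Set (RN N)) ×ˢ Icc 0 T)
  cont_ddm : ∀ i j, ContinuousOn (fun q : RN N × ℝ => pd i (pd j fun y => m y q.2) q.1)
    ((Set.univ : Set (RN N)) ×ˢ Icc 0 T)
  tdiff_u : ∀ x, ∀ t ∈ Ioo 0 T, DifferentiableAt ℝ (u x) t
  tdiff_m : ∀ x, ∀ t ∈ Ioo 0 T, DifferentiableAt ℝ (m x) t
  xdiff_u : ∀ t ∈ Icc 0 T,
    Differentiable ℝ (fun y => u y t) ∧ ∀ i, Differentiable ℝ (pd i fun y => u y t)
  xdiff_m : ∀ t ∈ Icc 0 T,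
    Differentiable ℝ (fun y => m y t) ∧ ∀ i, Differentiable ℝ (pd i fun y => m y t)
  hjb : ∀ x, ∀ t ∈ Ioo 0 T,
    -deriv (u x) t - lap (fun y => u y t) x + H (grad (fun y => u y t) x) = fc x t (m x t)
  fkp : ∀ x, ∀ t ∈ Ioo 0 T,
    deriv (m x) t - lap (fun y => m y t) x
      - dive (fun y => m y t • grad H (grad (fun z => u z t) y)) x = 0
  init : ∀ x, m x 0 = m₀ x
  final : ∀ x, u x T = uT x

/-- Weak solution `(u,m)` (with weak spatial gradient `Du` of `u`) of the MFG system
`-∂_t u - Δu + H(∇u) = fc(x,t,m)`, `∂_t m - Δm - div(∇H(∇u) m) = 0`, `m(·,0) = m₀`,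
`u(·,T) = u_T`, in the sense of Definition 3.1 of the paper. -/
structure WeakSol (N : ℕ) (T γ α : ℝ) (H : RN N → ℝ) (fc : RN N → ℝ → ℝ → ℝ)
    (m₀ uT : RN N → ℝ) (u m : RN N → ℝ → ℝ) (Du : RN N → ℝ → RN N) : Prop where
  per_u : ∀ t, ZPeriodic fun x => u x t
  per_m : ∀ t, ZPeriodic fun x => m x t
  per_Du : ∀ t, ZPeriodic fun x => Du x t
  nonneg_m : ∀ x t, 0 ≤ m x t
  lp_m : IntegrableOn (fun q : RN N × ℝ => m q.1 q.2 ^ (α + 1)) (QQ N T)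
  lq_u_sup : α < γ / N → ∃ C, ∀ᵐ q ∂(volume.restrict (QQ N T)), |u q.1 q.2| ≤ C
  lq_u_int : γ / N < α →
    IntegrableOn (fun q : RN N × ℝ =>
      |u q.1 q.2| ^ (γ * (α + 1) * (1 + (N : ℝ)) / (α * N - γ))) (QQ N T)
  weak_grad : HasWeakGradQ N T u Du
  lγ_Du : IntegrableOn (fun q : RN N × ℝ => euclNorm (Du q.1 q.2) ^ γ) (QQ N T)
  int_mL : IntegrableOn (fun q : RN N × ℝ =>
      m q.1 q.2 * Leg H (grad H (Du q.1 q.2))) (QQ N T)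
  int_mDH : IntegrableOn (fun q : RN N × ℝ => m q.1 q.2 • grad H (Du q.1 q.2)) (QQ N T)
  hjb : ∀ φ : RN N → ℝ → ℝ, IsTest N φ → (∀ x t, 0 ≤ φ x t) →
    (∃ ε > (0:ℝ), ∀ x, ∀ t ≤ ε, φ x t = 0) →
    intQ N T (fun x t => u x t * deriv (φ x) t - u x t * lap (fun y => φ y t) x
        + (H (Du x t) - fc x t (m x t)) * φ x t)
      ≤ ∫ x in cube N, uT x * φ x T
  fkp : ∀ φ : RN N → ℝ → ℝ, IsTest N φ → (∀ x, φ x T = 0) →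
    intQ N T (fun x t => m x t * deriv (φ x) t
        - dotp (m x t • grad H (Du x t)) (grad (fun y => φ y t) x)
        + m x t * lap (fun y => φ y t) x)
      + (∫ x in cube N, m₀ x * φ x 0) = 0
  energy_id : intQ N T (fun x t =>
        m x t * (-(fc x t (m x t)) + Leg H (grad H (Du x t))))
      + (∫ x in cube N, (m x T * uT x - m₀ x * u x 0)) = 0

/-- Nonnegative weak solution of the Fokker–Planck equation
`∂_t m - Δm + div(A m) = 0` in `Q`, `m(·,0) = m₀`, with finite energy
`E = ∫_Q |A|^{γ'} m < ∞`. -/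
structure FPSol (N : ℕ) (T γ' : ℝ) (m₀ : RN N → ℝ) (m : RN N → ℝ → ℝ)
    (A : RN N → ℝ → RN N) : Prop where
  per_m : ∀ t, ZPeriodic fun x => m x t
  per_A : ∀ t, ZPeriodic fun x => A x t
  nonneg : ∀ x t, 0 ≤ m x t
  int_m : IntegrableOn (fun q : RN N × ℝ => m q.1 q.2) (QQ N T)
  int_E : IntegrableOn (fun q : RN N × ℝ => euclNorm (A q.1 q.2) ^ γ' * m q.1 q.2) (QQ N T)
  weak : ∀ φ : RN N → ℝ → ℝ, IsTest N φ → (∀ x, φ x T = 0) →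
    intQ N T (fun x t => m x t * (deriv (φ x) t + lap (fun y => φ y t) x
        + dotp (A x t) (grad (fun y => φ y t) x)))
      + (∫ x in cube N, m₀ x * φ x 0) = 0

/-- Conditions on the initial datum of the Fokker–Planck equation: a periodic (i.e.
defined on the torus) Lipschitz probability density, with `‖∇m₀‖_∞ ≤ K₀`. -/
def FPData (N : ℕ) (K₀ : ℝ) (m₀ : RN N → ℝ) : Prop :=
  ZPeriodic m₀ ∧ (∀ x, 0 ≤ m₀ x) ∧ (∫ x in cube N, m₀ x) = 1 ∧
    Differentiable ℝ m₀ ∧ ∀ x, euclNorm (grad m₀ x) ≤ K₀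

section Basics

variable {N : ℕ}

lemma euclNorm_nonneg (p : RN N) : 0 ≤ euclNorm p := Real.sqrt_nonneg _

lemma euclNorm_sq (p : RN N) : euclNorm p ^ 2 = ∑ i, p i ^ 2 :=
  Real.sq_sqrt (Finset.sum_nonneg fun _ _ => sq_nonneg _)

lemma dotp_le (p q : RN N) : dotp p q ≤ euclNorm p * euclNorm q := by
  refine (abs_le.1 (abs_le_of_sq_le_sq ?_ (mul_nonneg (euclNorm_nonneg _) (euclNorm_nonneg _)))).2
  rw [mul_pow, euclNorm_sq, euclNorm_sq]
  exact Finset.sum_mul_sq_le_sq_mul_sq _ _ _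

lemma euclNorm_smul (c : ℝ) (p : RN N) : euclNorm (c • p) = |c| * euclNorm p := by
  have h : ∑ i, (c • p) i ^ 2 = c ^ 2 * ∑ i, p i ^ 2 := by
    simp [mul_pow, Finset.mul_sum]
  rw [euclNorm, h, Real.sqrt_mul (sq_nonneg _), Real.sqrt_sq_eq_abs, euclNorm]

lemma euclNorm_le_of_abs_le {p : RN N} {G : ℝ} (hG : 0 ≤ G) (h : ∀ i, |p i| ≤ G) :
    euclNorm p ≤ N * G := by
  apply Real.sqrt_le_iff.2 ⟨by positivity, ?_⟩
  calc ∑ i, p i ^ 2 ≤ ∑ _i : Fin N, G ^ 2 :=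
        Finset.sum_le_sum fun i _ => sq_le_sq' (by linarith [neg_abs_le (p i), h i])
          (le_trans (le_abs_self _) (h i))
    _ = N * G ^ 2 := by simp
    _ ≤ (N * G) ^ 2 := by
        rcases Nat.eq_zero_or_pos N with h0 | h0
        · simp [h0]
        · have : (1 : ℝ) ≤ N := by exact_mod_cast h0
          rw [mul_pow]; nlinarith [sq_nonneg G, mul_nonneg (sub_nonneg.2 this) (sq_nonneg G)]

lemma continuous_euclNorm : Continuous (euclNorm : RN N → ℝ) := by
  unfold euclNorm; fun_prop

lemma euclNorm_zero : euclNorm (0 : RN N) = 0 := by simp [euclNorm]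

/-- Every point of `ℝ^N` is congruent to a point of the unit cube. -/
lemma exists_cube_rep (x : RN N) :
    ∃ y ∈ cube N, ∃ z : Fin N → ℤ, x = fun i => y i + (z i : ℝ) :=
  ⟨fun i => Int.fract (x i), ⟨fun _ => Int.fract_nonneg _, fun _ => (Int.fract_lt_one _).le⟩,
    fun i => ⌊x i⌋, funext fun i => (Int.fract_add_floor (x i)).symm⟩

lemma ZPeriodic.forall_of_cube {β : Type*} {u : RN N → β} (hu : ZPeriodic u) {P : β → Prop}
    (h : ∀ x ∈ cube N, P (u x)) (x : RN N) : P (u x) := by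
  obtain ⟨y, hy, z, rfl⟩ := exists_cube_rep x
  rw [hu y z]; exact h y hy

lemma isCompact_cube : IsCompact (cube N) := isCompact_Icc

instance isProbabilityMeasure_cube :
    IsProbabilityMeasure ((volume : Measure (RN N)).restrict (cube N)) := by
  constructor
  rw [Measure.restrict_apply_univ, cube, Real.volume_Icc_pi]
  simp

lemma zperiodic_fderiv {u : RN N → ℝ} (hu : ZPeriodic u) : ZPeriodic (fderiv ℝ u) := by
  intro x z
  have : u = fun y => u (y + fun i => (z i : ℝ)) := funext fun y => (hu y z).symm
  conv_rhs => rw [this]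
  rw [fderiv_comp_add_right]
  rfl

lemma zperiodic_pd {u : RN N → ℝ} (hu : ZPeriodic u) (i : Fin N) : ZPeriodic (pd i u) := by
  intro x z
  simp only [pd]
  rw [zperiodic_fderiv hu x z]

/-- A function which is differentiable with continuous partial derivatives is `C¹`. -/
lemma contDiff_one_of_pd {u : RN N → ℝ} (hd : Differentiable ℝ u) (hc : ∀ i, Continuous (pd i u)) :
    ContDiff ℝ 1 u := by
  refine contDiff_one_iff_fderiv.2 ⟨hd, ?_⟩
  have : fderiv ℝ u = fun x => ∑ i, (pd i u x) • (ContinuousLinearMap.proj i : RN N →L[ℝ] ℝ) := by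
    funext x
    ext v
    conv_lhs => rw [pi_eq_sum_univ' v]
    simp only [map_sum, map_smul, pd, smul_eq_mul]
    simp only [FunLike.coe_sum, Finset.sum_apply, FunLike.coe_smul,
      Pi.smul_apply, ContinuousLinearMap.proj_apply, smul_eq_mul]
    refine Finset.sum_congr rfl fun i _ => ?_
    rw [mul_comm]
  rw [this]
  exact continuous_finsetSum _ fun i _ => (hc i).smul continuous_const

lemma continuous_pd {u : RN N → ℝ} (hu : ContDiff ℝ 1 u) (i : Fin N) : Continuous (pd i u) :=
  (hu.continuous_fderiv (by norm_num)).clm_apply continuous_const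

/-- The integral of a partial derivative of a periodic `C¹` function vanishes. -/
lemma integral_pd_eq_zero {g : RN N → ℝ} (hg : ContDiff ℝ 1 g) (hper : ZPeriodic g) (i : Fin N) :
    ∫ x in cube N, pd i g x = 0 := by
  obtain _ | n := N
  · exact i.elim0
  have hdiff : Differentiable ℝ g := hg.differentiable (by norm_num)
  have key := integral_divergence_of_hasFDerivAt_off_countable' (E := ℝ) (n := n)
    (0 : Fin (n + 1) → ℝ) 1 zero_le_one (fun j => if j = i then g else fun _ => 0)
    (fun j x => if j = i then fderiv ℝ g x else 0) ∅ countable_empty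
    (fun j => by
      by_cases h : j = i
      · simpa [h] using hg.continuous.continuousOn
      · simp only [h, if_false]; exact continuousOn_const)
    (fun x _ j => by
      by_cases h : j = i
      · simpa [h] using (hdiff x).hasFDerivAt
      · simp only [h, if_false]; exact hasFDerivAt_const (0 : ℝ) x)
    (by
      have : (fun x : Fin (n + 1) → ℝ => ∑ j, (if j = i then fderiv ℝ g x else 0)
          (Pi.single j 1)) = pd i g := by
        funext x
        rw [Finset.sum_eq_single i]
        · simp [pd]
        · intro b _ hb; simp [hb]
        · simp
      rw [this]
      exact (continuous_pd hg i).continuousOn.integrableOn_compact isCompact_Icc)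
  have h1 : ∀ x : Fin (n + 1) → ℝ, ∑ j, (if j = i then fderiv ℝ g x else 0)
      (Pi.single j 1) = pd i g x := by
    intro x
    rw [Finset.sum_eq_single i]
    · simp [pd]
    · intro b _ hb; simp [hb]
    · simp
  simp only [h1] at key
  rw [cube, key]
  refine Finset.sum_eq_zero fun j _ => ?_
  by_cases h : j = i
  · subst h
    rw [sub_eq_zero]
    congr 1
    funext y
    simp only [if_true]
    have h2 := hper (j.insertNth (0 : ℝ) y) (Pi.single j 1)
    have h3 : (fun k => (j.insertNth (0 : ℝ) y : Fin (n + 1) → ℝ) k +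
        ((Pi.single j (1 : ℤ) : Fin (n + 1) → ℤ) k : ℝ)) = j.insertNth (1 : ℝ) y := by
      funext k
      rcases Fin.eq_self_or_eq_succAbove j k with rfl | ⟨l, rfl⟩
      · simp
      · simp
    rw [h3] at h2
    exact h2
  · simp [h]

lemma pd_mul {f g : RN N → ℝ} {x : RN N} (hf : DifferentiableAt ℝ f x)
    (hg : DifferentiableAt ℝ g x) (i : Fin N) :
    pd i (fun y => f y * g y) x = f x * pd i g x + g x * pd i f x := by
  simp only [pd]
  rw [fderiv_fun_mul hf hg]
  simp

lemma integral_mul_pd {f g : RN N → ℝ} (hf : ContDiff ℝ 1 f) (hg : ContDiff ℝ 1 g)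
    (pf : ZPeriodic f) (pg : ZPeriodic g) (i : Fin N) :
    ∫ x in cube N, f x * pd i g x = -∫ x in cube N, pd i f x * g x := by
  have h := integral_pd_eq_zero (hf.mul hg) (fun x z => by simp only [pf x z, pg x z]) i
  have hdf := hf.differentiable (by norm_num)
  have hdg := hg.differentiable (by norm_num)
  simp only [pd_mul (hdf _) (hdg _)] at h
  rw [integral_add] at h
  · simp only [mul_comm (pd i f _)]; linarith
  · exact (hf.continuous.mul (continuous_pd hg i)).continuousOn.integrableOn_compact isCompact_cube
  · exact (hg.continuous.mul (continuous_pd hf i)).continuousOn.integrableOn_compact isCompact_cube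

/-- Integration by parts for the Laplacian on the torus. -/
lemma integral_mul_lap {f g : RN N → ℝ} (hf : ContDiff ℝ 1 f) (hg : ContDiff ℝ 2 g)
    (pf : ZPeriodic f) (pg : ZPeriodic g) :
    ∫ x in cube N, f x * lap g x = -∫ x in cube N, dotp (grad f x) (grad g x) := by
  have hpd : ∀ i, ContDiff ℝ 1 (pd i g) := fun i =>
    (hg.fderiv_right (m := 1) (by norm_num)).clm_apply contDiff_const
  simp only [lap, dotp, grad, Finset.mul_sum]
  rw [integral_finsetSum, integral_finsetSum, ← Finset.sum_neg_distrib]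
  · exact Finset.sum_congr rfl fun i _ => integral_mul_pd hf (hpd i) pf (zperiodic_pd pg i) i
  · exact fun i _ => ((continuous_pd hf i).mul
      (hpd i).continuous).continuousOn.integrableOn_compact isCompact_cube
  · exact fun i _ => (hf.continuous.mul
      (continuous_pd (hpd i) i)).continuousOn.integrableOn_compact isCompact_cube

end Basics

section Sobolev

variable {N : ℕ}

open scoped ENNReal NNReal

lemma lintegral_closedBall_le_of_periodic {h : RN N → ℝ≥0∞} (hm : Measurable h)
    (hper : ZPeriodic h) :
    ∫⁻ x in Metric.closedBall (0 : RN N) 2, h x ≤ 4 ^ N * ∫⁻ x in cube N, h x := by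
  let z : (Fin N → Fin 4) → Fin N → ℤ := fun j i => (j i : ℤ) - 2
  let S : (Fin N → Fin 4) → Set (RN N) := fun j => (fun x => x - fun i => (z j i : ℝ)) ⁻¹' cube N
  have hsub : Metric.closedBall (0 : RN N) 2 ⊆ ⋃ j, S j := by
    intro x hx
    rw [mem_closedBall_zero_iff, pi_norm_le_iff_of_nonneg (by norm_num)] at hx
    have hx' : ∀ i, ∃ k : Fin 4, 0 ≤ x i - (((k : ℕ) : ℝ) - 2) ∧ x i - (((k : ℕ) : ℝ) - 2) ≤ 1 := by
      intro i
      have h1 := abs_le.1 (hx i)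
      by_cases h2 : x i ≤ -1
      · exact ⟨0, by norm_num; constructor <;> linarith⟩
      by_cases h3 : x i ≤ 0
      · exact ⟨1, by norm_num; constructor <;> linarith⟩
      by_cases h4 : x i ≤ 1
      · exact ⟨2, by norm_num; constructor <;> linarith⟩
      · refine ⟨3, ?_⟩
        have : (((3 : Fin 4) : ℕ) : ℝ) = 3 := by norm_num
        rw [this]; constructor <;> linarith
    choose k hk using hx'
    refine mem_iUnion.2 ⟨k, ?_, ?_⟩ <;> intro i
    · simpa [z] using (hk i).1
    · simpa [z] using (hk i).2
  calc ∫⁻ x in Metric.closedBall (0 : RN N) 2, h x ≤ ∫⁻ x in ⋃ j, S j, h x :=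
        lintegral_mono_set hsub
    _ ≤ ∑' j, ∫⁻ x in S j, h x := lintegral_iUnion_le _ _
    _ = ∑ j, ∫⁻ x in S j, h x := tsum_fintype _
    _ = ∑ _j : Fin N → Fin 4, ∫⁻ x in cube N, h x := by
        refine Finset.sum_congr rfl fun j _ => ?_
        rw [← (measurePreserving_sub_right (volume : Measure (RN N))
          (fun i => (z j i : ℝ))).setLIntegral_comp_preimage isCompact_cube.measurableSet hm]
        refine lintegral_congr fun x => ?_
        have := hper (x - fun i => (z j i : ℝ)) (z j)
        simpa using this
    _ = 4 ^ N * ∫⁻ x in cube N, h x := by simp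

lemma norm_fderiv_sq_le (v : RN N → ℝ) (x : RN N) :
    ‖fderiv ℝ v x‖ ^ 2 ≤ N * ∑ i, pd i v x ^ 2 := by
  have h1 : ‖fderiv ℝ v x‖ ≤ ∑ i, |pd i v x| := by
    refine ContinuousLinearMap.opNorm_le_bound _ (Finset.sum_nonneg fun _ _ => abs_nonneg _) ?_
    intro w
    conv_lhs => rw [pi_eq_sum_univ' w]
    rw [map_sum, Finset.sum_mul]
    refine (norm_sum_le _ _).trans (Finset.sum_le_sum fun i _ => ?_)
    rw [map_smul, norm_smul, mul_comm]
    refine mul_le_mul (le_of_eq ?_) (norm_le_pi_norm w i) (norm_nonneg _) (abs_nonneg _)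
    rw [Real.norm_eq_abs]; rfl
  have h2 := Finset.sum_mul_sq_le_sq_mul_sq (Finset.univ : Finset (Fin N)) (fun _ => (1 : ℝ))
    (fun i => |pd i v x|)
  simp only [one_mul, one_pow, Finset.sum_const, Finset.card_univ, Fintype.card_fin,
    nsmul_eq_mul, mul_one, sq_abs] at h2
  exact (pow_le_pow_left₀ (norm_nonneg _) h1 2).trans h2

/-- The `H¹` energy of a function on the torus. -/
def h1Energy (v : RN N → ℝ) : ℝ := ∫ x in cube N, (∑ i, pd i v x ^ 2 + v x ^ 2)

lemma integrableOn_cube {g : RN N → ℝ} (hg : Continuous g) : IntegrableOn g (cube N) :=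
  hg.continuousOn.integrableOn_compact isCompact_cube

lemma continuous_h1_density {v : RN N → ℝ} (hv : ContDiff ℝ 1 v) :
    Continuous fun x => ∑ i, pd i v x ^ 2 + v x ^ 2 :=
  (continuous_finsetSum _ fun i _ => (continuous_pd hv i).pow 2).add (hv.continuous.pow 2)

lemma h1_density_nonneg (v : RN N → ℝ) (x : RN N) : 0 ≤ ∑ i, pd i v x ^ 2 + v x ^ 2 := by
  positivity

lemma h1Energy_nonneg (v : RN N → ℝ) : 0 ≤ h1Energy v :=
  integral_nonneg fun x => h1_density_nonneg v x

/-- Subcritical Sobolev inequality on the torus in dimension at least two. -/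
lemma sobolev_torus (hN : 2 ≤ N) {β : ℝ} (hβ0 : 0 < β) (hβ : β < 2 / N) :
    ∃ C : ℝ, 0 ≤ C ∧ ∀ v : RN N → ℝ, ContDiff ℝ 1 v → ZPeriodic v →
      (eLpNorm v (ENNReal.ofReal (2 / (1 - β))) (volume.restrict (cube N))) ^ 2
        ≤ ENNReal.ofReal (C * h1Energy v) := by
  have hN' : (2 : ℝ) ≤ N := by exact_mod_cast hN
  have hNp : (0 : ℝ) < N := by linarith
  have hβ1 : β < 1 := lt_of_lt_of_le hβ (by rw [div_le_one hNp]; exact hN')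
  have hβN : β / 2 < 1 / N := by
    have : (2 : ℝ) / N = 2 * (1 / N) := by ring
    linarith
  have h1N : (1 : ℝ) / N ≤ 1 / 2 := by
    rw [div_le_div_iff₀ hNp (by norm_num)]; linarith
  let χ : ContDiffBump (0 : RN N) := ⟨1, 2, one_pos, one_lt_two⟩
  have hχc : ContDiff ℝ 1 (χ : RN N → ℝ) := χ.contDiff
  obtain ⟨K, hK⟩ : ∃ K, ∀ x, ‖fderiv ℝ (χ : RN N → ℝ) x‖ ≤ K := by
    have := (χ.hasCompactSupport.fderiv (𝕜 := ℝ)).exists_bound_of_continuous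
      (hχc.continuous_fderiv (by norm_num))
    exact this
  have hK0 : 0 ≤ K := (norm_nonneg _).trans (hK 0)
  set s : Set (RN N) := Metric.closedBall (0 : RN N) 2 with hs
  let p : ℝ := (1 / 2 + 1 / N - β / 2)⁻¹
  have hpi : 1 / 2 < 1 / 2 + 1 / (N : ℝ) - β / 2 := by linarith
  have hpi1 : 1 / 2 + 1 / (N : ℝ) - β / 2 ≤ 1 := by linarith
  have hp1 : 1 ≤ p := (one_le_inv₀ (by linarith)).2 hpi1
  have hp2 : p < 2 := by
    have := (inv_lt_inv₀ (by linarith) (by norm_num : (0 : ℝ) < 1 / 2)).2 hpi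
    simpa [p] using this
  let p' : ℝ≥0 := p.toNNReal
  let q' : ℝ≥0 := (2 / (1 - β)).toNNReal
  have hp'c : (p' : ℝ) = p := Real.coe_toNNReal _ (by linarith)
  have hq'c : (q' : ℝ) = 2 / (1 - β) := Real.coe_toNNReal _ (by
    apply div_nonneg <;> linarith)
  have hfin : (volume s) ≠ ∞ := (isCompact_closedBall _ _).measure_lt_top.ne
  let C0 : ℝ≥0 := eLpNormLESNormFDerivOfLeConst ℝ (volume : Measure (RN N)) s p' q'
  let V : ℝ≥0∞ := (volume s) ^ (1 / p - 1 / 2)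
  have hV : V ≠ ∞ := ENNReal.rpow_ne_top_of_nonneg (by
    rw [sub_nonneg]; exact one_div_le_one_div_of_le (by linarith) hp2.le) hfin
  let A : ℝ := (C0 : ℝ) * V.toReal
  let c1 : ℝ := 2 * N + 2 * K ^ 2
  refine ⟨A ^ 2 * (4 ^ N * c1), by positivity, fun v hv hper => ?_⟩
  let u : RN N → ℝ := fun x => χ x * v x
  have hu : ContDiff ℝ 1 u := hχc.mul hv
  have husupp : u.support ⊆ s := by
    intro x hx
    have : x ∈ Function.support (χ : RN N → ℝ) := fun h => hx (by simp [u, h])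
    rw [χ.support_eq] at this
    exact Metric.ball_subset_closedBall this
  have hfd : ∀ x, ‖fderiv ℝ u x‖ ^ 2 ≤ c1 * (∑ i, pd i v x ^ 2 + v x ^ 2) := by
    intro x
    have e1 : fderiv ℝ u x = χ x • fderiv ℝ v x + v x • fderiv ℝ (χ : RN N → ℝ) x :=
      fderiv_fun_mul (hχc.differentiable (by norm_num) x) (hv.differentiable (by norm_num) x)
    have e2 : ‖fderiv ℝ u x‖ ≤ ‖fderiv ℝ v x‖ + K * |v x| := by
      rw [e1]
      refine (norm_add_le _ _).trans (add_le_add ?_ ?_)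
      · rw [norm_smul, Real.norm_eq_abs, abs_of_nonneg χ.nonneg]
        exact mul_le_of_le_one_left (norm_nonneg _) χ.le_one
      · rw [norm_smul, Real.norm_eq_abs, mul_comm]
        exact mul_le_mul_of_nonneg_right (hK x) (abs_nonneg _)
    have e3 := norm_fderiv_sq_le v x
    have e4 : ‖fderiv ℝ u x‖ ^ 2 ≤ 2 * ‖fderiv ℝ v x‖ ^ 2 + 2 * K ^ 2 * v x ^ 2 := by
      have := pow_le_pow_left₀ (norm_nonneg _) e2 2
      rw [← sq_abs (v x)]
      nlinarith [sq_nonneg (‖fderiv ℝ v x‖ - K * |v x|)]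
    have e5 : 0 ≤ ∑ i, pd i v x ^ 2 := Finset.sum_nonneg fun _ _ => sq_nonneg _
    calc ‖fderiv ℝ u x‖ ^ 2 ≤ 2 * (N * ∑ i, pd i v x ^ 2) + 2 * K ^ 2 * v x ^ 2 := by linarith
      _ ≤ _ := by
        simp only [c1]
        nlinarith [mul_nonneg (sq_nonneg K) e5, mul_nonneg hNp.le (sq_nonneg (v x))]
  have hsob : eLpNorm u q' volume ≤ C0 * eLpNorm (fderiv ℝ u) p' volume := by
    refine eLpNorm_le_eLpNorm_fderiv_of_le volume hu husupp ?_ ?_ ?_ Metric.isBounded_closedBall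
    · exact_mod_cast (show (1 : ℝ) ≤ (p' : ℝ) by rw [hp'c]; exact hp1)
    · have : (p' : ℝ) < (N : ℝ) := by rw [hp'c]; linarith
      simpa using (by exact_mod_cast this : p' < (N : ℝ≥0))
    · rw [NNReal.coe_inv, hp'c, hq'c]
      simp only [p, inv_inv, inv_div, Module.finrank_fintype_fun_eq_card, Fintype.card_fin]
      apply le_of_eq; ring
  have hsupp' : Function.support (fderiv ℝ u) ⊆ s := by
    refine (support_fderiv_subset ℝ).trans ?_
    exact closure_minimal husupp Metric.isClosed_closedBall
  have h2 : eLpNorm (fderiv ℝ u) p' volume ≤ eLpNorm (fderiv ℝ u) 2 (volume.restrict s) * V := by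
    have e0 : eLpNorm (fderiv ℝ u) (p' : ℝ≥0∞) (volume.restrict s)
        = eLpNorm (fderiv ℝ u) (p' : ℝ≥0∞) volume := by
      rw [← eLpNorm_norm (fderiv ℝ u), ← eLpNorm_norm (μ := volume) (fderiv ℝ u)]
      refine eLpNorm_restrict_eq_of_support_subset ?_
      intro x hx
      exact hsupp' fun h => hx (by simp [h])
    rw [← e0]
    have := eLpNorm_le_eLpNorm_mul_rpow_measure_univ (μ := volume.restrict s) (p := (p' : ℝ≥0∞))
      (q := 2) (f := fderiv ℝ u) (by
        have : (p' : ℝ≥0) ≤ 2 := by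
          exact_mod_cast (show (p' : ℝ) ≤ 2 by rw [hp'c]; exact hp2.le)
        exact_mod_cast this) (hu.continuous_fderiv (by norm_num)).aestronglyMeasurable
    refine this.trans (le_of_eq ?_)
    simp [V, hp'c]
  have h3 : (eLpNorm (fderiv ℝ u) 2 (volume.restrict s)) ^ 2
      ≤ ENNReal.ofReal (4 ^ N * c1 * h1Energy v) := by
    have e1 : (eLpNorm (fderiv ℝ u) 2 (volume.restrict s)) ^ 2
        = ∫⁻ x in s, ‖fderiv ℝ u x‖ₑ ^ (2 : ℝ) := by
      rw [eLpNorm_eq_lintegral_rpow_enorm_toReal (by norm_num) (by norm_num)]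
      simp only [ENNReal.toReal_ofNat]
      rw [← ENNReal.rpow_natCast, ← ENNReal.rpow_mul]
      norm_num
    rw [e1]
    have hcont := continuous_h1_density hv
    calc ∫⁻ x in s, ‖fderiv ℝ u x‖ₑ ^ (2 : ℝ)
        ≤ ∫⁻ x in s, ENNReal.ofReal (c1 * (∑ i, pd i v x ^ 2 + v x ^ 2)) := by
          refine lintegral_mono fun x => ?_
          rw [← ofReal_norm, ENNReal.ofReal_rpow_of_nonneg (norm_nonneg _) (by norm_num)]
          exact ENNReal.ofReal_le_ofReal (by simpa using hfd x)
      _ ≤ 4 ^ N * ∫⁻ x in cube N, ENNReal.ofReal (c1 * (∑ i, pd i v x ^ 2 + v x ^ 2)) := by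
          refine lintegral_closedBall_le_of_periodic ?_ ?_
          · exact (continuous_const.mul hcont).measurable.ennreal_ofReal
          · intro x z
            simp only [hper x z, fun i => zperiodic_pd hper i x z]
      _ = ENNReal.ofReal (4 ^ N * c1 * h1Energy v) := by
          rw [← ofReal_integral_eq_lintegral_ofReal]
          · rw [integral_const_mul, mul_assoc, ENNReal.ofReal_mul (p := 4 ^ N) (by positivity)]
            congr 1
            rw [ENNReal.ofReal_pow (by norm_num)]; norm_num
          · exact integrableOn_cube (continuous_const.mul hcont)
          · exact ae_of_all _ fun x => mul_nonneg (by positivity) (h1_density_nonneg v x)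
  have h4 : eLpNorm v q' (volume.restrict (cube N)) ≤ eLpNorm u q' volume := by
    refine le_trans (le_of_eq ?_)
      (eLpNorm_mono_measure u (Measure.restrict_le_self (s := cube N)))
    refine eLpNorm_congr_ae ?_
    filter_upwards [ae_restrict_mem isCompact_cube.measurableSet] with x hx
    have : χ x = 1 := by
      apply χ.one_of_mem_closedBall
      rw [mem_closedBall_zero_iff, pi_norm_le_iff_of_nonneg zero_le_one]
      intro i
      rw [Real.norm_eq_abs, abs_le]
      exact ⟨by linarith [hx.1 i, show (0 : RN N) i = 0 from rfl], hx.2 i⟩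
    simp [u, this]
  calc (eLpNorm v (ENNReal.ofReal (2 / (1 - β))) (volume.restrict (cube N))) ^ 2
      ≤ (C0 * (eLpNorm (fderiv ℝ u) 2 (volume.restrict s) * V)) ^ 2 :=
        pow_le_pow_left' (h4.trans (hsob.trans (mul_le_mul_right h2 _))) 2
    _ = (C0 * V) ^ 2 * (eLpNorm (fderiv ℝ u) 2 (volume.restrict s)) ^ 2 := by ring
    _ ≤ (C0 * V) ^ 2 * ENNReal.ofReal (4 ^ N * c1 * h1Energy v) := mul_le_mul_right h3 _
    _ = ENNReal.ofReal (A ^ 2 * (4 ^ N * c1) * h1Energy v) := by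
        rw [mul_assoc (A ^ 2), ENNReal.ofReal_mul (p := A ^ 2) (by positivity)]
        congr 1
        rw [ENNReal.ofReal_pow (by positivity), ENNReal.ofReal_mul (by positivity),
          ENNReal.ofReal_coe_nnreal, ENNReal.ofReal_toReal hV]

end Sobolev

section MultiplicativeInterpolation

lemma integral_rpow_mul_rpow_le {X : Type*} [MeasurableSpace X] {μ : Measure X} {f g : X → ℝ}
    (hf : Integrable f μ) (hg : Integrable g μ) (hf0 : ∀ x, 0 ≤ f x) (hg0 : ∀ x, 0 ≤ g x)
    {θ : ℝ} (h0 : 0 < θ) (h1 : θ < 1) :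
    ∫ x, f x ^ (1 - θ) * g x ^ θ ∂μ ≤ (∫ x, f x ∂μ) ^ (1 - θ) * (∫ x, g x ∂μ) ^ θ := by
  have key : ∀ {h : X → ℝ}, Integrable h μ → (∀ x, 0 ≤ h x) → ∀ {a : ℝ}, 0 < a →
      MemLp (fun x => h x ^ a) (ENNReal.ofReal (1 / a)) μ := by
    intro h hh hh0 a ha
    have := (memLp_one_iff_integrable.2 hh).norm_rpow_div (ENNReal.ofReal a)
    rw [ENNReal.toReal_ofReal ha.le] at this
    have e : (1 : ENNReal) / ENNReal.ofReal a = ENNReal.ofReal (1 / a) := by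
      rw [ENNReal.ofReal_div_of_pos ha, ENNReal.ofReal_one]
    rw [e] at this
    simpa only [Real.norm_eq_abs, abs_of_nonneg (hh0 _)] using this
  have hpq : (1 / (1 - θ)).HolderConjugate (1 / θ) := by
    rw [Real.holderConjugate_iff]
    constructor
    · rw [lt_div_iff₀ (by linarith)]; linarith
    · simp
  have := integral_mul_le_Lp_mul_Lq_of_nonneg hpq (ae_of_all μ fun x => Real.rpow_nonneg (hf0 x) _)
    (ae_of_all μ fun x => Real.rpow_nonneg (hg0 x) _) (key hf hf0 (by linarith)) (key hg hg0 h0)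
  refine this.trans (le_of_eq ?_)
  have e1 : ∀ x, (f x ^ (1 - θ)) ^ (1 / (1 - θ)) = f x := fun x => by
    rw [← Real.rpow_mul (hf0 x), mul_one_div_cancel (by linarith), Real.rpow_one]
  have e2 : ∀ x, (g x ^ θ) ^ (1 / θ) = g x := fun x => by
    rw [← Real.rpow_mul (hg0 x), mul_one_div_cancel h0.ne', Real.rpow_one]
  simp only [e1, e2, one_div_one_div]

lemma integral_rpow_le_rpow_integral {X : Type*} [MeasurableSpace X] {μ : Measure X}
    [IsProbabilityMeasure μ] {f : X → ℝ} (hf : Integrable f μ) (hf0 : ∀ x, 0 ≤ f x)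
    {θ : ℝ} (h0 : 0 < θ) (h1 : θ < 1) : ∫ x, f x ^ θ ∂μ ≤ (∫ x, f x ∂μ) ^ θ := by
  simpa using integral_rpow_mul_rpow_le (μ := μ) (integrable_const (1 : ℝ)) hf
    (fun _ => zero_le_one) hf0 h0 h1

lemma integral_cube_one {g : RN 1 → ℝ} :
    ∫ x in cube 1, g x = ∫ s in (0 : ℝ)..1, g (fun _ => s) := by
  have e := volume_preserving_funUnique (Fin 1) ℝ
  have h := e.setIntegral_preimage_emb (MeasurableEquiv.measurableEmbedding _)
    (fun s : ℝ => g (fun _ => s)) (Icc 0 1)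
  rw [intervalIntegral.integral_of_le zero_le_one, ← integral_Icc_eq_integral_Ioc, ← h]
  have hs : (MeasurableEquiv.funUnique (Fin 1) ℝ) ⁻¹' Icc 0 1 = cube 1 := by
    ext x
    simp only [mem_preimage, cube, mem_Icc, Pi.le_def]
    simp [MeasurableEquiv.funUnique]
  rw [hs]
  refine integral_congr_ae (ae_of_all _ fun x => ?_)
  simp only
  congr 1
  ext i
  fin_cases i
  rfl

lemma le_integral_add_integral_abs_pd {g : RN 1 → ℝ} (hg : ContDiff ℝ 1 g)
    {x : RN 1} (hx : x ∈ cube 1) :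
    g x ≤ (∫ y in cube 1, g y) + ∫ y in cube 1, |pd 0 g y| := by
  let γ : ℝ → RN 1 := fun s _ => s
  have hγ : ∀ s, HasDerivAt γ (Pi.single 0 1) s := by
    intro s
    rw [hasDerivAt_pi]
    intro i
    fin_cases i
    simpa [γ] using hasDerivAt_id' s
  have hγc : Continuous γ := continuous_iff_continuousAt.2 fun s => (hγ s).continuousAt
  have hd : ∀ s, HasDerivAt (fun s => g (γ s)) (pd 0 g (γ s)) s := fun s =>
    ((hg.differentiable (by norm_num) (γ s)).hasFDerivAt).comp_hasDerivAt s (hγ s)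
  have hpc : Continuous fun s => pd 0 g (γ s) := (continuous_pd hg 0).comp hγc
  obtain ⟨y, hy, hyle⟩ : ∃ y ∈ cube 1, g y ≤ ∫ y in cube 1, g y := by
    have h1 : (volume (cube 1)) = 1 := by
      rw [← Measure.restrict_apply_univ]; exact measure_univ
    have := exists_le_setAverage (μ := volume) (s := cube 1) (f := g) (by simp [h1]) (by simp [h1])
      (integrableOn_cube hg.continuous)
    simpa [setAverage_eq, measureReal_def, h1] using this
  have ex : x = γ (x 0) := by ext i; fin_cases i; rfl
  have ey : y = γ (y 0) := by ext i; fin_cases i; rfl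
  have hftc := intervalIntegral.integral_eq_sub_of_hasDerivAt (a := y 0) (b := x 0)
    (fun s _ => hd s) (hpc.intervalIntegrable _ _)
  rw [← ex, ← ey] at hftc
  have h1 : |∫ s in (y 0)..(x 0), pd 0 g (γ s)| ≤ ∫ s in (0 : ℝ)..1, |pd 0 g (γ s)| := by
    have hsub : uIoc (y 0) (x 0) ⊆ uIoc 0 1 := by
      rw [uIoc_of_le zero_le_one]
      intro s hs
      rw [uIoc, mem_Ioc] at hs
      exact ⟨lt_of_le_of_lt (le_min (hy.1 0) (hx.1 0)) hs.1, hs.2.trans (max_le (hy.2 0) (hx.2 0))⟩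
    have hm := intervalIntegral.abs_integral_mono_interval (μ := volume)
      (f := fun s => |pd 0 g (γ s)|) hsub (ae_of_all _ fun _ => abs_nonneg _)
      (hpc.abs.intervalIntegrable _ _)
    have h0 : 0 ≤ ∫ s in (0 : ℝ)..1, |pd 0 g (γ s)| :=
      intervalIntegral.integral_nonneg zero_le_one fun _ _ => abs_nonneg _
    rw [abs_of_nonneg h0] at hm
    have hn := intervalIntegral.norm_integral_le_abs_integral_norm (μ := volume) (a := y 0)
      (b := x 0) (f := fun s => pd 0 g (γ s))
    simp only [Real.norm_eq_abs] at hn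
    exact hn.trans hm
  rw [integral_cube_one (g := fun y => |pd 0 g y|)]
  have := (abs_le.1 h1).2
  linarith

lemma continuous_rpow_of_pos {X : Type*} [TopologicalSpace X] {v : X → ℝ} (hv : Continuous v)
    (h0 : ∀ x, 0 < v x) (a : ℝ) : Continuous fun x => v x ^ a :=
  hv.rpow_const fun x => Or.inl (h0 x).ne'

lemma multiplicative_interpolation_one {β σ : ℝ} (hβ0 : 0 < β) (hβ : β < 2) (hσ : 0 < σ) :
    ∃ C : ℝ, 0 ≤ C ∧ ∀ v : RN 1 → ℝ, ContDiff ℝ 1 v → ZPeriodic v → (∀ x, 0 < v x) →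
      ∫ x in cube 1, v x ^ (2 + σ * β) ≤ C * h1Energy v * (∫ x in cube 1, v x ^ σ) ^ β := by
  set a : ℝ := σ * β / 4 with ha
  have ha0 : 0 < a := by positivity
  refine ⟨(2 + a) ^ 2, by positivity, fun v hv hper hpos => ?_⟩
  have hvc := hv.continuous
  have hI : ∀ b : ℝ, Integrable (fun x => v x ^ b) (volume.restrict (cube 1)) := fun b =>
    integrableOn_cube (continuous_rpow_of_pos hvc hpos b)
  have hI0 : ∀ b : ℝ, 0 ≤ ∫ x in cube 1, v x ^ b := fun b =>
    integral_nonneg fun x => Real.rpow_nonneg (hpos x).le b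
  set g : RN 1 → ℝ := fun x => v x ^ (1 + a) with hg
  have hgc : ContDiff ℝ 1 g := contDiff_iff_contDiffAt.2 fun x =>
    (hv.contDiffAt).rpow_const_of_ne (hpos x).ne'
  have hpd : ∀ x, pd 0 g x = (1 + a) * (v x ^ a * pd 0 v x) := by
    intro x
    have h := ((hv.differentiable (by norm_num) x).hasFDerivAt).rpow_const (p := 1 + a)
      (Or.inl (hpos x).ne')
    unfold pd
    rw [h.fderiv]
    simp only [smul_apply, smul_eq_mul, add_sub_cancel_left]
    ring
  set W : ℝ := ∫ x in cube 1, v x ^ (2 * a) with hW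
  have hW0 : 0 ≤ W := hI0 _
  have cs : ∀ {h : RN 1 → ℝ}, Continuous h → (∀ x, h x ^ 2 ≤ ∑ i, pd i v x ^ 2 + v x ^ 2) →
      ∫ x in cube 1, v x ^ a * |h x| ≤ Real.sqrt (W * h1Energy v) := by
    intro h hc hle
    have e := integral_rpow_mul_rpow_le (μ := volume.restrict (cube 1)) (hI (2 * a))
      (integrableOn_cube (hc.pow 2)) (fun x => Real.rpow_nonneg (hpos x).le _)
      (fun x => sq_nonneg (h x)) (θ := 1 / 2) (by norm_num) (by norm_num)
    have e1 : ∀ x, (v x ^ (2 * a)) ^ (1 - 1 / 2 : ℝ) = v x ^ a := fun x => by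
      rw [← Real.rpow_mul (hpos x).le]; congr 1; ring
    have e2 : ∀ x, (h x ^ 2) ^ (1 / 2 : ℝ) = |h x| := fun x => by
      rw [← Real.sqrt_eq_rpow, Real.sqrt_sq_eq_abs]
    simp only [e1, Pi.pow_apply, e2] at e
    refine e.trans ?_
    have e3 : ∫ x in cube 1, h x ^ 2 ≤ h1Energy v :=
      integral_mono (integrableOn_cube (hc.pow 2))
        (integrableOn_cube (continuous_h1_density hv)) hle
    rw [show (1 - 1 / 2 : ℝ) = 1 / 2 by norm_num, ← Real.sqrt_eq_rpow, ← Real.sqrt_eq_rpow,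
      Real.sqrt_mul hW0]
    exact mul_le_mul_of_nonneg_left (Real.sqrt_le_sqrt e3) (Real.sqrt_nonneg _)
  have hsup : ∀ x ∈ cube 1, v x ^ (2 + 2 * a) ≤ (2 + a) ^ 2 * (W * h1Energy v) := by
    intro x hx
    have h1 := le_integral_add_integral_abs_pd hgc hx
    have h2 : ∫ y in cube 1, g y ≤ Real.sqrt (W * h1Energy v) := by
      refine le_trans (le_of_eq ?_) (cs hvc fun x => ?_)
      · refine integral_congr_ae (ae_of_all _ fun x => ?_)
        simp only [hg]
        rw [abs_of_pos (hpos x), add_comm, Real.rpow_add (hpos x), Real.rpow_one]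
      · have : 0 ≤ ∑ i, pd i v x ^ 2 := Finset.sum_nonneg fun _ _ => sq_nonneg _
        linarith
    have h3 : ∫ y in cube 1, |pd 0 g y| ≤ (1 + a) * Real.sqrt (W * h1Energy v) := by
      have e : ∀ y, |pd 0 g y| = (1 + a) * (v y ^ a * |pd 0 v y|) := fun y => by
        rw [hpd, abs_mul, abs_mul, abs_of_pos (by linarith : 0 < 1 + a),
          abs_of_nonneg (Real.rpow_nonneg (hpos y).le a)]
      simp only [e]
      rw [integral_const_mul]
      refine mul_le_mul_of_nonneg_left (cs (continuous_pd hv 0) fun x => ?_) (by linarith)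
      simp only [Finset.univ_unique, Fin.default_eq_zero, Finset.sum_singleton]
      nlinarith [sq_nonneg (v x)]
    have h4 : g x ≤ (2 + a) * Real.sqrt (W * h1Energy v) := by linarith
    have h5 : 0 ≤ g x := Real.rpow_nonneg (hpos x).le _
    have h6 := pow_le_pow_left₀ h5 h4 2
    rw [mul_pow, Real.sq_sqrt (mul_nonneg hW0 (h1Energy_nonneg v))] at h6
    refine le_trans (le_of_eq ?_) h6
    simp only [hg]
    rw [← Real.rpow_natCast, ← Real.rpow_mul (hpos x).le]
    congr 1; push_cast; ring
  have hWle : W ^ 2 ≤ (∫ x in cube 1, v x ^ σ) ^ β := by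
    have e := integral_rpow_le_rpow_integral (hI σ) (fun x => Real.rpow_nonneg (hpos x).le σ)
      (θ := β / 2) (by linarith) (by linarith)
    have e1 : ∀ x, (v x ^ σ) ^ (β / 2) = v x ^ (2 * a) := fun x => by
      rw [← Real.rpow_mul (hpos x).le]; congr 1; rw [ha]; ring
    simp only [e1] at e
    refine (pow_le_pow_left₀ hW0 e 2).trans (le_of_eq ?_)
    rw [← Real.rpow_natCast, ← Real.rpow_mul (hI0 σ)]
    congr 1; push_cast; ring
  have e : ∀ x, v x ^ (2 + σ * β) = v x ^ (2 + 2 * a) * v x ^ (2 * a) := fun x => by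
    rw [← Real.rpow_add (hpos x)]; congr 1; rw [ha]; ring
  calc ∫ x in cube 1, v x ^ (2 + σ * β)
      ≤ ∫ x in cube 1, (2 + a) ^ 2 * (W * h1Energy v) * v x ^ (2 * a) := by
        refine setIntegral_mono_on (hI _) ((hI (2 * a)).const_mul _)
          isCompact_cube.measurableSet fun x hx => ?_
        rw [e]
        exact mul_le_mul_of_nonneg_right (hsup x hx) (Real.rpow_nonneg (hpos x).le _)
    _ = (2 + a) ^ 2 * h1Energy v * W ^ 2 := by rw [integral_const_mul]; ring
    _ ≤ _ := mul_le_mul_of_nonneg_left hWle (mul_nonneg (sq_nonneg _) (h1Energy_nonneg v))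

/-- Multiplicative interpolation inequality on the torus. -/
lemma multiplicative_interpolation {N : ℕ} (hN : 1 ≤ N) {β σ : ℝ} (hβ0 : 0 < β) (hβ : β < 2 / N)
    (hσ : 0 < σ) :
    ∃ C : ℝ, 0 ≤ C ∧ ∀ v : RN N → ℝ, ContDiff ℝ 1 v → ZPeriodic v → (∀ x, 0 < v x) →
      ∫ x in cube N, v x ^ (2 + σ * β) ≤ C * h1Energy v * (∫ x in cube N, v x ^ σ) ^ β := by
  rcases hN.eq_or_lt with rfl | hN
  · exact multiplicative_interpolation_one hβ0 (by simpa using hβ) hσ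
  have hN2 : (2 : ℝ) ≤ N := by exact_mod_cast hN
  have hβ1 : β < 1 := lt_of_lt_of_le hβ (by rw [div_le_one (by linarith)]; exact hN2)
  obtain ⟨C, hC, h⟩ := sobolev_torus hN hβ0 hβ
  refine ⟨C, hC, fun v hv hper hpos => ?_⟩
  have hvc := hv.continuous
  have hI : ∀ b : ℝ, Integrable (fun x => v x ^ b) (volume.restrict (cube N)) := fun b =>
    integrableOn_cube (continuous_rpow_of_pos hvc hpos b)
  have hI0 : ∀ b : ℝ, 0 ≤ ∫ x in cube N, v x ^ b := fun b =>
    integral_nonneg fun x => Real.rpow_nonneg (hpos x).le b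
  set ρ : ℝ := 2 / (1 - β) with hρ
  have hρ0 : 0 < ρ := div_pos two_pos (by linarith)
  have e := integral_rpow_mul_rpow_le (hI ρ) (hI σ) (fun x => Real.rpow_nonneg (hpos x).le _)
    (fun x => Real.rpow_nonneg (hpos x).le _) hβ0 hβ1
  have e1 : ∀ x, (v x ^ ρ) ^ (1 - β) * (v x ^ σ) ^ β = v x ^ (2 + σ * β) := fun x => by
    rw [← Real.rpow_mul (hpos x).le, ← Real.rpow_mul (hpos x).le, ← Real.rpow_add (hpos x), hρ,
      div_mul_cancel₀ _ (by linarith)]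
  simp only [e1] at e
  refine e.trans (mul_le_mul_of_nonneg_right ?_ (Real.rpow_nonneg (hI0 σ) β))
  have hL : eLpNorm v (ENNReal.ofReal ρ) (volume.restrict (cube N))
      = ENNReal.ofReal ((∫ x in cube N, v x ^ ρ) ^ ρ⁻¹) := by
    have hne : ENNReal.ofReal ρ ≠ 0 := by simpa using hρ0
    have hmem : MemLp v (ENNReal.ofReal ρ) (volume.restrict (cube N)) := by
      rw [← integrable_norm_rpow_iff hvc.aestronglyMeasurable hne ENNReal.ofReal_ne_top,
        ENNReal.toReal_ofReal hρ0.le]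
      simpa only [Real.norm_eq_abs, abs_of_pos (hpos _)] using hI ρ
    rw [hmem.eLpNorm_eq_integral_rpow_norm hne ENNReal.ofReal_ne_top,
      ENNReal.toReal_ofReal hρ0.le]
    simp only [Real.norm_eq_abs, abs_of_pos (hpos _)]
  have h' := h v hv hper
  rw [hL, ← ENNReal.ofReal_pow (Real.rpow_nonneg (hI0 ρ) _), ENNReal.ofReal_le_ofReal_iff
    (mul_nonneg hC (h1Energy_nonneg v)), ← Real.rpow_natCast, ← Real.rpow_mul (hI0 ρ)] at h'
  refine le_trans (le_of_eq ?_) h'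
  congr 1
  rw [hρ]; push_cast; field_simp

end MultiplicativeInterpolation

section Legendre

variable {N : ℕ}

lemma euclNorm_add_le (p q : RN N) : euclNorm (p + q) ≤ euclNorm p + euclNorm q := by
  have h : euclNorm (p + q) ^ 2 ≤ (euclNorm p + euclNorm q) ^ 2 := by
    have e : euclNorm (p + q) ^ 2 = euclNorm p ^ 2 + 2 * dotp p q + euclNorm q ^ 2 := by
      simp only [euclNorm_sq, dotp, Finset.mul_sum, ← Finset.sum_add_distrib, Pi.add_apply]
      exact Finset.sum_congr rfl fun i _ => by ring
    rw [e]
    nlinarith [dotp_le p q]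
  exact abs_le_of_sq_le_sq' h (add_nonneg (euclNorm_nonneg p) (euclNorm_nonneg q)) |>.2

lemma euclNorm_single (i : Fin N) : euclNorm (Pi.single i 1 : RN N) = 1 := by
  simp [euclNorm, Pi.single_apply]

lemma exists_forall_dotp_sub_le {a b c c' : ℝ} (hab : a.HolderConjugate b) (hc : 0 < c)
    (hc' : 0 ≤ c') :
    ∃ K : ℝ, 0 < K ∧ ∀ H : RN N → ℝ, (∀ p, c * euclNorm p ^ a - c' ≤ H p) →
      ∀ p q, dotp p q - H p ≤ K * (euclNorm q ^ b + 1) := by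
  have ha := hab.pos
  have hb := hab.symm.pos
  set d : ℝ := c ^ (1 / a) with hd
  have hd0 : 0 < d := Real.rpow_pos_of_pos hc _
  refine ⟨(1 / d) ^ b / b + c' + 1, by positivity, fun H hH p q => ?_⟩
  have hp := euclNorm_nonneg p
  have hq := euclNorm_nonneg q
  have hy := Real.young_inequality_of_nonneg (a := d * euclNorm p) (b := 1 / d * euclNorm q)
    (by positivity) (by positivity) hab
  rw [Real.mul_rpow hd0.le hp, Real.mul_rpow (by positivity) hq, hd, ← Real.rpow_mul hc.le,
    one_div_mul_cancel ha.ne', Real.rpow_one, ← hd] at hy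
  have e : d * euclNorm p * (1 / d * euclNorm q) = euclNorm p * euclNorm q := by
    field_simp
  rw [e] at hy
  have h1 : c * euclNorm p ^ a / a ≤ c * euclNorm p ^ a :=
    div_le_self (by positivity) hab.lt.le
  have h2 := hH p
  have h3 := dotp_le p q
  have h4 : 0 ≤ euclNorm q ^ b := Real.rpow_nonneg hq b
  have h5 : (1 / d) ^ b * euclNorm q ^ b / b = (1 / d) ^ b / b * euclNorm q ^ b := by ring
  have h6 : 0 ≤ (1 / d) ^ b / b := by positivity
  have h7 : dotp p q - H p ≤ (1 / d) ^ b / b * euclNorm q ^ b + c' := by linarith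
  nlinarith [mul_nonneg hc' h4]

lemma le_leg {H : RN N → ℝ} {q : RN N} (hb : BddAbove ((fun p => dotp p q - H p) '' univ))
    (p : RN N) : dotp p q - H p ≤ Leg H q := le_csSup hb ⟨p, mem_univ p, rfl⟩

lemma leg_le {H : RN N → ℝ} {q : RN N} {K : ℝ} (h : ∀ p, dotp p q - H p ≤ K) : Leg H q ≤ K :=
  csSup_le (image_nonempty.2 univ_nonempty) (by rintro _ ⟨p, -, rfl⟩; exact h p)

lemma bddAbove_leg {H : RN N → ℝ} {q : RN N} {K : ℝ} (h : ∀ p, dotp p q - H p ≤ K) :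
    BddAbove ((fun p => dotp p q - H p) '' univ) :=
  ⟨K, by rintro _ ⟨p, -, rfl⟩; exact h p⟩

lemma convexOn_leg {H : RN N → ℝ} (hb : ∀ q, BddAbove ((fun p => dotp p q - H p) '' univ)) :
    ConvexOn ℝ univ (Leg H) := by
  refine ⟨convex_univ, fun x _ y _ a b ha hb' hab => leg_le fun p => ?_⟩
  have e : dotp p (a • x + b • y) - H p = a * (dotp p x - H p) + b * (dotp p y - H p) := by
    have : dotp p (a • x + b • y) = a * dotp p x + b * dotp p y := by
      simp only [dotp, Finset.mul_sum, ← Finset.sum_add_distrib, Pi.add_apply, Pi.smul_apply,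
        smul_eq_mul]
      exact Finset.sum_congr rfl fun i _ => by ring
    rw [this]; linear_combination H p * hab
  rw [e]
  exact add_le_add (mul_le_mul_of_nonneg_left (le_leg (hb x) p) ha)
    (mul_le_mul_of_nonneg_left (le_leg (hb y) p) hb')

lemma continuous_leg {H : RN N → ℝ} {a b c : ℝ} (hab : a.HolderConjugate b) (hc : 0 < c)
    (hH : ∀ p, c * euclNorm p ^ a ≤ H p) : Continuous (Leg H) := by
  obtain ⟨K, -, hK⟩ := exists_forall_dotp_sub_le (N := N) hab hc le_rfl
  exact (convexOn_leg fun q => bddAbove_leg fun p =>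
    hK H (fun p => by simpa using hH p) p q).locallyLipschitz.continuous

lemma pd_le_of_convex {h : RN N → ℝ} (hh : ConvexOn ℝ univ h) {p : RN N}
    (hd : DifferentiableAt ℝ h p) {R : ℝ} (hR : 0 < R) (d : RN N) :
    fderiv ℝ h p d ≤ (h (p + R • d) - h p) / R := by
  have h1 : ConvexOn ℝ univ (fun s : ℝ => h (p + s • d)) := by
    have := hh.comp_affineMap (AffineMap.lineMap p (p + d) : ℝ →ᵃ[ℝ] RN N)
    refine (this.congr ?_)
    intro s _
    simp [AffineMap.lineMap_apply, add_comm]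
  have h2 : HasDerivAt (fun s : ℝ => h (p + s • d)) (fderiv ℝ h p d) 0 := by
    have e : HasDerivAt (fun s : ℝ => p + s • d) d 0 := by
      simpa using ((hasDerivAt_id (0 : ℝ)).smul_const d).const_add p
    have h3 : HasFDerivAt h (fderiv ℝ h p) (p + (0 : ℝ) • d) := by simpa using hd.hasFDerivAt
    exact h3.comp_hasDerivAt (0 : ℝ) e
  have := h1.le_slope_of_hasDerivAt (mem_univ 0) (mem_univ R) hR h2
  simpa [slope_def_field] using this

/-- Growth of the penalised Hamiltonian and of its gradient, uniformly in the penalisation. -/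
lemma hpen_bounds {γ γ' C_L : ℝ} (hγ : 1 < γ) (hγ' : γ' = γ / (γ - 1)) (hCL : 0 < C_L)
    {L : RN N → ℝ}
    (hL : ∀ q, C_L⁻¹ * euclNorm q ^ γ' - C_L ≤ L q ∧ L q ≤ C_L * (euclNorm q ^ γ' + 1)) :
    ∃ C : ℝ, 1 ≤ C ∧ ∀ η : ℝ, 0 ≤ η →
      (∀ p, -C ≤ Hpen L η p ∧ Hpen L η p ≤ C * (euclNorm p ^ γ + 1)) ∧
      ∀ p i, |grad (Hpen L η) p i| ≤ C * (1 + euclNorm p) ^ (γ - 1) := by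
  have hab : γ'.HolderConjugate γ := by
    have := (Real.HolderConjugate.conjExponent hγ).symm
    rwa [Real.conjExponent, ← hγ'] at this
  obtain ⟨K, hK0, hK⟩ := exists_forall_dotp_sub_le (N := N) hab (inv_pos.2 hCL) hCL.le
  refine ⟨(2 ^ γ + 1) * K + C_L + 1, ?_, fun η hη => ?_⟩
  · have : 0 < (2 : ℝ) ^ γ := by positivity
    nlinarith [mul_pos this hK0]
  have h2γ : 0 < (2 : ℝ) ^ γ := by positivity
  have hpen : ∀ p q, dotp q p - Lpen L η q ≤ K * (euclNorm p ^ γ + 1) := fun p q =>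
    hK (Lpen L η) (fun q => (hL q).1.trans (le_add_of_nonneg_right (mul_nonneg
      (div_nonneg hη (by positivity)) (Real.rpow_nonneg (euclNorm_nonneg q) _)))) q p
  have hbdd : ∀ p, BddAbove ((fun q => dotp q p - Lpen L η q) '' univ) := fun p =>
    bddAbove_leg (hpen p)
  have hup : ∀ p, Hpen L η p ≤ K * (euclNorm p ^ γ + 1) := fun p => leg_le (hpen p)
  have hlow : ∀ p, -C_L ≤ Hpen L η p := by
    intro p
    have h1 := le_leg (hbdd p) 0
    have h2 : Lpen L η (0 : RN N) ≤ C_L := by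
      have := (hL 0).2
      rw [euclNorm_zero, Real.zero_rpow hab.pos.ne'] at this
      have h3 : ((N : ℝ) + 3) ≠ 0 := by positivity
      simp only [Lpen, euclNorm_zero, Real.zero_rpow h3]
      linarith
    have h3 : dotp (0 : RN N) p = 0 := by simp [dotp]
    rw [h3] at h1
    exact le_trans (by linarith) h1
  have hpγ : ∀ p : RN N, 0 ≤ euclNorm p ^ γ := fun p => Real.rpow_nonneg (euclNorm_nonneg p) γ
  refine ⟨fun p => ⟨?_, ?_⟩, fun p i => ?_⟩
  · have := hlow p
    nlinarith [mul_pos h2γ hK0]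
  · refine (hup p).trans (mul_le_mul_of_nonneg_right ?_ (by linarith [hpγ p]))
    nlinarith [mul_pos h2γ hK0]
  by_cases hd : DifferentiableAt ℝ (Hpen L η) p
  · set R : ℝ := 1 + euclNorm p with hR
    have hR1 : 1 ≤ R := by linarith [euclNorm_nonneg p]
    have hR0 : 0 < R := by linarith
    have key : ∀ d : RN N, euclNorm d = 1 →
        fderiv ℝ (Hpen L η) p d ≤ ((2 ^ γ + 1) * K + C_L + 1) * R ^ (γ - 1) := by
      intro d hd1
      refine (pd_le_of_convex (convexOn_leg hbdd) hd hR0 d).trans ?_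
      rw [div_le_iff₀ hR0]
      have e1 : euclNorm (p + R • d) ≤ 2 * R := by
        refine (euclNorm_add_le _ _).trans ?_
        rw [euclNorm_smul, hd1, abs_of_pos hR0]; linarith
      have e2 : euclNorm (p + R • d) ^ γ ≤ 2 ^ γ * R ^ γ := by
        rw [← Real.mul_rpow (by norm_num) hR0.le]
        exact Real.rpow_le_rpow (euclNorm_nonneg _) e1 (by linarith)
      have e3 : R ^ γ = R ^ (γ - 1) * R := by
        conv_rhs => rw [← Real.rpow_one R, ← Real.rpow_mul hR0.le, one_mul]
        rw [← Real.rpow_add hR0]; congr 1; ring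
      have e4 : 1 ≤ R ^ γ := Real.one_le_rpow hR1 (by linarith)
      rw [mul_assoc, ← e3]
      have e5 := hup (p + R • d)
      have e6 := hlow p
      change Leg (Lpen L η) (p + R • d) - Leg (Lpen L η) p ≤ _
      change Leg (Lpen L η) (p + R • d) ≤ _ at e5
      change _ ≤ Leg (Lpen L η) p at e6
      have e7 := mul_le_mul_of_nonneg_left e2 hK0.le
      nlinarith [mul_le_mul_of_nonneg_left e4 hK0.le, mul_le_mul_of_nonneg_left e4 hCL.le]
    have k1 := key (Pi.single i 1) (euclNorm_single i)
    have k2 := key (-Pi.single i 1) (by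
      have := euclNorm_smul (-1 : ℝ) (Pi.single i 1 : RN N)
      rw [euclNorm_single] at this
      simpa using this)
    rw [map_neg] at k2
    exact abs_le.2 ⟨by simp only [grad, pd]; linarith, k1⟩
  · have : grad (Hpen L η) p i = 0 := by
      simp only [grad, pd, fderiv_zero_of_not_differentiableAt hd]; rfl
    rw [this, abs_zero]
    have := euclNorm_nonneg p
    positivity

end Legendre

section MaximumPrinciple

variable {N : ℕ}

lemma nonpos_of_isLocalMax_of_hasDerivAt {h h1 : ℝ → ℝ} {h2 s : ℝ} (hmax : IsLocalMax h s)
    (hd : ∀ r, HasDerivAt h (h1 r) r) (hd2 : HasDerivAt h1 h2 s) : h2 ≤ 0 := by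
  by_contra! hpos
  have e1 : deriv h = h1 := funext fun r => (hd r).deriv
  have hmin : IsLocalMin h s := isLocalMin_of_deriv_deriv_pos (by rw [e1, hd2.deriv]; exact hpos)
    hmax.deriv_eq_zero (hd s).continuousAt
  have hc : h =ᶠ[𝓝 s] fun _ => h s := by
    filter_upwards [hmax, hmin] with r h3 h4 using le_antisymm h3 h4
  have h5 : deriv (deriv h) s = 0 := by
    rw [hc.deriv.deriv_eq]
    simp
  rw [e1, hd2.deriv] at h5
  exact hpos.ne' h5

lemma deriv_nonpos_of_forall_le {h : ℝ → ℝ} {h1 t T : ℝ} (htT : t < T) (hd : HasDerivAt h h1 t)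
    (hle : ∀ s ∈ Icc t T, h s ≤ h t) : h1 ≤ 0 := by
  have h2 : Tendsto (slope h t) (𝓝[>] t) (𝓝 h1) :=
    hd.tendsto_slope.mono_left (nhdsWithin_mono _ fun s hs => ne_of_gt hs)
  refine le_of_tendsto h2 ?_
  filter_upwards [Ioc_mem_nhdsGT htT] with s hs
  rw [slope_def_field]
  exact div_nonpos_of_nonpos_of_nonneg (by linarith [hle s ⟨hs.1.le, hs.2⟩]) (by linarith [hs.1])

lemma hasDerivAt_line {g : RN N → ℝ} (hg : Differentiable ℝ g) (x : RN N) (i : Fin N) (σ s : ℝ) :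
    HasDerivAt (fun s : ℝ => g (x + (σ * s) • (Pi.single i 1 : RN N)))
      (σ * pd i g (x + (σ * s) • (Pi.single i 1 : RN N))) s := by
  have e : HasDerivAt (fun s : ℝ => x + (σ * s) • (Pi.single i 1 : RN N))
      (σ • (Pi.single i 1 : RN N)) s := by
    have := (((hasDerivAt_id s).const_mul σ).smul_const (Pi.single i 1 : RN N)).const_add x
    simpa using this
  have := (hg (x + (σ * s) • (Pi.single i 1 : RN N))).hasFDerivAt.comp_hasDerivAt s e
  refine HasDerivAt.congr_deriv this ?_
  rw [map_smul, smul_eq_mul, pd]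

/-- Spatially periodic functions on `T^N × [0,T]` that are `C¹` in time and `C²` in space in the
sense needed for the classical maximum principle. -/
structure SpaceTimeReg (N : ℕ) (T : ℝ) (u : RN N → ℝ → ℝ) : Prop where
  per : ∀ t, ZPeriodic fun x => u x t
  cont : ContinuousOn (fun q : RN N × ℝ => u q.1 q.2) ((univ : Set (RN N)) ×ˢ Icc 0 T)
  tdiff : ∀ x, ∀ t ∈ Ioo 0 T, DifferentiableAt ℝ (u x) t
  xdiff : ∀ t ∈ Icc 0 T,
    Differentiable ℝ (fun y => u y t) ∧ ∀ i, Differentiable ℝ (pd i fun y => u y t)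

lemma exists_bound_of_periodic {T : ℝ} {g : RN N → ℝ → ℝ} (hper : ∀ t, ZPeriodic fun x => g x t)
    (hg : ContinuousOn (fun q : RN N × ℝ => g q.1 q.2) ((univ : Set (RN N)) ×ˢ Icc 0 T)) :
    ∃ M, ∀ x, ∀ t ∈ Icc 0 T, |g x t| ≤ M := by
  obtain ⟨M, hM⟩ := ((isCompact_cube (N := N)).prod
    (isCompact_Icc (a := 0) (b := T))).exists_bound_of_continuousOn
    (hg.mono (prod_mono (subset_univ _) le_rfl))
  refine ⟨M, fun x t ht => (hper t).forall_of_cube (P := fun r => |r| ≤ M) (fun y hy => ?_) x⟩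
  exact hM (y, t) ⟨hy, ht⟩

lemma SpaceTimeReg.le_of_forall_critical {T : ℝ} {u : RN N → ℝ → ℝ}
    (hu : SpaceTimeReg N T u) {c K U : ℝ} (hK : 0 ≤ K)
    (hcrit : ∀ x, ∀ t ∈ Ioo 0 T, grad (fun y => u y t) x = 0 →
      -(c * (deriv (u x) t + lap (fun y => u y t) x)) ≤ K)
    (hfin : ∀ x, c * u x T ≤ U) :
    ∀ x, ∀ t ∈ Ioo 0 T, c * u x t ≤ U + (K + 1) * T := by
  intro x t ht
  by_contra! hcon
  set Ψ : RN N × ℝ → ℝ := fun q => c * u q.1 q.2 - (K + 1) * (T - q.2) with hΨ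
  have hc : ContinuousOn Ψ (cube N ×ˢ Icc t T) := by
    refine (continuousOn_const.mul (hu.cont.mono (prod_mono (subset_univ _)
      (Icc_subset_Icc ht.1.le le_rfl)))).sub (Continuous.continuousOn (by fun_prop))
  obtain ⟨⟨x0, t0⟩, ⟨hx0, ht0⟩, hmax'⟩ := ((isCompact_cube (N := N)).prod
    (isCompact_Icc (a := t) (b := T))).exists_isMaxOn
    ⟨((0 : RN N), t), ⟨by simp [cube], by simp [ht.2.le]⟩⟩ hc
  have hmax : ∀ y, ∀ s ∈ Icc t T, Ψ (y, s) ≤ Ψ (x0, t0) := by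
    intro y s hs
    refine (hu.per s).forall_of_cube
      (P := fun r => c * r - (K + 1) * (T - s) ≤ Ψ (x0, t0)) (fun z hz => ?_) y
    exact hmax' (a := (z, s)) ⟨hz, hs⟩
  have ht0T : t0 < T := by
    refine lt_of_le_of_ne ht0.2 fun h => ?_
    have h1 := hmax x t ⟨le_rfl, ht.2.le⟩
    simp only [hΨ, h] at h1
    nlinarith [hfin x0, ht.1, ht.2]
  have ht0' : t0 ∈ Ioo 0 T := ⟨ht.1.trans_le ht0.1, ht0T⟩
  have htd : c * deriv (u x0) t0 + (K + 1) ≤ 0 := by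
    refine deriv_nonpos_of_forall_le (h := fun s => Ψ (x0, s)) ht0T ?_
      fun s hs => hmax x0 s ⟨ht0.1.trans hs.1, hs.2⟩
    have h1 := ((hu.tdiff x0 t0 ht0').hasDerivAt.const_mul c).sub
      (((hasDerivAt_id t0).const_sub T).const_mul (K + 1))
    exact h1.congr_deriv (by ring)
  obtain ⟨hd1, hd2⟩ := hu.xdiff t0 ⟨ht0'.1.le, ht0'.2.le⟩
  have hline : ∀ i, ∀ s : ℝ, HasDerivAt (fun s : ℝ => Ψ (x0 + (1 * s) • (Pi.single i 1 : RN N), t0))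
      (c * (1 * pd i (fun y => u y t0) (x0 + (1 * s) • (Pi.single i 1 : RN N)))) s := fun i s =>
    ((hasDerivAt_line hd1 x0 i 1 s).const_mul c).sub_const ((K + 1) * (T - t0))
  have hloc : ∀ i, IsLocalMax (fun s : ℝ => Ψ (x0 + (1 * s) • (Pi.single i 1 : RN N), t0)) 0 := by
    intro i
    refine Eventually.of_forall fun s => ?_
    simpa using hmax _ t0 ⟨ht0.1, ht0.2⟩
  have hsec : ∀ i, c * pd i (pd i fun y => u y t0) x0 ≤ 0 := by
    intro i
    have h1 := (((hasDerivAt_line (hd2 i) x0 i 1 0).const_mul 1).const_mul c)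
    have := nonpos_of_isLocalMax_of_hasDerivAt (hloc i) (hline i) h1
    simpa using this
  have hfirst : ∀ i, c * pd i (fun y => u y t0) x0 = 0 := by
    intro i
    have := (hloc i).hasDerivAt_eq_zero (hline i 0)
    simpa using this
  have hlap : c * lap (fun y => u y t0) x0 ≤ 0 := by
    rw [lap, Finset.mul_sum]
    exact Finset.sum_nonpos fun i _ => hsec i
  by_cases hc0 : c = 0
  · rw [hc0] at htd; linarith
  · have hg : grad (fun y => u y t0) x0 = 0 := funext fun i =>
      (mul_eq_zero.1 (hfirst i)).resolve_left hc0
    have := hcrit x0 t0 ht0' hg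
    linarith

/-- Doubling-of-variables Lipschitz estimate for solutions of `∂ₜu + Δu = g` with `g` bounded. -/
lemma SpaceTimeReg.abs_pd_le {T : ℝ} {u : RN N → ℝ → ℝ}
    (hu : SpaceTimeReg N T u) {U Γ ℓ R : ℝ} (hU : ∀ x, ∀ t ∈ Ioc 0 T, |u x t| ≤ U)
    (hΓ : ∀ x, ∀ t ∈ Ioo 0 T, |deriv (u x) t + lap (fun y => u y t) x| ≤ Γ)
    (hℓ : ∀ x i s, |u (x + s • (Pi.single i 1 : RN N)) T
      - u (x + (-s) • (Pi.single i 1 : RN N)) T| ≤ 2 * ℓ * |s|) (hR : 0 < R) :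
    ∀ i x, ∀ t ∈ Ioo 0 T, |pd i (fun y => u y t) x| ≤ U / R + (Γ + 1) * R / 2 + ℓ := by
  intro i x t ht
  set e : RN N := Pi.single i 1 with he
  have hΓ0 : 0 ≤ Γ := (abs_nonneg _).trans (hΓ x t ht)
  have hU0 : 0 ≤ U := (abs_nonneg _).trans (hU x t ⟨ht.1, ht.2.le⟩)
  have hℓ0 : 0 ≤ ℓ := by
    have := (abs_nonneg _).trans (hℓ 0 i 1)
    simp at this; linarith
  set a : ℝ := 2 * U / R + (Γ + 1) * R + 2 * ℓ with ha
  have haR : 2 * U + (Γ + 1) * R ^ 2 ≤ a * R := by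
    have : a * R = 2 * U + (Γ + 1) * R ^ 2 + 2 * ℓ * R := by rw [ha]; field_simp
    rw [this]; nlinarith
  have ha2 : (Γ + 1) * R + 2 * ℓ ≤ a := by
    have : 0 ≤ 2 * U / R := by positivity
    rw [ha]; linarith
  have main : ∀ c : ℝ, |c| = 1 → ∀ s ∈ Icc 0 R,
      c * (u (x + (1 * s) • e) t - u (x + (-1 * s) • e) t) - a * s + (Γ + 1) * s ^ 2 ≤ 0 := by
    intro c hc s hs
    by_contra! hcon
    set Ψ : RN N → ℝ → ℝ → ℝ := fun x s t =>
      c * (u (x + (1 * s) • e) t - u (x + (-1 * s) • e) t) - a * s + (Γ + 1) * s ^ 2 with hΨ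
    have hcΨ : ContinuousOn (fun q : RN N × ℝ × ℝ => Ψ q.1 q.2.1 q.2.2)
        (cube N ×ˢ Icc 0 R ×ˢ Icc t T) := by
      have h1 : ∀ σ : ℝ, ContinuousOn (fun q : RN N × ℝ × ℝ => u (q.1 + (σ * q.2.1) • e) q.2.2)
          (cube N ×ˢ Icc 0 R ×ˢ Icc t T) := by
        intro σ
        refine hu.cont.comp (f := fun q : RN N × ℝ × ℝ => (q.1 + (σ * q.2.1) • e, q.2.2))
          (Continuous.continuousOn (by fun_prop)) ?_
        rintro ⟨y, r, τ⟩ ⟨-, -, hτ⟩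
        exact ⟨mem_univ _, Icc_subset_Icc ht.1.le le_rfl hτ⟩
      refine ((continuousOn_const.mul ((h1 1).sub (h1 (-1)))).sub ?_).add ?_ <;>
        exact Continuous.continuousOn (by fun_prop)
    obtain ⟨⟨x0, s0, t0⟩, ⟨hx0, hs0, ht0⟩, hmax'⟩ := ((isCompact_cube (N := N)).prod
      ((isCompact_Icc (a := 0) (b := R)).prod (isCompact_Icc (a := t) (b := T)))).exists_isMaxOn
      ⟨((0 : RN N), 0, t), ⟨by simp [cube], by simp [hR.le], by simp [ht.2.le]⟩⟩ hcΨ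
    have hmax : ∀ y, ∀ r ∈ Icc 0 R, ∀ τ ∈ Icc t T, Ψ y r τ ≤ Ψ x0 s0 t0 := by
      intro y r hr τ hτ
      have hp : ZPeriodic fun y => Ψ y r τ := by
        intro y z
        have h1 : ∀ σ : ℝ, u ((fun j => y j + (z j : ℝ)) + (σ * r) • e) τ
            = u (y + (σ * r) • e) τ := by
          intro σ
          refine Eq.trans ?_ (hu.per τ (y + (σ * r) • e) z)
          show u _ τ = u _ τ
          congr 1
          funext j
          simp only [Pi.add_apply]
          ring
        simp only [hΨ, h1]
      exact hp.forall_of_cube (P := fun v => v ≤ Ψ x0 s0 t0)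
        (fun z hz => hmax' (a := (z, r, τ)) ⟨hz, hr, hτ⟩) y
    have hpos : 0 < Ψ x0 s0 t0 := hcon.trans_le (hmax x s hs t ⟨le_rfl, ht.2.le⟩)
    have habs : ∀ b : ℝ, c * b ≤ |b| := fun b =>
      (le_abs_self _).trans (by rw [abs_mul, hc, one_mul])
    have hs00 : 0 < s0 := by
      refine lt_of_le_of_ne hs0.1 fun h => ?_
      simp [hΨ, ← h] at hpos
    have hs0R : s0 < R := by
      refine lt_of_le_of_ne hs0.2 fun h => ?_
      have h1 := habs (u (x0 + (1 * s0) • e) t0 - u (x0 + (-1 * s0) • e) t0)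
      have h2 := abs_sub (u (x0 + (1 * s0) • e) t0) (u (x0 + (-1 * s0) • e) t0)
      have h3 := hU (x0 + (1 * s0) • e) t0 ⟨ht.1.trans_le ht0.1, ht0.2⟩
      have h4 := hU (x0 + (-1 * s0) • e) t0 ⟨ht.1.trans_le ht0.1, ht0.2⟩
      simp only [hΨ] at hpos
      rw [h] at *
      linarith
    have ht0T : t0 < T := by
      refine lt_of_le_of_ne ht0.2 fun h => ?_
      have h1 := habs (u (x0 + (1 * s0) • e) T - u (x0 + (-1 * s0) • e) T)
      have h2 := hℓ x0 i s0
      rw [abs_of_pos hs00] at h2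
      simp only [hΨ, h, one_mul, neg_mul, ← he] at hpos h1 h2
      nlinarith [mul_nonneg hs00.le (sub_nonneg.2 hs0R.le)]
    have ht0' : t0 ∈ Ioo 0 T := ⟨ht.1.trans_le ht0.1, ht0T⟩
    obtain ⟨hd1, hd2⟩ := hu.xdiff t0 ⟨ht0'.1.le, ht0'.2.le⟩
    set y1 : RN N := x0 + (1 * s0) • e with hy1
    set y2 : RN N := x0 + (-1 * s0) • e with hy2
    have htd : c * (deriv (u y1) t0 - deriv (u y2) t0) ≤ 0 := by
      refine deriv_nonpos_of_forall_le (h := fun s => Ψ x0 s0 s) ht0T ?_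
        fun s hs => hmax x0 s0 hs0 s ⟨ht0.1.trans hs.1, hs.2⟩
      exact ((((hu.tdiff y1 t0 ht0').hasDerivAt.sub
        (hu.tdiff y2 t0 ht0').hasDerivAt).const_mul c).sub_const _).add_const _
    have hsec : ∀ j, c * (pd j (pd j fun y => u y t0) y1 - pd j (pd j fun y => u y t0) y2)
        ≤ if j = i then -(2 * (Γ + 1)) else 0 := by
      intro j
      split_ifs with hj
      · subst hj
        have hF : ∀ s, HasDerivAt (fun s => Ψ x0 s t0)
            (c * (1 * pd j (fun y => u y t0) (x0 + (1 * s) • e)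
              - -1 * pd j (fun y => u y t0) (x0 + (-1 * s) • e)) - a * 1
              + (Γ + 1) * (2 * s)) s := by
          intro s
          have h1 := (((hasDerivAt_line hd1 x0 j 1 s).sub
            (hasDerivAt_line hd1 x0 j (-1) s)).const_mul c)
          have h2 := ((hasDerivAt_id s).pow 2).const_mul (Γ + 1)
          have h3 := (h1.sub ((hasDerivAt_id s).const_mul a)).add h2
          refine h3.congr_deriv ?_
          simp [he]
        have hG : HasDerivAt (fun s => (c * (1 * pd j (fun y => u y t0) (x0 + (1 * s) • e)
              - -1 * pd j (fun y => u y t0) (x0 + (-1 * s) • e)) - a * 1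
              + (Γ + 1) * (2 * s)))
            (c * (1 * (1 * pd j (pd j fun y => u y t0) (x0 + (1 * s0) • e))
              - -1 * (-1 * pd j (pd j fun y => u y t0) (x0 + (-1 * s0) • e)))
              + (Γ + 1) * (2 * 1)) s0 := by
          have h1 := ((((hasDerivAt_line (hd2 j) x0 j 1 s0).const_mul 1).sub
            ((hasDerivAt_line (hd2 j) x0 j (-1) s0).const_mul (-1))).const_mul c).sub_const (a * 1)
          exact h1.add (((hasDerivAt_id s0).const_mul 2).const_mul (Γ + 1))
        have hl : IsLocalMax (fun s => Ψ x0 s t0) s0 := by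
          filter_upwards [Ioo_mem_nhds hs00 hs0R] with s hs
          exact hmax x0 s ⟨hs.1.le, hs.2.le⟩ t0 ht0
        have := nonpos_of_isLocalMax_of_hasDerivAt hl hF hG
        rw [← hy1, ← hy2] at this
        linarith
      · have hF : ∀ r, HasDerivAt (fun r : ℝ => Ψ (x0 + (1 * r) • (Pi.single j 1 : RN N)) s0 t0)
            (c * (1 * pd j (fun y => u y t0) (y1 + (1 * r) • (Pi.single j 1 : RN N))
              - 1 * pd j (fun y => u y t0) (y2 + (1 * r) • (Pi.single j 1 : RN N)))) r := by
          intro r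
          have h1 := ((((hasDerivAt_line hd1 y1 j 1 r).sub
            (hasDerivAt_line hd1 y2 j 1 r)).const_mul c).sub_const (a * s0)).add_const
              ((Γ + 1) * s0 ^ 2)
          have h2 : (fun r : ℝ => Ψ (x0 + (1 * r) • (Pi.single j 1 : RN N)) s0 t0) = fun r : ℝ =>
              c * (u (y1 + (1 * r) • (Pi.single j 1 : RN N)) t0
                - u (y2 + (1 * r) • (Pi.single j 1 : RN N)) t0) - a * s0 + (Γ + 1) * s0 ^ 2 := by
            funext r
            simp only [hΨ, hy1, hy2, add_right_comm x0]
          rw [h2]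
          exact h1
        have hG : HasDerivAt (fun r : ℝ =>
            c * (1 * pd j (fun y => u y t0) (y1 + (1 * r) • (Pi.single j 1 : RN N))
              - 1 * pd j (fun y => u y t0) (y2 + (1 * r) • (Pi.single j 1 : RN N))))
            (c * (1 * (1 * pd j (pd j fun y => u y t0) (y1 + (1 * (0 : ℝ)) • (Pi.single j 1 : RN N)))
              - 1 * (1 * pd j (pd j fun y => u y t0) (y2 + (1 * (0 : ℝ)) • (Pi.single j 1 : RN N)))))
            0 :=
          (((hasDerivAt_line (hd2 j) y1 j 1 0).const_mul 1).sub
            ((hasDerivAt_line (hd2 j) y2 j 1 0).const_mul 1)).const_mul c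
        have hl : IsLocalMax (fun r : ℝ => Ψ (x0 + (1 * r) • (Pi.single j 1 : RN N)) s0 t0) 0 := by
          refine Eventually.of_forall fun r => ?_
          simpa using hmax _ s0 hs0 t0 ht0
        have := nonpos_of_isLocalMax_of_hasDerivAt hl hF hG
        simpa using this
    have hlap : c * (lap (fun y => u y t0) y1 - lap (fun y => u y t0) y2) ≤ -(2 * (Γ + 1)) := by
      rw [lap, lap, ← Finset.sum_sub_distrib, Finset.mul_sum]
      refine (Finset.sum_le_sum fun j _ => hsec j).trans (le_of_eq ?_)
      simp
    have h1 := hΓ y1 t0 ht0'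
    have h2 := hΓ y2 t0 ht0'
    have h3 := habs (-((deriv (u y1) t0 + lap (fun y => u y t0) y1)
      - (deriv (u y2) t0 + lap (fun y => u y t0) y2)))
    rw [abs_neg] at h3
    have h4 := abs_sub (deriv (u y1) t0 + lap (fun y => u y t0) y1)
      (deriv (u y2) t0 + lap (fun y => u y t0) y2)
    linarith
  have hd1 := (hu.xdiff t ⟨ht.1.le, ht.2.le⟩).1
  have hone : ∀ c : ℝ, |c| = 1 → c * pd i (fun y => u y t) x ≤ a / 2 := by
    intro c hc
    have h1 : HasDerivAt (fun s : ℝ =>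
        c * (u (x + (1 * s) • e) t - u (x + (-1 * s) • e) t) - a * s + (Γ + 1) * s ^ 2)
        (c * (2 * pd i (fun y => u y t) x) - a) 0 := by
      have h1 := (((hasDerivAt_line hd1 x i 1 0).sub
        (hasDerivAt_line hd1 x i (-1) 0)).const_mul c)
      have h2 := ((hasDerivAt_id (0:ℝ)).pow 2).const_mul (Γ + 1)
      have h3 := ((h1.sub ((hasDerivAt_id (0:ℝ)).const_mul a)).add h2)
      refine h3.congr_deriv ?_
      simp only [mul_zero, zero_smul, add_zero, id, mul_one]
      ring
    have h2 := deriv_nonpos_of_forall_le hR h1 fun s hs => by simpa using main c hc s hs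
    linarith
  have h1 := hone 1 (by simp)
  have h2 := hone (-1) (by simp)
  have h3 : a / 2 = U / R + (Γ + 1) * R / 2 + ℓ := by rw [ha]; ring
  rw [← h3]
  exact abs_le.2 ⟨by linarith, by linarith⟩

end MaximumPrinciple

section GradientBound

variable {N : ℕ}

/-- Gradient bound for viscous Hamilton–Jacobi equations with subquadratic Hamiltonian and right
hand side of size `Y`, in terms of the power `1 / (2 - γ)` of `Y`. -/
lemma exists_abs_pd_le_rpow {T γ C U₀ ℓ : ℝ} (hN : 1 ≤ N) (hT : 0 < T) (hγ : 1 < γ) (hγ2 : γ < 2)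
    (hC : 1 ≤ C) (hU₀ : 0 ≤ U₀) (hℓ0 : 0 ≤ ℓ) :
    ∃ B, 1 ≤ B ∧ ∀ (h : RN N → ℝ) (u : RN N → ℝ → ℝ) (Y : ℝ), 1 ≤ Y →
      SpaceTimeReg N T u →
      (∃ M, ∀ i x, ∀ t ∈ Ioo 0 T, |pd i (fun y => u y t) x| ≤ M) →
      (∀ p, |h p| ≤ C * (euclNorm p ^ γ + 1)) →
      (∀ x, ∀ t ∈ Ioo 0 T,
        |deriv (u x) t + lap (fun y => u y t) x - h (grad (fun y => u y t) x)| ≤ C * Y) →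
      (∀ x, |u x T| ≤ U₀) →
      (∀ x i s, |u (x + s • (Pi.single i 1 : RN N)) T
        - u (x + (-s) • (Pi.single i 1 : RN N)) T| ≤ 2 * ℓ * |s|) →
      ∀ i x, ∀ t ∈ Ioo 0 T, |pd i (fun y => u y t) x| ≤ (B * Y) ^ (1 / (2 - γ)) := by
  have hN0 : (0 : ℝ) < N := by exact_mod_cast hN
  set A := U₀ + (2 * C + 1) * T with hA
  have hA0 : 0 ≤ A := by positivity
  set κ := 1 / (C * (N : ℝ) ^ γ) with hκ
  have hκ0 : 0 < κ := by positivity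
  set B := A / κ + κ * (2 * C + 1) / 2 + ℓ with hB
  have hB0 : 0 ≤ B := by positivity
  refine ⟨2 * B + 1, by linarith, fun h u Y hY hu hbdd hh heq hUT hℓ => ?_⟩
  have hY0 : 0 < Y := by linarith
  have hCY : C ≤ C * Y := le_mul_of_one_le_right (by linarith) hY
  have hcritle : ∀ x, ∀ t ∈ Ioo 0 T, grad (fun y => u y t) x = 0 →
      |deriv (u x) t + lap (fun y => u y t) x| ≤ 2 * C * Y := by
    intro x t ht hg
    have h1 := heq x t ht
    have h2 := hh 0
    rw [hg] at h1
    rw [euclNorm_zero, Real.zero_rpow (by linarith), zero_add, mul_one] at h2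
    rw [abs_le] at *
    constructor <;> linarith [h1.1, h1.2, h2.1, h2.2]
  have hUbd : ∀ x, ∀ t ∈ Ioc 0 T, |u x t| ≤ A * Y := by
    intro x t ht
    have h0 : U₀ + (2 * C * Y + 1) * T ≤ A * Y := by
      rw [hA]
      nlinarith [mul_nonneg hU₀ (sub_nonneg.2 hY), mul_nonneg hT.le (sub_nonneg.2 hY)]
    rcases ht.2.lt_or_eq with h1 | h1
    · have hp := hu.le_of_forall_critical (c := 1) (K := 2 * C * Y) (U := U₀) (by positivity)
        (fun x t ht hg => by linarith [(abs_le.1 (hcritle x t ht hg)).1])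
        (fun x => by linarith [(abs_le.1 (hUT x)).2]) x t ⟨ht.1, h1⟩
      have hm := hu.le_of_forall_critical (c := -1) (K := 2 * C * Y) (U := U₀) (by positivity)
        (fun x t ht hg => by linarith [(abs_le.1 (hcritle x t ht hg)).2])
        (fun x => by linarith [(abs_le.1 (hUT x)).1]) x t ⟨ht.1, h1⟩
      exact abs_le.2 ⟨by linarith, by linarith⟩
    · rw [h1]
      refine (hUT x).trans (le_trans ?_ h0)
      have : 0 ≤ (2 * C * Y + 1) * T := by positivity
      linarith
  intro i x t ht
  set S : Set ℝ := {r | ∃ i x, ∃ t ∈ Ioo 0 T, r = |pd i (fun y => u y t) x|} with hS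
  have hSb : BddAbove S := by
    obtain ⟨M, hM⟩ := hbdd
    refine ⟨M, ?_⟩
    rintro r ⟨i, x, t, ht, rfl⟩
    exact hM i x t ht
  have hSne : S.Nonempty := ⟨_, i, x, t, ht, rfl⟩
  have hle : ∀ i x, ∀ t ∈ Ioo 0 T, |pd i (fun y => u y t) x| ≤ sSup S := fun i x t ht =>
    le_csSup hSb ⟨i, x, t, ht, rfl⟩
  refine (hle i x t ht).trans ?_
  set G := sSup S with hG
  have h2γ : 0 < 2 - γ := by linarith
  have hBY : 1 ≤ (2 * B + 1) * Y := by nlinarith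
  rcases le_or_gt G 1 with hG1 | hG1
  · exact hG1.trans (Real.one_le_rpow hBY (by positivity))
  have hG0 : 0 < G := by linarith
  set R := κ * G ^ (1 - γ) with hR
  have hR0 : 0 < R := by positivity
  have hGam : ∀ x, ∀ t ∈ Ioo 0 T, |deriv (u x) t + lap (fun y => u y t) x|
      ≤ 2 * C * Y + C * (N : ℝ) ^ γ * G ^ γ := by
    intro x t ht
    have h1 := heq x t ht
    have h2 := hh (grad (fun y => u y t) x)
    have h3 : euclNorm (grad (fun y => u y t) x) ^ γ ≤ (N * G) ^ γ :=
      Real.rpow_le_rpow (euclNorm_nonneg _)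
        (euclNorm_le_of_abs_le hG0.le fun i => hle i x t ht) (by linarith)
    rw [Real.mul_rpow hN0.le hG0.le] at h3
    have h4 : C * (euclNorm (grad (fun y => u y t) x) ^ γ + 1)
        ≤ C * (N : ℝ) ^ γ * G ^ γ + C * Y := by nlinarith
    rw [abs_le] at *
    constructor <;> linarith [h1.1, h1.2, h2.1, h2.2]
  have hmain : G ≤ A * Y / R + (2 * C * Y + C * (N : ℝ) ^ γ * G ^ γ + 1) * R / 2 + ℓ := by
    refine csSup_le hSne ?_
    rintro r ⟨i, x, t, ht, rfl⟩
    exact hu.abs_pd_le hUbd hGam hℓ hR0 i x t ht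
  have e1 : A * Y / R = A / κ * Y * G ^ (γ - 1) := by
    rw [hR, show (1 - γ) = -(γ - 1) by ring, Real.rpow_neg hG0.le]
    field_simp
  have e2 : C * (N : ℝ) ^ γ * G ^ γ * R = G := by
    have : G ^ γ * G ^ (1 - γ) = G := by
      rw [← Real.rpow_add hG0]; simp
    calc C * (N : ℝ) ^ γ * G ^ γ * R = (C * (N : ℝ) ^ γ * κ) * (G ^ γ * G ^ (1 - γ)) := by
          rw [hR]; ring
      _ = G := by
          rw [this, hκ, mul_one_div_cancel (by positivity), one_mul]
  have e3 : R ≤ κ := mul_le_of_le_one_right hκ0.le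
    (Real.rpow_le_one_of_one_le_of_nonpos hG1.le (by linarith))
  have e4 : 1 ≤ G ^ (γ - 1) := Real.one_le_rpow hG1.le (by linarith)
  have e5 : G / 2 ≤ B * Y * G ^ (γ - 1) := by
    have h1 : (2 * C * Y + 1) * R ≤ (2 * C + 1) * Y * κ := by
      have : (2 * C * Y + 1) ≤ (2 * C + 1) * Y := by linarith
      gcongr
    have h2 : (κ * (2 * C + 1) / 2 + ℓ) * Y ≤ (κ * (2 * C + 1) / 2 + ℓ) * Y * G ^ (γ - 1) :=
      le_mul_of_one_le_right (by positivity) e4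
    have h3 : ℓ ≤ ℓ * Y := le_mul_of_one_le_right hℓ0 hY
    rw [e1] at hmain
    rw [hB]
    linarith
  have e6 : G ^ (2 - γ) ≤ (2 * B + 1) * Y := by
    have h1 : G = G ^ (2 - γ) * G ^ (γ - 1) := by
      rw [← Real.rpow_add hG0]; norm_num
    have h2 : G ^ (2 - γ) * G ^ (γ - 1) ≤ 2 * B * Y * G ^ (γ - 1) := by
      rw [← h1]; linarith
    have h3 := le_of_mul_le_mul_right h2 (by positivity)
    linarith
  calc G = (G ^ (2 - γ)) ^ (1 / (2 - γ)) := by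
        rw [← Real.rpow_mul hG0.le, mul_one_div_cancel h2γ.ne', Real.rpow_one]
    _ ≤ _ := Real.rpow_le_rpow (by positivity) e6 (by positivity)

lemma abs_sub_line_le_of_contDiff {g : RN N → ℝ} (hg : ContDiff ℝ 2 g) (hper : ZPeriodic g) :
    ∃ ℓ, 0 ≤ ℓ ∧ ∀ x i (s : ℝ), |g (x + s • (Pi.single i 1 : RN N))
        - g (x + (-s) • (Pi.single i 1 : RN N))| ≤ 2 * ℓ * |s| := by
  have h1 : Continuous fun x => ‖fderiv ℝ g x‖ := (hg.continuous_fderiv (by norm_num)).norm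
  obtain ⟨ℓ, hℓ⟩ := (isCompact_cube (N := N)).exists_bound_of_continuousOn h1.continuousOn
  have hℓ' : ∀ x, ‖fderiv ℝ g x‖ ≤ ℓ := fun x =>
    (zperiodic_fderiv hper).forall_of_cube (P := fun r => ‖r‖ ≤ ℓ)
      (fun y hy => by simpa using hℓ y hy) x
  refine ⟨ℓ, (norm_nonneg _).trans (hℓ' 0), fun x i s => ?_⟩
  have h2 := convex_univ.norm_image_sub_le_of_norm_fderiv_le (𝕜 := ℝ) (f := g) (C := ℓ)
    (fun y _ => hg.differentiable (by norm_num) y) (fun y _ => hℓ' y)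
    (mem_univ (x + (-s) • (Pi.single i 1 : RN N))) (mem_univ (x + s • (Pi.single i 1 : RN N)))
  rw [Real.norm_eq_abs] at h2
  refine h2.trans (le_of_eq ?_)
  have h3 : x + s • (Pi.single i 1 : RN N) - (x + (-s) • (Pi.single i 1 : RN N))
      = (2 * s) • (Pi.single i 1 : RN N) := by
    rw [add_sub_add_left_eq_sub, ← sub_smul]; congr 1; ring
  rw [h3, norm_smul, Real.norm_eq_abs, abs_mul, Pi.norm_single]
  simp
  ring

/-- Uniform bound of the drift of the penalised systems in terms of the size of the density. -/
lemma exists_drift_bound {T γ γ' C α : ℝ} (hN : 1 ≤ N) (hT : 0 < T) (hγ : 1 < γ)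
    (hγ' : γ' = γ / (γ - 1)) (h2 : 2 < γ') (hC : 1 ≤ C) (hα : 0 < α)
    {f : RN N → ℝ → ℝ} {m₀ uT : RN N → ℝ}
    (hf : ∀ x s, 0 ≤ s → |f x s| ≤ C * (1 + s) ^ α)
    (huT : ContDiff ℝ 2 uT) (huTper : ZPeriodic uT) :
    ∃ D, 1 ≤ D ∧ ∀ (h : RN N → ℝ) (u m : RN N → ℝ → ℝ) (M : ℝ),
      (∀ p, |h p| ≤ C * (euclNorm p ^ γ + 1)) →
      (∀ p i, |grad h p i| ≤ C * (1 + euclNorm p) ^ (γ - 1)) →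
      ClassicalSol N T h (fun x _ mv => -f x mv) m₀ uT u m →
      (∀ x t, 0 ≤ m x t) → (∀ x, ∀ t ∈ Icc 0 T, m x t ≤ M) →
      ∀ x, ∀ t ∈ Ioo 0 T, euclNorm ((-(m x t)) • grad h (grad (fun y => u y t) x))
        ≤ D * (1 + M) ^ (α / (γ' - 2)) * m x t := by
  have hN0 : (1 : ℝ) ≤ N := by exact_mod_cast hN
  have hγ1 : 0 < γ - 1 := by linarith
  have hγ2 : γ < 2 := by
    rw [hγ', lt_div_iff₀ hγ1] at h2; linarith
  obtain ⟨ℓ, hℓ0, hℓ⟩ := abs_sub_line_le_of_contDiff huT huTper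
  obtain ⟨U₀, hU₀⟩ := (isCompact_cube (N := N)).exists_bound_of_continuousOn
    huT.continuous.continuousOn
  have hU₀' : ∀ x, |uT x| ≤ U₀ := fun x =>
    huTper.forall_of_cube (P := fun r => |r| ≤ U₀) (fun y hy => hU₀ y hy) x
  obtain ⟨B, hB, hmain⟩ := exists_abs_pd_le_rpow (N := N) (T := T) (γ := γ) (C := C) (U₀ := U₀)
    (ℓ := ℓ) hN hT hγ hγ2 hC ((abs_nonneg _).trans (hU₀' 0)) hℓ0
  have h2γ : 0 < 2 - γ := by linarith
  have hexp : 1 / (2 - γ) * (γ - 1) = 1 / (γ' - 2) := by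
    have : γ' - 2 = (2 - γ) / (γ - 1) := by rw [hγ']; field_simp; ring
    rw [this]; field_simp
  refine ⟨N * (C * (2 * N) ^ (γ - 1) * B ^ (1 / (γ' - 2))), ?_, ?_⟩
  · have h3 : 1 ≤ (2 * (N : ℝ)) ^ (γ - 1) := Real.one_le_rpow (by linarith) hγ1.le
    have h4 : 1 ≤ B ^ (1 / (γ' - 2)) := Real.one_le_rpow hB (by
      apply div_nonneg <;> linarith)
    exact one_le_mul_of_one_le_of_one_le hN0
      (one_le_mul_of_one_le_of_one_le (one_le_mul_of_one_le_of_one_le hC h3) h4)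
  intro h u m M hh hgh hs hm hM x t ht
  have hM0 : 0 ≤ M := (hm x t).trans (hM x t ⟨ht.1.le, ht.2.le⟩)
  set Y := (1 + M) ^ α with hY
  have hY1 : 1 ≤ Y := Real.one_le_rpow (by linarith) hα.le
  have hbdd : ∃ M, ∀ i x, ∀ t ∈ Ioo 0 T, |pd i (fun y => u y t) x| ≤ M := by
    have : ∀ i, ∃ M, ∀ x, ∀ t ∈ Icc 0 T, |pd i (fun y => u y t) x| ≤ M := fun i =>
      exists_bound_of_periodic (g := fun x t => pd i (fun y => u y t) x)
        (fun t => zperiodic_pd (hs.per_u t) i) (hs.cont_du i)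
    choose Mi hMi using this
    refine ⟨∑ i, |Mi i|, fun i x t ht => (hMi i x t ⟨ht.1.le, ht.2.le⟩).trans ?_⟩
    exact (le_abs_self _).trans
      (Finset.single_le_sum (f := fun i => |Mi i|) (fun j _ => abs_nonneg _) (Finset.mem_univ i))
  have hpd := hmain h u Y hY1 ⟨hs.per_u, hs.cont_u, hs.tdiff_u, hs.xdiff_u⟩ hbdd hh (by
      intro x t ht
      have h3 := hs.hjb x t ht
      have h4 : deriv (u x) t + lap (fun y => u y t) x - h (grad (fun y => u y t) x)
          = f x (m x t) := by linarith
      rw [h4]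
      refine (hf x _ (hm x t)).trans ?_
      exact mul_le_mul_of_nonneg_left (Real.rpow_le_rpow (by linarith [hm x t])
        (by linarith [hM x t ⟨ht.1.le, ht.2.le⟩]) hα.le) (by linarith))
    (fun x => by rw [hs.final]; exact hU₀' x)
    (fun x i s => by rw [hs.final, hs.final]; exact hℓ x i s)
  set G := (B * Y) ^ (1 / (2 - γ)) with hG
  have hBY : 1 ≤ B * Y := one_le_mul_of_one_le_of_one_le hB hY1
  have hG1 : 1 ≤ G := Real.one_le_rpow hBY (by positivity)
  have hg : euclNorm (grad (fun y => u y t) x) ≤ N * G :=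
    euclNorm_le_of_abs_le (by linarith) fun i => hpd i x t ht
  have hgr : ∀ i, |grad h (grad (fun y => u y t) x) i|
      ≤ C * (2 * N) ^ (γ - 1) * B ^ (1 / (γ' - 2)) * (1 + M) ^ (α / (γ' - 2)) := by
    intro i
    refine (hgh _ i).trans ?_
    have h3 : (1 + euclNorm (grad (fun y => u y t) x)) ^ (γ - 1) ≤ (2 * N * G) ^ (γ - 1) := by
      refine Real.rpow_le_rpow (by linarith [euclNorm_nonneg (grad (fun y => u y t) x)]) ?_ hγ1.le
      nlinarith
    have h4 : (2 * N * G) ^ (γ - 1)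
        = (2 * N) ^ (γ - 1) * (B ^ (1 / (γ' - 2)) * (1 + M) ^ (α / (γ' - 2))) := by
      rw [Real.mul_rpow (by linarith) (by linarith), hG, ← Real.rpow_mul (by linarith), hexp,
        Real.mul_rpow (x := B) (by linarith) (by linarith), hY, ← Real.rpow_mul (x := 1 + M)
          (by linarith), mul_one_div]
    rw [h4] at h3
    calc _ ≤ C * ((2 * N) ^ (γ - 1) * (B ^ (1 / (γ' - 2)) * (1 + M) ^ (α / (γ' - 2)))) := by gcongr
      _ = _ := by ring
  have h5 := euclNorm_le_of_abs_le (by positivity) hgr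
  rw [euclNorm_smul, abs_neg, abs_of_nonneg (hm x t), mul_comm]
  exact mul_le_mul_of_nonneg_right (h5.trans (le_of_eq (by ring))) (hm x t)

end GradientBound

section Mollification

variable {N : ℕ}

instance isAddHaarMeasure_spaceTime : (volume : Measure (RN N × ℝ)).IsAddHaarMeasure :=
  inferInstanceAs ((volume : Measure (RN N)).prod (volume : Measure ℝ)).IsAddHaarMeasure

lemma norm_convolution_bump_le {g : RN N × ℝ → ℝ} (hg : Continuous g) {S : ℝ} (hS : ∀ q, |g q| ≤ S)
    (φ : ContDiffBump (0 : RN N × ℝ)) (q : RN N × ℝ) :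
    |convolution (φ.normed volume) g (ContinuousLinearMap.lsmul ℝ ℝ) volume q| ≤ 3 * S := by
  have h := ContDiffBump.dist_normed_convolution_le (φ := φ) (μ := (volume : Measure (RN N × ℝ)))
    (x₀ := q) (ε := 2 * S) hg.aestronglyMeasurable fun x _ => by
      rw [Real.dist_eq]
      exact (abs_sub _ _).trans (by linarith [hS x, hS q])
  rw [Real.dist_eq] at h
  have := hS q
  rw [abs_le] at *
  constructor <;> linarith [h.1, h.2]

lemma hasDerivAt_convolution_bump {g g' : RN N × ℝ → ℝ} {v : RN N × ℝ} (hg : Continuous g)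
    (hg' : Continuous g') {S : ℝ} (hS : ∀ q, |g' q| ≤ S)
    (hd : ∀ q (s : ℝ), HasDerivAt (fun s : ℝ => g (q + s • v)) (g' (q + s • v)) s)
    (φ : ContDiffBump (0 : RN N × ℝ)) (q : RN N × ℝ) :
    HasDerivAt (fun s : ℝ => convolution (φ.normed volume) g (ContinuousLinearMap.lsmul ℝ ℝ) volume
        (q + s • v))
      (convolution (φ.normed volume) g' (ContinuousLinearMap.lsmul ℝ ℝ) volume q) 0 := by
  have hρ : Continuous (φ.normed (volume : Measure (RN N × ℝ))) :=
    φ.contDiff_normed (n := 0).continuous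
  have hρs := φ.hasCompactSupport_normed (μ := (volume : Measure (RN N × ℝ)))
  have hρi : Integrable (φ.normed (volume : Measure (RN N × ℝ))) :=
    hρ.integrable_of_hasCompactSupport hρs
  simp only [convolution_def, ContinuousLinearMap.lsmul_apply, smul_eq_mul]
  have := (hasDerivAt_integral_of_dominated_loc_of_deriv_le (μ := (volume : Measure (RN N × ℝ)))
    (F := fun (s : ℝ) z => φ.normed volume z * g (q + s • v - z))
    (F' := fun (s : ℝ) z => φ.normed volume z * g' (q + s • v - z)) (x₀ := (0 : ℝ))
    (bound := fun z => ‖φ.normed (volume : Measure (RN N × ℝ)) z‖ * S) (s := univ) univ_mem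
    (Eventually.of_forall fun s => Continuous.aestronglyMeasurable (by fun_prop)) ?_
    (Continuous.aestronglyMeasurable (by fun_prop)) ?_ (hρi.norm.mul_const S) ?_).2
  · simpa using this
  · exact Continuous.integrable_of_hasCompactSupport (by fun_prop) hρs.mul_right
  · refine Eventually.of_forall fun z s _ => ?_
    rw [norm_mul]
    exact mul_le_mul_of_nonneg_left (hS _) (norm_nonneg _)
  · refine Eventually.of_forall fun z s _ => ?_
    have h1 := (hd (q - z) s).const_mul (φ.normed volume z)
    simpa only [sub_add_eq_add_sub] using h1

/-- Smooth space-time approximation of functions with continuous space derivatives that vanish near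
the initial and final times. -/
lemma exists_test_approx {T δ S : ℝ} (hδ : 0 < δ) {g : RN N × ℝ → ℝ} {g' : Fin N → RN N × ℝ → ℝ}
    (hg : Continuous g) (hg' : ∀ i, Continuous (g' i)) (hgS : ∀ q, |g q| ≤ S)
    (hgS' : ∀ i q, |g' i q| ≤ S) (hper : ∀ t, ZPeriodic fun x => g (x, t))
    (hd : ∀ i x t (s : ℝ), HasDerivAt (fun s : ℝ => g (x + s • (Pi.single i 1 : RN N), t))
      (g' i (x + s • (Pi.single i 1 : RN N), t)) s)
    (hvan : ∀ x t, t < δ ∨ T - δ < t → g (x, t) = 0) :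
    ∃ φ : ℕ → RN N → ℝ → ℝ, (∀ k, IsTest N (φ k)) ∧ (∀ k x t, t ≤ 0 ∨ T ≤ t → φ k x t = 0) ∧
      (∀ k x t, |φ k x t| ≤ 3 * S) ∧ (∀ k i x t, |pd i (fun y => φ k y t) x| ≤ 3 * S) ∧
      (∀ x t, Tendsto (fun k => φ k x t) atTop (𝓝 (g (x, t)))) ∧
      ∀ i x t, Tendsto (fun k => pd i (fun y => φ k y t) x) atTop (𝓝 (g' i (x, t))) := by
  let B : ℕ → ContDiffBump (0 : RN N × ℝ) := fun k =>
    ⟨δ / (2 * (k + 1)), δ / (k + 1), by positivity, by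
      apply div_lt_div_of_pos_left hδ <;> norm_cast <;> omega⟩
  have hBt : Tendsto (fun k => (B k).rOut) atTop (𝓝 0) := by
    have := (tendsto_one_div_add_atTop_nhds_zero_nat (𝕜 := ℝ)).const_mul δ
    simpa [B, div_eq_mul_inv] using this
  let φ : ℕ → RN N → ℝ → ℝ := fun k x t =>
    convolution ((B k).normed volume) g (ContinuousLinearMap.lsmul ℝ ℝ) volume (x, t)
  have hsm : ∀ k, ContDiff ℝ (⊤ : ℕ∞) (fun q : RN N × ℝ => φ k q.1 q.2) := fun k =>
    (B k).hasCompactSupport_normed.contDiff_convolution_left _ (B k).contDiff_normed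
      hg.locallyIntegrable
  have hpd : ∀ k i x t, pd i (fun y => φ k y t) x =
      convolution ((B k).normed volume) (g' i) (ContinuousLinearMap.lsmul ℝ ℝ) volume (x, t) := by
    intro k i x t
    have h1 : Differentiable ℝ fun y => φ k y t :=
      ((hsm k).differentiable (by simp)).comp (g := fun q : RN N × ℝ => φ k q.1 q.2)
        (f := fun y => (y, t)) (by fun_prop)
    have h2 := hasDerivAt_line h1 x i 1 0
    have h3 := hasDerivAt_convolution_bump (v := ((Pi.single i 1 : RN N), (0 : ℝ))) hg (hg' i)
      (hgS' i) (fun q s => by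
        have e : ∀ s : ℝ, q + s • ((Pi.single i 1 : RN N), (0 : ℝ))
            = (q.1 + s • (Pi.single i 1 : RN N), q.2) := fun s => by ext <;> simp
        simpa only [e] using hd i q.1 q.2 s) (B k) (x, t)
    have h4 : (fun s : ℝ => φ k (x + (1 * s) • (Pi.single i 1 : RN N)) t) = fun s : ℝ =>
        convolution ((B k).normed volume) g (ContinuousLinearMap.lsmul ℝ ℝ) volume
        ((x, t) + s • ((Pi.single i 1 : RN N), (0 : ℝ))) := by
      funext s
      simp [φ]
    rw [h4] at h2
    have := h2.unique h3
    simpa using this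
  refine ⟨φ, fun k => ⟨hsm k, fun t x z => ?_⟩, fun k x t ht => ?_,
    fun k x t => norm_convolution_bump_le hg hgS _ _, fun k i x t => ?_, fun x t =>
    ContDiffBump.convolution_tendsto_right_of_continuous hBt hg _, fun i x t => ?_⟩
  · simp only [φ, convolution_def]
    congr 1
    funext q
    congr 1
    refine Eq.trans ?_ (hper (t - q.2) (x - q.1) z)
    show g _ = g _
    congr 1
    ext j
    · simp only [Prod.fst_sub, Pi.sub_apply]; ring
    · simp
  · have hb : (B k).rOut ≤ δ := div_le_self hδ.le (by norm_cast; omega)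
    have h0 : g (x, t) = 0 := hvan x t (by rcases ht with h | h; · left; linarith
                                           · right; linarith)
    have h := ContDiffBump.dist_normed_convolution_le (φ := B k)
      (μ := (volume : Measure (RN N × ℝ))) (x₀ := (x, t)) (ε := 0) hg.aestronglyMeasurable
      fun y hy => by
        rw [Metric.mem_ball, Prod.dist_eq, max_lt_iff, Real.dist_eq, abs_lt] at hy
        rw [h0, hvan y.1 y.2 (by
          rcases ht with h | h
          · left; linarith [hy.2.2]
          · right; linarith [hy.2.1])]
        simp
    rw [h0, Real.dist_eq, sub_zero] at h
    exact abs_nonpos_iff.1 h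
  · rw [hpd]
    exact norm_convolution_bump_le (hg' i) (hgS' i) _ _
  · simp only [hpd]
    exact ContDiffBump.convolution_tendsto_right_of_continuous hBt (hg' i) _

end Mollification

section WeakForm

variable {N : ℕ} {T : ℝ}

lemma integrableOn_QQ {F : RN N × ℝ → ℝ}
    (hF : ContinuousOn F ((univ : Set (RN N)) ×ˢ Icc 0 T)) : IntegrableOn F (QQ N T) :=
  ((hF.mono (prod_mono (subset_univ _) le_rfl)).integrableOn_compact
    (isCompact_cube.prod isCompact_Icc)).mono_set (prod_mono le_rfl Ioo_subset_Icc_self)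

lemma restrict_QQ : (volume : Measure (RN N × ℝ)).restrict (QQ N T)
    = ((volume : Measure (RN N)).restrict (cube N)).prod
      ((volume : Measure ℝ).restrict (Ioo 0 T)) := by
  rw [QQ, Measure.volume_eq_prod, Measure.prod_restrict]

lemma setIntegral_QQ {F : RN N × ℝ → ℝ} (hF : IntegrableOn F (QQ N T)) :
    ∫ q in QQ N T, F q = ∫ x in cube N, ∫ t in Ioo 0 T, F (x, t) := by
  rw [IntegrableOn, restrict_QQ] at hF
  rw [restrict_QQ, integral_prod _ hF]

lemma setIntegral_QQ_symm {F : RN N × ℝ → ℝ} (hF : IntegrableOn F (QQ N T)) :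
    ∫ q in QQ N T, F q = ∫ t in Ioo 0 T, ∫ x in cube N, F (x, t) := by
  rw [IntegrableOn, restrict_QQ] at hF
  rw [restrict_QQ, integral_prod_symm _ hF]

lemma pd_slice_eq {Φ : RN N × ℝ → ℝ} (hΦ : Differentiable ℝ Φ) (i : Fin N) (x : RN N) (t : ℝ) :
    pd i (fun y => Φ (y, t)) x = fderiv ℝ Φ (x, t) (Pi.single i 1, 0) := by
  have h1 : HasFDerivAt (fun y : RN N => (y, t)) (ContinuousLinearMap.inl ℝ (RN N) ℝ) x :=
    hasFDerivAt_prodMk_left x t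
  have h2 : HasFDerivAt (fun y : RN N => Φ (y, t)) _ x := (hΦ (x, t)).hasFDerivAt.comp x h1
  rw [pd, h2.fderiv]
  rfl

lemma contDiff_pd_slice {Φ : RN N × ℝ → ℝ} (hΦ : ContDiff ℝ (⊤ : ℕ∞) Φ) (i : Fin N) :
    ContDiff ℝ (⊤ : ℕ∞) (fun q : RN N × ℝ => pd i (fun y => Φ (y, q.2)) q.1) := by
  have h1 : (fun q : RN N × ℝ => pd i (fun y => Φ (y, q.2)) q.1)
      = fun q => fderiv ℝ Φ q (Pi.single i 1, 0) := by
    funext q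
    exact pd_slice_eq (hΦ.differentiable (by simp)) i q.1 q.2
  rw [h1]
  exact (hΦ.fderiv_right (m := (⊤ : ℕ∞)) (by simp)).clm_apply contDiff_const

lemma hasDerivAt_slice {Φ : RN N × ℝ → ℝ} (hΦ : ContDiff ℝ (⊤ : ℕ∞) Φ) (x : RN N) (t : ℝ) :
    HasDerivAt (fun s => Φ (x, s)) (fderiv ℝ Φ (x, t) (0, 1)) t := by
  have h1 : HasDerivAt (fun s : ℝ => (x, s)) ((0 : RN N), (1 : ℝ)) t :=
    (hasDerivAt_const t x).prodMk (hasDerivAt_id t)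
  exact ((hΦ.differentiable (by simp)) (x, t)).hasFDerivAt.comp_hasDerivAt t h1

/-- Densities `m` that are regular enough to be differentiated once in time and space and solve
`∂ₜm - Δm + div w = 0` in the weak sense, with an integrable flux `w`. -/
structure FluxSol (N : ℕ) (T : ℝ) (m : RN N → ℝ → ℝ) (w : RN N → ℝ → RN N) : Prop where
  per : ∀ t, ZPeriodic fun x => m x t
  nonneg : ∀ x t, 0 ≤ m x t
  cont : ContinuousOn (fun q : RN N × ℝ => m q.1 q.2) ((univ : Set (RN N)) ×ˢ Icc 0 T)
  cont_t : ContinuousOn (fun q : RN N × ℝ => deriv (m q.1) q.2) ((univ : Set (RN N)) ×ˢ Icc 0 T)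
  cont_d : ∀ i, ContinuousOn (fun q : RN N × ℝ => pd i (fun y => m y q.2) q.1)
    ((univ : Set (RN N)) ×ˢ Icc 0 T)
  tdiff : ∀ x, ∀ t ∈ Ioo 0 T, DifferentiableAt ℝ (m x) t
  xdiff : ∀ t ∈ Icc 0 T, Differentiable ℝ (fun y => m y t)
  flux : IntegrableOn (fun q : RN N × ℝ => w q.1 q.2) (QQ N T)
  weak : ∀ φ : RN N → ℝ → ℝ, IsTest N φ → (∀ x, φ x 0 = 0) → (∀ x, φ x T = 0) →
    intQ N T (fun x t => m x t * deriv (φ x) t + dotp (w x t) (grad (fun y => φ y t) x)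
        + m x t * lap (fun y => φ y t) x) = 0

lemma continuous_slice {F : RN N × ℝ → ℝ} (hF : ContinuousOn F ((univ : Set (RN N)) ×ˢ Icc 0 T))
    {t : ℝ} (ht : t ∈ Icc 0 T) : Continuous fun x => F (x, t) :=
  hF.comp_continuous (f := fun x => (x, t)) (by fun_prop) fun x => ⟨mem_univ _, ht⟩

lemma continuousOn_slice {F : RN N × ℝ → ℝ} (hF : ContinuousOn F ((univ : Set (RN N)) ×ˢ Icc 0 T))
    (x : RN N) : ContinuousOn (fun t => F (x, t)) (Icc 0 T) :=
  hF.comp (f := fun t => (x, t)) (by fun_prop) fun t ht => ⟨mem_univ _, ht⟩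

variable {m : RN N → ℝ → ℝ} {w : RN N → ℝ → RN N}

lemma FluxSol.contDiff (h : FluxSol N T m w) {t : ℝ} (ht : t ∈ Icc 0 T) :
    ContDiff ℝ 1 fun x => m x t :=
  contDiff_one_of_pd (h.xdiff t ht) fun i => continuous_slice (h.cont_d i) ht

lemma FluxSol.flux_apply (h : FluxSol N T m w) (i : Fin N) :
    IntegrableOn (fun q : RN N × ℝ => w q.1 q.2 i) (QQ N T) :=
  (ContinuousLinearMap.proj (R := ℝ) (φ := fun _ : Fin N => ℝ) i).integrable_comp h.flux

lemma integrableOn_mul_of_bound {F G : RN N × ℝ → ℝ} (hF : IntegrableOn F (QQ N T))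
    (hG : Continuous G) {S : ℝ} (hS : ∀ q, |G q| ≤ S) :
    IntegrableOn (fun q => F q * G q) (QQ N T) :=
  hF.mul_bdd (c := S) hG.aestronglyMeasurable (Eventually.of_forall fun q => hS q)

lemma integral_mul_deriv_slice (hT : 0 < T) (h : FluxSol N T m w) {Φ : RN N × ℝ → ℝ}
    (hΦ : ContDiff ℝ (⊤ : ℕ∞) Φ) (h0 : ∀ x, Φ (x, 0) = 0) (hT0 : ∀ x, Φ (x, T) = 0) (x : RN N) :
    ∫ t in Ioo 0 T, m x t * fderiv ℝ Φ (x, t) (0, 1)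
      = -∫ t in Ioo 0 T, deriv (m x) t * Φ (x, t) := by
  have hΦc : Continuous fun t => Φ (x, t) := hΦ.continuous.comp (by fun_prop)
  have hΦd : Continuous fun t => fderiv ℝ Φ (x, t) (0, 1) :=
    (((hΦ.continuous_fderiv (by simp)).comp (f := fun t : ℝ => (x, t)) (by fun_prop))).clm_apply
      continuous_const
  have hc := continuousOn_slice h.cont x
  have hct := continuousOn_slice h.cont_t x
  have c1 : ContinuousOn (fun t => deriv (m x) t * Φ (x, t)) (Icc 0 T) := hct.mul hΦc.continuousOn
  have c2 : ContinuousOn (fun t => m x t * fderiv ℝ Φ (x, t) (0, 1)) (Icc 0 T) :=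
    hc.mul hΦd.continuousOn
  have key := intervalIntegral.integral_eq_sub_of_hasDerivAt_of_le hT.le
    (f := fun t => m x t * Φ (x, t))
    (f' := fun t => deriv (m x) t * Φ (x, t) + m x t * fderiv ℝ Φ (x, t) (0, 1))
    (hc.mul hΦc.continuousOn)
    (fun t ht => (h.tdiff x t ht).hasDerivAt.mul (hasDerivAt_slice hΦ x t))
    ((c1.add c2).intervalIntegrable_of_Icc hT.le)
  rw [intervalIntegral.integral_of_le hT.le, ← integral_Ioc_eq_integral_Ioo.symm] at key
  rw [integral_add (c1.integrableOn_Icc.mono_set Ioo_subset_Icc_self)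
    (c2.integrableOn_Icc.mono_set Ioo_subset_Icc_self), h0, hT0] at key
  linarith

lemma FluxSol.integral_test_eq_zero (hT : 0 < T) (h : FluxSol N T m w) {φ : RN N → ℝ → ℝ}
    (hφ : IsTest N φ) (hv : ∀ x t, t ≤ 0 ∨ T ≤ t → φ x t = 0) {S : ℝ}
    (hS : ∀ i x t, |pd i (fun y => φ y t) x| ≤ S) :
    ∫ q in QQ N T, (deriv (m q.1) q.2 * φ q.1 q.2
      + ∑ i, (pd i (fun y => m y q.2) q.1 - w q.1 q.2 i) * pd i (fun y => φ y q.2) q.1) = 0 := by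
  obtain ⟨hsm, hper⟩ := hφ
  set Φ : RN N × ℝ → ℝ := fun q => φ q.1 q.2 with hΦ
  have hw := h.weak φ ⟨hsm, hper⟩ (fun x => hv x 0 (Or.inl le_rfl))
    (fun x => hv x T (Or.inr le_rfl))
  have hpdsm := fun i => contDiff_pd_slice hsm i
  have hpc : ∀ i, Continuous fun q : RN N × ℝ => pd i (fun y => φ y q.2) q.1 := fun i =>
    (hpdsm i).continuous
  have hlc : Continuous fun q : RN N × ℝ => lap (fun y => φ y q.2) q.1 :=
    continuous_finsetSum _ fun i _ => (contDiff_pd_slice (hpdsm i) i).continuous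
  have hdt : ∀ x t, deriv (φ x) t = fderiv ℝ Φ (x, t) (0, 1) := fun x t =>
    (hasDerivAt_slice hsm x t).deriv
  have hdc : Continuous fun q : RN N × ℝ => fderiv ℝ Φ (q.1, q.2) (0, 1) :=
    (hsm.continuous_fderiv (by simp)).clm_apply continuous_const
  have i1 : IntegrableOn (fun q : RN N × ℝ => m q.1 q.2 * fderiv ℝ Φ (q.1, q.2) (0, 1)) (QQ N T) :=
    integrableOn_QQ (h.cont.mul hdc.continuousOn)
  have i1' : IntegrableOn (fun q : RN N × ℝ => deriv (m q.1) q.2 * φ q.1 q.2) (QQ N T) :=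
    integrableOn_QQ (h.cont_t.mul hsm.continuous.continuousOn)
  have i2 : ∀ i, IntegrableOn (fun q : RN N × ℝ => w q.1 q.2 i * pd i (fun y => φ y q.2) q.1)
      (QQ N T) := fun i => integrableOn_mul_of_bound (h.flux_apply i) (hpc i) fun q => hS i q.1 q.2
  have i2' : IntegrableOn (fun q : RN N × ℝ => dotp (w q.1 q.2) (grad (fun y => φ y q.2) q.1))
      (QQ N T) := integrable_finsetSum _ fun i _ => i2 i
  have i3 : IntegrableOn (fun q : RN N × ℝ => m q.1 q.2 * lap (fun y => φ y q.2) q.1) (QQ N T) :=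
    integrableOn_QQ (h.cont.mul hlc.continuousOn)
  have i3' : ∀ i, IntegrableOn (fun q : RN N × ℝ => pd i (fun y => m y q.2) q.1
      * pd i (fun y => φ y q.2) q.1) (QQ N T) := fun i =>
    integrableOn_QQ ((h.cont_d i).mul (hpc i).continuousOn)
  have i3'' : IntegrableOn (fun q : RN N × ℝ => dotp (grad (fun y => m y q.2) q.1)
      (grad (fun y => φ y q.2) q.1)) (QQ N T) := integrable_finsetSum _ fun i _ => i3' i
  have e1 : ∫ q in QQ N T, m q.1 q.2 * fderiv ℝ Φ (q.1, q.2) (0, 1)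
      = -∫ q in QQ N T, deriv (m q.1) q.2 * φ q.1 q.2 := by
    rw [setIntegral_QQ i1, setIntegral_QQ i1', ← integral_neg]
    refine integral_congr_ae (Eventually.of_forall fun x => ?_)
    exact integral_mul_deriv_slice hT h hsm (fun x => hv x 0 (Or.inl le_rfl))
      (fun x => hv x T (Or.inr le_rfl)) x
  have e3 : ∫ q in QQ N T, m q.1 q.2 * lap (fun y => φ y q.2) q.1
      = -∫ q in QQ N T, dotp (grad (fun y => m y q.2) q.1) (grad (fun y => φ y q.2) q.1) := by
    rw [setIntegral_QQ_symm i3, setIntegral_QQ_symm i3'', ← integral_neg]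
    refine setIntegral_congr_fun measurableSet_Ioo fun t ht => ?_
    refine integral_mul_lap (h.contDiff ⟨ht.1.le, ht.2.le⟩) ?_ (h.per t) (hper t)
    exact (hsm.comp (g := fun q : RN N × ℝ => φ q.1 q.2) (f := fun x : RN N => (x, t))
      (by fun_prop)).of_le (by norm_cast)
  have hw' : ∫ q in QQ N T, (m q.1 q.2 * fderiv ℝ Φ (q.1, q.2) (0, 1)
      + dotp (w q.1 q.2) (grad (fun y => φ y q.2) q.1)) + m q.1 q.2 * lap (fun y => φ y q.2) q.1
      = 0 := by
    simpa only [intQ, hdt] using hw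
  have i12 : IntegrableOn (fun q : RN N × ℝ => m q.1 q.2 * fderiv ℝ Φ (q.1, q.2) (0, 1)
      + dotp (w q.1 q.2) (grad (fun y => φ y q.2) q.1)) (QQ N T) := i1.add i2'
  rw [integral_add i12 i3, integral_add i1 i2', e1, e3] at hw'
  have e4 : ∀ q : RN N × ℝ, (deriv (m q.1) q.2 * φ q.1 q.2
      + ∑ i, (pd i (fun y => m y q.2) q.1 - w q.1 q.2 i) * pd i (fun y => φ y q.2) q.1)
      = deriv (m q.1) q.2 * φ q.1 q.2 + (dotp (grad (fun y => m y q.2) q.1)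
        (grad (fun y => φ y q.2) q.1) - dotp (w q.1 q.2) (grad (fun y => φ y q.2) q.1)) := by
    intro q
    simp only [dotp, grad, ← Finset.sum_sub_distrib, sub_mul]
  simp only [e4]
  have i4 : IntegrableOn (fun q : RN N × ℝ => dotp (grad (fun y => m y q.2) q.1)
      (grad (fun y => φ y q.2) q.1) - dotp (w q.1 q.2) (grad (fun y => φ y q.2) q.1)) (QQ N T) :=
    i3''.sub i2'
  rw [integral_add i1' i4, integral_sub i3'' i2']
  linarith

end WeakForm

section EnergyInequality

variable {N : ℕ} {T : ℝ}

/-- The nearest point of `[0,T]`. -/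
def clampTime (T t : ℝ) : ℝ := max 0 (min t T)

lemma continuous_clampTime : Continuous (clampTime T) := by
  unfold clampTime; fun_prop

lemma clampTime_mem (hT : 0 < T) (t : ℝ) : clampTime T t ∈ Icc 0 T :=
  ⟨le_max_left _ _, max_le hT.le (min_le_right _ _)⟩

lemma clampTime_eq {t : ℝ} (ht : t ∈ Icc 0 T) : clampTime T t = t := by
  rw [clampTime, min_eq_left ht.2, max_eq_right ht.1]

lemma continuous_comp_clampTime (hT : 0 < T) {F : RN N × ℝ → ℝ}
    (hF : ContinuousOn F ((univ : Set (RN N)) ×ˢ Icc 0 T)) :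
    Continuous fun q : RN N × ℝ => F (q.1, clampTime T q.2) :=
  hF.comp_continuous (f := fun q : RN N × ℝ => (q.1, clampTime T q.2))
    (continuous_fst.prodMk (continuous_clampTime.comp continuous_snd))
    fun _ => ⟨mem_univ _, clampTime_mem hT _⟩

lemma continuousOn_integral_slice (hT : 0 < T) {F : RN N × ℝ → ℝ}
    (hF : ContinuousOn F ((univ : Set (RN N)) ×ˢ Icc 0 T)) :
    ContinuousOn (fun t => ∫ x in cube N, F (x, t)) (Icc 0 T) := by
  have h1 : Continuous fun t => ∫ x in cube N, F (x, clampTime T t) :=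
    continuous_parametric_integral_of_continuous (s := cube N)
      (f := fun (t : ℝ) (x : RN N) => F (x, clampTime T t))
      ((continuous_comp_clampTime hT hF).comp continuous_swap) isCompact_cube
  refine h1.continuousOn.congr fun t ht => ?_
  simp only [clampTime_eq ht]

lemma hasDerivAt_integral_slice {F F' : RN N × ℝ → ℝ}
    (hF : ContinuousOn F ((univ : Set (RN N)) ×ˢ Icc 0 T))
    (hF' : ContinuousOn F' ((univ : Set (RN N)) ×ˢ Icc 0 T))
    (hd : ∀ x, ∀ t ∈ Ioo 0 T, HasDerivAt (fun t => F (x, t)) (F' (x, t)) t)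
    {t : ℝ} (ht : t ∈ Ioo 0 T) :
    HasDerivAt (fun t => ∫ x in cube N, F (x, t)) (∫ x in cube N, F' (x, t)) t := by
  obtain ⟨M, hM⟩ := ((isCompact_cube (N := N)).prod
    (isCompact_Icc (a := 0) (b := T))).exists_bound_of_continuousOn
    (hF'.mono (prod_mono (subset_univ _) le_rfl))
  refine (hasDerivAt_integral_of_dominated_loc_of_deriv_le
    (F := fun t x => F (x, t)) (F' := fun t x => F' (x, t)) (bound := fun _ => M) (s := Ioo 0 T)
    (Ioo_mem_nhds ht.1 ht.2) ?_ ?_ ?_ ?_ (integrable_const _) ?_).2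
  · filter_upwards [Ioo_mem_nhds ht.1 ht.2] with s hs
    exact (continuous_slice hF ⟨hs.1.le, hs.2.le⟩).aestronglyMeasurable
  · exact integrableOn_cube (continuous_slice hF ⟨ht.1.le, ht.2.le⟩)
  · exact (continuous_slice hF' ⟨ht.1.le, ht.2.le⟩).aestronglyMeasurable
  · refine (ae_restrict_iff' isCompact_cube.measurableSet).2 (Eventually.of_forall fun x hx s hs => ?_)
    exact hM (x, s) ⟨hx, hs.1.le, hs.2.le⟩
  · exact Eventually.of_forall fun x s hs => hd x s hs

variable {m : RN N → ℝ → ℝ} {w : RN N → ℝ → RN N}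

lemma FluxSol.integrableOn_weak (h : FluxSol N T m w) {g : RN N × ℝ → ℝ}
    {g' : Fin N → RN N × ℝ → ℝ} (hg : Continuous g) (hg' : ∀ i, Continuous (g' i)) {S : ℝ}
    (hgS' : ∀ i q, |g' i q| ≤ S) :
    IntegrableOn (fun q : RN N × ℝ => deriv (m q.1) q.2 * g q
      + ∑ i, (pd i (fun y => m y q.2) q.1 - w q.1 q.2 i) * g' i q) (QQ N T) :=
  (integrableOn_QQ (h.cont_t.mul hg.continuousOn)).add (integrable_finsetSum _ fun i _ =>
    integrableOn_mul_of_bound ((integrableOn_QQ (h.cont_d i)).sub (h.flux_apply i)) (hg' i) (hgS' i))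

lemma FluxSol.integral_eq_zero_of_vanish (hT : 0 < T) (h : FluxSol N T m w) {δ S : ℝ} (hδ : 0 < δ)
    {g : RN N × ℝ → ℝ} {g' : Fin N → RN N × ℝ → ℝ}
    (hg : Continuous g) (hg' : ∀ i, Continuous (g' i)) (hgS : ∀ q, |g q| ≤ S)
    (hgS' : ∀ i q, |g' i q| ≤ S) (hper : ∀ t, ZPeriodic fun x => g (x, t))
    (hd : ∀ i x t (s : ℝ), HasDerivAt (fun s : ℝ => g (x + s • (Pi.single i 1 : RN N), t))
      (g' i (x + s • (Pi.single i 1 : RN N), t)) s)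
    (hvan : ∀ x t, t < δ ∨ T - δ < t → g (x, t) = 0) :
    ∫ q in QQ N T, (deriv (m q.1) q.2 * g q
      + ∑ i, (pd i (fun y => m y q.2) q.1 - w q.1 q.2 i) * g' i q) = 0 := by
  obtain ⟨φ, hφ, hφv, hφS, hφS', hφt, hφt'⟩ :=
    exists_test_approx hδ hg hg' hgS hgS' hper hd hvan
  have hz := fun k => h.integral_test_eq_zero hT (hφ k) (hφv k) (hφS' k)
  have j1 : IntegrableOn (fun q : RN N × ℝ => deriv (m q.1) q.2) (QQ N T) :=
    integrableOn_QQ h.cont_t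
  have j2 : ∀ i, IntegrableOn (fun q : RN N × ℝ => pd i (fun y => m y q.2) q.1 - w q.1 q.2 i)
    (QQ N T) := fun i => (integrableOn_QQ (h.cont_d i)).sub (h.flux_apply i)
  have key := tendsto_integral_of_dominated_convergence (μ := volume.restrict (QQ N T))
    (F := fun k (q : RN N × ℝ) => deriv (m q.1) q.2 * φ k q.1 q.2
      + ∑ i, (pd i (fun y => m y q.2) q.1 - w q.1 q.2 i) * pd i (fun y => φ k y q.2) q.1)
    (f := fun q : RN N × ℝ => deriv (m q.1) q.2 * g q
      + ∑ i, (pd i (fun y => m y q.2) q.1 - w q.1 q.2 i) * g' i q)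
    (fun q : RN N × ℝ => ‖deriv (m q.1) q.2‖ * (3 * S)
      + ∑ i, ‖pd i (fun y => m y q.2) q.1 - w q.1 q.2 i‖ * (3 * S))
    (fun k => ((h.integrableOn_weak (hφ k).1.continuous
      (fun i => (contDiff_pd_slice (hφ k).1 i).continuous)
      (fun i q => hφS' k i q.1 q.2)).aestronglyMeasurable))
    ((j1.norm.mul_const _).add (integrable_finsetSum _ fun i _ => (j2 i).norm.mul_const _))
    (fun k => Eventually.of_forall fun q => ?_)
    (Eventually.of_forall fun q => ?_)
  · simp only [hz] at key
    exact (tendsto_nhds_unique key tendsto_const_nhds)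
  · refine (norm_add_le _ _).trans (add_le_add ?_ ((norm_sum_le _ _).trans
      (Finset.sum_le_sum fun i _ => ?_)))
    · rw [norm_mul]; exact mul_le_mul_of_nonneg_left (hφS k _ _) (norm_nonneg _)
    · rw [norm_mul]; exact mul_le_mul_of_nonneg_left (hφS' k i _ _) (norm_nonneg _)
  · exact ((hφt q.1 q.2).const_mul _).add (tendsto_finsetSum _ fun i _ =>
      (hφt' i q.1 q.2).const_mul _)

lemma FluxSol.ae_integral_eq_zero (hT : 0 < T) (h : FluxSol N T m w) {S : ℝ}
    {ψ : RN N × ℝ → ℝ} {ψ' : Fin N → RN N × ℝ → ℝ}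
    (hψ : Continuous ψ) (hψ' : ∀ i, Continuous (ψ' i)) (hψS : ∀ q, |ψ q| ≤ S)
    (hψS' : ∀ i q, |ψ' i q| ≤ S) (hper : ∀ t, ZPeriodic fun x => ψ (x, t))
    (hd : ∀ i x t (s : ℝ), HasDerivAt (fun s : ℝ => ψ (x + s • (Pi.single i 1 : RN N), t))
      (ψ' i (x + s • (Pi.single i 1 : RN N), t)) s) :
    ∀ᵐ t, t ∈ Ioo 0 T → ∫ x in cube N, (deriv (m x) t * ψ (x, t)
      + ∑ i, (pd i (fun y => m y t) x - w x t i) * ψ' i (x, t)) = 0 := by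
  have hJ := h.integrableOn_weak hψ hψ' hψS'
  have hJ' := hJ
  rw [IntegrableOn, restrict_QQ] at hJ'
  have hS0 : 0 ≤ S := (abs_nonneg _).trans (hψS (0, 0))
  have hI : IntegrableOn (fun t => ∫ x in cube N, (deriv (m x) t * ψ (x, t)
      + ∑ i, (pd i (fun y => m y t) x - w x t i) * ψ' i (x, t))) (Ioo 0 T) :=
    hJ'.integral_prod_right
  refine isOpen_Ioo.ae_eq_zero_of_integral_contDiff_smul_eq_zero hI.locallyIntegrableOn ?_
  intro χ hχ hχc hχs
  obtain ⟨δ, hδ, hδK⟩ := hχc.isCompact.exists_forall_le' (f := fun t => min t (T - t)) (a := 0)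
    (Continuous.continuousOn (by fun_prop)) fun t ht => by
      have := hχs ht
      exact lt_min this.1 (by linarith [this.2])
  have hχ0 : ∀ t, t < δ ∨ T - δ < t → χ t = 0 := by
    intro t ht
    refine image_eq_zero_of_notMem_tsupport fun hmem => ?_
    have := hδK t hmem
    rw [le_min_iff] at this
    rcases ht with h | h <;> linarith [this.1, this.2]
  obtain ⟨X, hX⟩ := hχc.exists_bound_of_continuous hχ.continuous
  have hX0 : 0 ≤ X := (norm_nonneg _).trans (hX 0)
  have hχcont := hχ.continuous
  have hzero := h.integral_eq_zero_of_vanish hT hδ (S := X * S)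
    (g := fun q => χ q.2 * ψ q) (g' := fun i q => χ q.2 * ψ' i q) (by fun_prop)
    (fun i => by have := hψ' i; fun_prop)
    (fun q => by rw [abs_mul]; exact mul_le_mul (hX _) (hψS _) (abs_nonneg _) hX0)
    (fun i q => by rw [abs_mul]; exact mul_le_mul (hX _) (hψS' i _) (abs_nonneg _) hX0)
    (fun t x z => congrArg (χ t * ·) (hper t x z)) (fun i x t s => (hd i x t s).const_mul (χ t))
    (fun x t ht => by simp only [hχ0 t ht, zero_mul])
  have e1 : ∀ q : RN N × ℝ, deriv (m q.1) q.2 * (χ q.2 * ψ q)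
      + ∑ i, (pd i (fun y => m y q.2) q.1 - w q.1 q.2 i) * (χ q.2 * ψ' i q)
      = χ q.2 * (deriv (m q.1) q.2 * ψ q
      + ∑ i, (pd i (fun y => m y q.2) q.1 - w q.1 q.2 i) * ψ' i q) := by
    intro q
    rw [mul_add, Finset.mul_sum]
    congr 1
    · ring
    · exact Finset.sum_congr rfl fun i _ => by ring
  simp only [e1] at hzero
  have hJχ : IntegrableOn (fun q : RN N × ℝ => χ q.2 * (deriv (m q.1) q.2 * ψ q
      + ∑ i, (pd i (fun y => m y q.2) q.1 - w q.1 q.2 i) * ψ' i q)) (QQ N T) :=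
    hJ.bdd_mul (c := X) (hχcont.comp continuous_snd).aestronglyMeasurable
      (Eventually.of_forall fun q => hX q.2)
  rw [setIntegral_QQ_symm hJχ] at hzero
  simp only [integral_const_mul] at hzero
  rw [← hzero]
  refine (setIntegral_eq_integral_of_forall_compl_eq_zero fun t ht => ?_).symm
  have : χ t = 0 := image_eq_zero_of_notMem_tsupport fun hmem => ht (hχs hmem)
  rw [this, zero_smul]

end EnergyInequality

section EnergyInequality

variable {N : ℕ} {T : ℝ} {m : RN N → ℝ → ℝ} {w : RN N → ℝ → RN N}

/-- The integral of `(1+m)^p` over the torus at time `t`. -/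
def powInt (m : RN N → ℝ → ℝ) (p t : ℝ) : ℝ := ∫ x in cube N, (1 + m x t) ^ p

/-- The time derivative of `powInt m p`. -/
def powIntDeriv (m : RN N → ℝ → ℝ) (p t : ℝ) : ℝ :=
  ∫ x in cube N, p * (1 + m x t) ^ (p - 1) * deriv (m x) t

/-- The `H¹` energy of `(1+m)^(p/2)` at time `t`. -/
def powEnergy (m : RN N → ℝ → ℝ) (p t : ℝ) : ℝ := h1Energy fun x => (1 + m x t) ^ (p / 2)

lemma FluxSol.one_add_pos (h : FluxSol N T m w) (x : RN N) (t : ℝ) : 0 < 1 + m x t := by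
  linarith [h.nonneg x t]

lemma FluxSol.continuousOn_rpow (h : FluxSol N T m w) (a : ℝ) :
    ContinuousOn (fun q : RN N × ℝ => (1 + m q.1 q.2) ^ a) ((univ : Set (RN N)) ×ˢ Icc 0 T) :=
  (continuousOn_const.add h.cont).rpow_const fun _ _ => Or.inl (h.one_add_pos _ _).ne'

lemma FluxSol.continuous_rpow (h : FluxSol N T m w) (a : ℝ) {t : ℝ} (ht : t ∈ Icc 0 T) :
    Continuous fun x => (1 + m x t) ^ a := continuous_slice (h.continuousOn_rpow a) ht

lemma FluxSol.continuousOn_powInt (hT : 0 < T) (h : FluxSol N T m w) (p : ℝ) :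
    ContinuousOn (powInt m p) (Icc 0 T) :=
  continuousOn_integral_slice hT (h.continuousOn_rpow p)

lemma FluxSol.continuousOn_powIntDeriv_density (h : FluxSol N T m w) (p : ℝ) :
    ContinuousOn (fun q : RN N × ℝ => p * (1 + m q.1 q.2) ^ (p - 1) * deriv (m q.1) q.2)
      ((univ : Set (RN N)) ×ˢ Icc 0 T) :=
  (continuousOn_const.mul (h.continuousOn_rpow _)).mul h.cont_t

lemma FluxSol.continuousOn_powIntDeriv (hT : 0 < T) (h : FluxSol N T m w) (p : ℝ) :
    ContinuousOn (powIntDeriv m p) (Icc 0 T) :=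
  continuousOn_integral_slice hT (h.continuousOn_powIntDeriv_density p)

lemma FluxSol.hasDerivAt_powInt (h : FluxSol N T m w) (p : ℝ) {t : ℝ} (ht : t ∈ Ioo 0 T) :
    HasDerivAt (powInt m p) (powIntDeriv m p t) t :=
  hasDerivAt_integral_slice (F := fun q : RN N × ℝ => (1 + m q.1 q.2) ^ p)
    (h.continuousOn_rpow p) (h.continuousOn_powIntDeriv_density p) (fun x s hs => by
      have h1 := ((h.tdiff x s hs).hasDerivAt.const_add 1).rpow_const (p := p)
        (Or.inl (h.one_add_pos x s).ne')
      exact h1.congr_deriv (by ring)) ht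

lemma FluxSol.powInt_pos (h : FluxSol N T m w) (p : ℝ) {t : ℝ} (ht : t ∈ Icc 0 T) :
    0 < powInt m p t := by
  have hc := h.continuous_rpow p ht
  have hne : (cube N).Nonempty := ⟨0, by simp [cube]⟩
  obtain ⟨x₀, -, hx₀⟩ := isCompact_cube.exists_isMinOn hne hc.continuousOn
  have h1 : ∫ x in cube N, (1 + m x₀ t) ^ p ≤ powInt m p t :=
    setIntegral_mono_on (integrable_const _) (integrableOn_cube hc)
      isCompact_cube.measurableSet fun x hx => hx₀ hx
  have := isProbabilityMeasure_cube (N := N)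
  rw [integral_const, probReal_univ, one_smul] at h1
  exact (Real.rpow_pos_of_pos (h.one_add_pos x₀ t) p).trans_le h1

lemma FluxSol.one_le_powInt (h : FluxSol N T m w) {p : ℝ} (hp : 0 ≤ p) {t : ℝ} (ht : t ∈ Icc 0 T) :
    1 ≤ powInt m p t := by
  have h1 : ∫ x in cube N, (1 : ℝ) ≤ powInt m p t :=
    setIntegral_mono_on (integrable_const _) (integrableOn_cube (h.continuous_rpow p ht))
      isCompact_cube.measurableSet fun x _ => Real.one_le_rpow (by linarith [h.nonneg x t]) hp
  have := isProbabilityMeasure_cube (N := N)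
  rwa [integral_const, probReal_univ, one_smul] at h1

lemma FluxSol.contDiff_rpow (h : FluxSol N T m w) (a : ℝ) {t : ℝ} (ht : t ∈ Icc 0 T) :
    ContDiff ℝ 1 fun x => (1 + m x t) ^ a :=
  (contDiff_const.add (h.contDiff ht)).rpow_const_of_ne fun x => (h.one_add_pos x t).ne'

lemma FluxSol.pd_rpow (h : FluxSol N T m w) (a : ℝ) {t : ℝ} (ht : t ∈ Icc 0 T) (i : Fin N)
    (x : RN N) : pd i (fun x => (1 + m x t) ^ a) x
      = a * (1 + m x t) ^ (a - 1) * pd i (fun x => m x t) x := by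
  have h1 := ((h.xdiff t ht x).hasFDerivAt.const_add 1).rpow_const (p := a)
    (Or.inl (h.one_add_pos x t).ne')
  rw [pd, h1.fderiv]
  rfl

lemma FluxSol.zperiodic_rpow (h : FluxSol N T m w) (a t : ℝ) :
    ZPeriodic fun x => (1 + m x t) ^ a :=
  fun x z => congrArg (fun s => (1 + s) ^ a) (h.per t x z)

lemma FluxSol.powEnergy_eq (h : FluxSol N T m w) (p : ℝ) {t : ℝ} (ht : t ∈ Icc 0 T) :
    powEnergy m p t = (∫ x in cube N, p ^ 2 / 4 * ((1 + m x t) ^ (p - 2)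
      * ∑ i, pd i (fun y => m y t) x ^ 2)) + powInt m p t := by
  have hc : Continuous fun x => p ^ 2 / 4 * ((1 + m x t) ^ (p - 2)
      * ∑ i, pd i (fun y => m y t) x ^ 2) :=
    continuous_const.mul ((h.continuous_rpow _ ht).mul (continuous_finsetSum _ fun i _ =>
      (continuous_slice (h.cont_d i) ht).pow 2))
  rw [powInt, ← integral_add (integrableOn_cube hc) (integrableOn_cube (h.continuous_rpow p ht)),
    powEnergy, h1Energy]
  refine integral_congr_ae (Eventually.of_forall fun x => ?_)
  have hn := h.one_add_pos x t
  simp only [h.pd_rpow _ ht]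
  have e1 : (1 + m x t) ^ (p - 2) = ((1 + m x t) ^ (p / 2 - 1)) ^ 2 := by
    rw [← Real.rpow_natCast, ← Real.rpow_mul hn.le]; congr 1; push_cast; ring
  have e2 : (1 + m x t) ^ p = ((1 + m x t) ^ (p / 2)) ^ 2 := by
    rw [← Real.rpow_natCast, ← Real.rpow_mul hn.le]; congr 1; push_cast; ring
  rw [e1, e2, Finset.mul_sum, Finset.mul_sum]
  congr 1
  exact Finset.sum_congr rfl fun i _ => by ring

lemma FluxSol.aestronglyMeasurable_mul (h : FluxSol N T m w) (a b : ℝ) :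
    AEStronglyMeasurable (fun q : RN N × ℝ => (1 + m q.1 q.2) ^ a * euclNorm (w q.1 q.2) ^ b)
      (volume.restrict (QQ N T)) :=
  (integrableOn_QQ (h.continuousOn_rpow a)).aestronglyMeasurable.mul
    (((continuous_euclNorm.measurable.pow_const b).comp_aemeasurable
      h.flux.aestronglyMeasurable.aemeasurable).aestronglyMeasurable)

lemma measurableSet_QQ : MeasurableSet (QQ N T) :=
  isCompact_cube.measurableSet.prod measurableSet_Ioo

lemma FluxSol.integrableOn_flux_sq (h : FluxSol N T m w) {D : ℝ}
    (hD : ∀ x, ∀ t ∈ Ioo 0 T, euclNorm (w x t) ≤ D * m x t) (a : ℝ) :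
    IntegrableOn (fun q : RN N × ℝ => (1 + m q.1 q.2) ^ a * euclNorm (w q.1 q.2) ^ 2) (QQ N T) := by
  have hg : ContinuousOn (fun q : RN N × ℝ => (1 + m q.1 q.2) ^ a * (D * m q.1 q.2) ^ 2)
      ((univ : Set (RN N)) ×ˢ Icc 0 T) :=
    (h.continuousOn_rpow a).mul ((continuousOn_const.mul h.cont).pow 2)
  refine Integrable.mono' (integrableOn_QQ hg) ?_ ?_
  · have := h.aestronglyMeasurable_mul a (2 : ℕ)
    simpa only [Real.rpow_natCast] using this
  · refine (ae_restrict_iff' measurableSet_QQ).2 (Eventually.of_forall fun q hq => ?_)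
    have h0 := Real.rpow_pos_of_pos (h.one_add_pos q.1 q.2) a
    rw [Real.norm_of_nonneg (by positivity)]
    exact mul_le_mul_of_nonneg_left
      (pow_le_pow_left₀ (euclNorm_nonneg _) (hD q.1 q.2 hq.2) 2) h0.le

lemma FluxSol.ae_powIntDeriv_le (hT : 0 < T) (h : FluxSol N T m w) {D : ℝ}
    (hD : ∀ x, ∀ t ∈ Ioo 0 T, euclNorm (w x t) ≤ D * m x t) {p : ℝ} (hp : 1 < p) :
    ∀ᵐ t, t ∈ Ioo 0 T → powIntDeriv m p t
      + 2 * (p - 1) / p * (powEnergy m p t - powInt m p t)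
      ≤ p * (p - 1) / 2 * ∫ x in cube N, (1 + m x t) ^ (p - 2) * euclNorm (w x t) ^ 2 := by
  have hψc := h.continuousOn_rpow (p - 1)
  have hψc' : ∀ i, ContinuousOn (fun q : RN N × ℝ => (p - 1) * (1 + m q.1 q.2) ^ (p - 1 - 1)
      * pd i (fun y => m y q.2) q.1) ((univ : Set (RN N)) ×ˢ Icc 0 T) := fun i =>
    (continuousOn_const.mul (h.continuousOn_rpow _)).mul (h.cont_d i)
  obtain ⟨S₀, hS₀⟩ := exists_bound_of_periodic (T := T) (g := fun x t => (1 + m x t) ^ (p - 1))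
    (h.zperiodic_rpow (p - 1)) hψc
  have hS := fun i => exists_bound_of_periodic (T := T)
    (g := fun x t => (p - 1) * (1 + m x t) ^ (p - 1 - 1) * pd i (fun y => m y t) x)
    (fun t x z => by
      have e1 := h.zperiodic_rpow (p - 1 - 1) t x z
      have e2 := zperiodic_pd (h.per t) i x z
      simp only at e1 e2
      simp only [e1, e2]) (hψc' i)
  choose S₁ hS₁ using hS
  have hae := h.ae_integral_eq_zero hT (S := |S₀| + ∑ i, |S₁ i|)
    (ψ := fun q => (1 + m q.1 (clampTime T q.2)) ^ (p - 1))
    (ψ' := fun i q => (p - 1) * (1 + m q.1 (clampTime T q.2)) ^ (p - 1 - 1)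
      * pd i (fun y => m y (clampTime T q.2)) q.1)
    (continuous_comp_clampTime hT hψc) (fun i => continuous_comp_clampTime hT (hψc' i))
    (fun q => (hS₀ _ _ (clampTime_mem hT _)).trans ((le_abs_self _).trans
      (le_add_of_nonneg_right (Finset.sum_nonneg fun i _ => abs_nonneg _))))
    (fun i q => (hS₁ i _ _ (clampTime_mem hT _)).trans ((le_abs_self _).trans
      ((Finset.single_le_sum (f := fun i => |S₁ i|) (fun i _ => abs_nonneg _)
        (Finset.mem_univ i)).trans (le_add_of_nonneg_left (abs_nonneg _)))))
    (fun t => h.zperiodic_rpow (p - 1) (clampTime T t))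
    (fun i x t s => by
      have hd := hasDerivAt_line (h.contDiff_rpow (p - 1) (clampTime_mem hT t)
        |>.differentiable one_ne_zero) x i 1 s
      simp only [one_mul] at hd
      rw [h.pd_rpow _ (clampTime_mem hT t)] at hd
      exact hd)
  have hWs : ∀ᵐ t, t ∈ Ioo 0 T → IntegrableOn
      (fun x => (1 + m x t) ^ (p - 2) * euclNorm (w x t) ^ 2) (cube N) := by
    have hW := h.integrableOn_flux_sq hD (p - 2)
    rw [IntegrableOn, restrict_QQ] at hW
    exact (ae_restrict_iff' measurableSet_Ioo).1 hW.prod_left_ae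
  have hws : ∀ᵐ t, t ∈ Ioo 0 T → ∀ i, IntegrableOn (fun x => w x t i) (cube N) := by
    have : ∀ i, ∀ᵐ t, t ∈ Ioo 0 T → IntegrableOn (fun x => w x t i) (cube N) := fun i => by
      have hW := h.flux_apply i
      rw [IntegrableOn, restrict_QQ] at hW
      exact (ae_restrict_iff' measurableSet_Ioo).1 hW.prod_left_ae
    filter_upwards [ae_all_iff.2 this] with t ht h1 i using ht i h1
  filter_upwards [hae, hWs, hws] with t h1 h2 h3 ht
  have htI : t ∈ Icc 0 T := Ioo_subset_Icc_self ht
  specialize h1 ht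
  specialize h2 ht
  specialize h3 ht
  simp only [clampTime_eq htI] at h1
  rw [h.powEnergy_eq p htI, add_sub_cancel_right, powIntDeriv, ← integral_const_mul,
    ← integral_const_mul]
  have i1 : IntegrableOn (fun x => p * (1 + m x t) ^ (p - 1) * deriv (m x) t) (cube N) :=
    integrableOn_cube (continuous_slice (h.continuousOn_powIntDeriv_density p) htI)
  have i2 : IntegrableOn (fun x => 2 * (p - 1) / p * (p ^ 2 / 4 * ((1 + m x t) ^ (p - 2)
      * ∑ i, pd i (fun y => m y t) x ^ 2))) (cube N) :=
    integrableOn_cube (continuous_const.mul (continuous_const.mul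
      ((h.continuous_rpow _ htI).mul (continuous_finsetSum _ fun i _ =>
      (continuous_slice (h.cont_d i) htI).pow 2))))
  have i3 : IntegrableOn (fun x => p * (deriv (m x) t * (1 + m x t) ^ (p - 1)
      + ∑ i, (pd i (fun y => m y t) x - w x t i)
        * ((p - 1) * (1 + m x t) ^ (p - 1 - 1) * pd i (fun y => m y t) x))) (cube N) := by
    refine Integrable.const_mul (Integrable.add (integrableOn_cube
      ((continuous_slice h.cont_t htI).mul (h.continuous_rpow _ htI)))
      (integrable_finsetSum _ fun i _ => ?_)) p
    have hc : Continuous fun x => (p - 1) * (1 + m x t) ^ (p - 1 - 1) * pd i (fun y => m y t) x :=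
      continuous_slice (hψc' i) htI
    obtain ⟨B, hB⟩ := isCompact_cube.exists_bound_of_continuousOn (hc.continuousOn (s := cube N))
    exact ((integrableOn_cube (continuous_slice (h.cont_d i) htI)).sub (h3 i)).mul_bdd (c := B)
      hc.aestronglyMeasurable ((ae_restrict_iff' isCompact_cube.measurableSet).2
        (Eventually.of_forall hB))
  have i4 : IntegrableOn (fun x => p * (p - 1) / 2 * ((1 + m x t) ^ (p - 2)
      * euclNorm (w x t) ^ 2)) (cube N) := h2.const_mul _
  have i12 : IntegrableOn (fun x => p * (1 + m x t) ^ (p - 1) * deriv (m x) t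
      + 2 * (p - 1) / p * (p ^ 2 / 4 * ((1 + m x t) ^ (p - 2)
      * ∑ i, pd i (fun y => m y t) x ^ 2))) (cube N) := i1.add i2
  have i34 : IntegrableOn (fun x => p * (deriv (m x) t * (1 + m x t) ^ (p - 1)
      + ∑ i, (pd i (fun y => m y t) x - w x t i)
        * ((p - 1) * (1 + m x t) ^ (p - 1 - 1) * pd i (fun y => m y t) x))
      + p * (p - 1) / 2 * ((1 + m x t) ^ (p - 2) * euclNorm (w x t) ^ 2)) (cube N) := i3.add i4
  have hle := integral_mono i12 i34 fun x => ?_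
  · rw [integral_add i1 i2, integral_add i3 i4, integral_const_mul p, h1, mul_zero, zero_add] at hle
    exact hle
  · have hn := Real.rpow_pos_of_pos (h.one_add_pos x t) (p - 2)
    have e : p - 1 - 1 = p - 2 := by ring
    simp only [e, euclNorm_sq]
    have hsum : ∑ i, (pd i (fun y => m y t) x - w x t i)
        * ((p - 1) * (1 + m x t) ^ (p - 2) * pd i (fun y => m y t) x)
        = (p - 1) * (1 + m x t) ^ (p - 2) * ∑ i, (pd i (fun y => m y t) x - w x t i)
          * pd i (fun y => m y t) x := by
      rw [Finset.mul_sum]; exact Finset.sum_congr rfl fun i _ => by ring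
    have hY : ∑ i, pd i (fun y => m y t) x ^ 2 ≤ 2 * (∑ i, (pd i (fun y => m y t) x - w x t i)
          * pd i (fun y => m y t) x) + ∑ i, w x t i ^ 2 := by
      rw [Finset.mul_sum, ← Finset.sum_add_distrib]
      exact Finset.sum_le_sum fun i _ => by
        nlinarith [sq_nonneg (pd i (fun y => m y t) x - w x t i)]
    rw [hsum]
    have hK : 0 ≤ p * (p - 1) / 2 * (1 + m x t) ^ (p - 2) :=
      mul_nonneg (by nlinarith) hn.le
    have := mul_le_mul_of_nonneg_left hY hK
    have e2 : 2 * (p - 1) / p * (p ^ 2 / 4) = p * (p - 1) / 2 := by field_simp; ring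
    rw [← mul_assoc (2 * (p - 1) / p), e2]
    linarith

lemma FluxSol.powInt_one (hT : 0 < T) (h : FluxSol N T m w) {t : ℝ} (ht : t ∈ Icc 0 T) :
    powInt m 1 t = powInt m 1 0 := by
  have hae := h.ae_integral_eq_zero hT (S := 1) (ψ := fun _ => 1) (ψ' := fun _ _ => 0)
    continuous_const (fun _ => continuous_const) (fun _ => by simp) (fun _ _ => by simp)
    (fun _ _ _ => rfl) (fun _ _ _ _ => hasDerivAt_const _ _)
  have hz : ∀ s ∈ Ioo 0 T, powIntDeriv m 1 s = 0 := by
    have hc : ContinuousOn (powIntDeriv m 1) (Ioo 0 T) :=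
      (h.continuousOn_powIntDeriv hT 1).mono Ioo_subset_Icc_self
    have h0 : powIntDeriv m 1 =ᵐ[volume.restrict (Ioo 0 T)] fun _ => (0 : ℝ) := by
      refine (ae_restrict_iff' measurableSet_Ioo).2 ?_
      filter_upwards [hae] with s hs hsI
      have := hs hsI
      simpa [powIntDeriv] using this
    exact Measure.eqOn_open_of_ae_eq h0 isOpen_Ioo hc continuousOn_const
  rcases eq_or_ne t 0 with rfl | ht0
  · rfl
  have htp : 0 < t := lt_of_le_of_ne ht.1 ht0.symm
  obtain ⟨s, hs, hs'⟩ := exists_hasDerivAt_eq_slope (powInt m 1) (powIntDeriv m 1) htp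
    ((h.continuousOn_powInt hT 1).mono (Icc_subset_Icc_right ht.2))
    fun s hs => h.hasDerivAt_powInt 1 ⟨hs.1, hs.2.trans_le ht.2⟩
  rw [hz s ⟨hs.1, hs.2.trans_le ht.2⟩, eq_comm, div_eq_zero_iff] at hs'
  rcases hs' with h1 | h1 <;> linarith

end EnergyInequality

section MoserIteration

variable {N : ℕ} {T : ℝ} {m : RN N → ℝ → ℝ} {w : RN N → ℝ → RN N}

lemma le_of_integral_rpow_le {n : RN N → ℝ} (hc : Continuous n) (hper : ZPeriodic n)
    (hpos : ∀ x, 0 < n x) {Θ : ℝ} (hΘ : 0 < Θ) {P : ℕ → ℝ} (hP : Tendsto P atTop atTop)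
    (h : ∀ k, ∫ x in cube N, n x ^ P k ≤ Θ ^ P k) (x : RN N) : n x ≤ Θ := by
  refine hper.forall_of_cube (P := fun s => s ≤ Θ) (fun x₀ hx₀ => ?_) x
  by_contra! hlt
  set Θ' : ℝ := (Θ + n x₀) / 2 with hΘ'
  have h1 : Θ < Θ' := by rw [hΘ']; linarith
  have h2 : Θ' < n x₀ := by rw [hΘ']; linarith
  have hU : IsOpen {x | Θ' < n x} := isOpen_lt continuous_const hc
  have hprob := isProbabilityMeasure_cube (N := N)
  set μ := (volume : Measure (RN N)).restrict (cube N) with hμ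
  have hu0 : μ.real {x | Θ' < n x} = 0 := by
    by_contra hne
    have hupos : 0 < μ.real {x | Θ' < n x} := lt_of_le_of_ne measureReal_nonneg (Ne.symm hne)
    have hbound : ∀ k, 0 ≤ P k → (Θ' / Θ) ^ P k * μ.real {x | Θ' < n x} ≤ 1 := by
      intro k hk
      have e : ∫ x in {x | Θ' < n x}, Θ' ^ P k ∂μ ≤ Θ ^ P k := by
        refine le_trans ?_ (h k)
        have hint : Integrable (fun x => n x ^ P k) μ :=
          integrableOn_cube (continuous_rpow_of_pos hc hpos _)
        refine le_trans (setIntegral_mono_on (integrable_const _) hint.integrableOn hU.measurableSet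
          fun x hx => Real.rpow_le_rpow (by linarith) (le_of_lt hx) hk) ?_
        exact setIntegral_le_integral hint
          (Eventually.of_forall fun x => Real.rpow_nonneg (hpos x).le _)
      rw [setIntegral_const, smul_eq_mul] at e
      rw [Real.div_rpow (by linarith) hΘ.le, div_mul_eq_mul_div,
        div_le_one (Real.rpow_pos_of_pos hΘ _)]
      linarith
    have ht : Tendsto (fun k => (Θ' / Θ) ^ P k) atTop atTop :=
      (tendsto_rpow_atTop_of_base_gt_one _ ((one_lt_div hΘ).2 h1)).comp hP
    obtain ⟨k, hk, hk'⟩ := ((ht.eventually_gt_atTop (1 / μ.real {x | Θ' < n x})).and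
      (hP.eventually_ge_atTop 0)).exists
    rw [div_lt_iff₀ hupos] at hk
    linarith [hbound k hk']
  have hu : μ {x | Θ' < n x} = 0 := (measureReal_eq_zero_iff).1 hu0
  have hball := lintegral_closedBall_le_of_periodic
    (h := indicator {x | Θ' < n x} fun _ => (1 : ENNReal))
    (measurable_const.indicator hU.measurableSet) fun x z => by
      simp only [indicator, mem_ofPred_eq, hper x z]
  rw [← hμ, lintegral_indicator hU.measurableSet, lintegral_indicator hU.measurableSet,
    setLIntegral_one, setLIntegral_one, hu, mul_zero, nonpos_iff_eq_zero,
    Measure.restrict_apply hU.measurableSet] at hball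
  have hpos' := (hU.inter (Metric.isOpen_ball (x := (0 : RN N)) (ε := 2))).measure_pos volume
    ⟨x₀, h2, by
      rw [Metric.mem_ball, dist_zero_right]
      refine lt_of_le_of_lt ((pi_norm_le_iff_of_nonneg zero_le_one).2 fun i => ?_) one_lt_two
      rw [Real.norm_of_nonneg (hx₀.1 i)]
      exact hx₀.2 i⟩
  exact hpos'.ne' (measure_mono_null (inter_subset_inter_right _ Metric.ball_subset_closedBall) hball)

lemma nonpos_of_ae_nonpos {g : ℝ → ℝ} (hg : ContinuousOn g (Ioo 0 T))
    (h : ∀ᵐ t, t ∈ Ioo 0 T → g t ≤ 0) {t : ℝ} (ht : t ∈ Ioo 0 T) : g t ≤ 0 := by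
  have h0 : (fun t => max (g t) 0) =ᵐ[volume.restrict (Ioo 0 T)] fun _ => (0 : ℝ) := by
    refine (ae_restrict_iff' measurableSet_Ioo).2 ?_
    filter_upwards [h] with s hs hsI
    exact max_eq_right (hs hsI)
  have := Measure.eqOn_open_of_ae_eq h0 isOpen_Ioo (ContinuousOn.sup hg continuousOn_const)
    continuousOn_const ht
  exact max_eq_right_iff.1 this

lemma le_of_barrier {y y' : ℝ → ℝ} {B : ℝ} (hT : 0 < T) (hy : ContinuousOn y (Icc 0 T))
    (hy' : ∀ t ∈ Ioo 0 T, HasDerivAt y (y' t) t) (h0 : y 0 ≤ B)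
    (hB : ∀ t ∈ Ioo 0 T, B < y t → y' t < 0) {t : ℝ} (ht : t ∈ Icc 0 T) : y t ≤ B := by
  obtain ⟨s, hs, hmax⟩ := isCompact_Icc.exists_isMaxOn ⟨0, left_mem_Icc.2 hT.le⟩ hy
  refine (hmax ht).trans ?_
  by_contra! hlt
  have hs0 : 0 < s := lt_of_le_of_ne hs.1 fun h => by rw [← h] at hlt; linarith
  have hev : ∀ᶠ r in 𝓝[<] s, B < y r := by
    have h1 : ∀ᶠ r in 𝓝[Icc 0 T] s, B < y r := (hy s hs).eventually_const_lt hlt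
    refine (nhdsWithin_le_of_mem ?_ : 𝓝[<] s ≤ 𝓝[Icc 0 T] s) h1
    filter_upwards [Ioo_mem_nhdsLT hs0] with r hr using ⟨hr.1.le, hr.2.le.trans hs.2⟩
  obtain ⟨l, hl, hlB⟩ := (mem_nhdsLT_iff_exists_Ioo_subset' hs0).1 (hev.and (Ioo_mem_nhdsLT hs0))
  have hls : l < s := hl
  set r := (l + s) / 2 with hr
  have hrm : r ∈ Ioo l s := ⟨by rw [hr]; linarith, by rw [hr]; linarith⟩
  have hr0 : 0 < r := (hlB hrm).2.1
  obtain ⟨c, hc, hc'⟩ := exists_hasDerivAt_eq_slope y y' hrm.2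
    (hy.mono (Icc_subset_Icc hr0.le hs.2))
    fun c hc => hy' c ⟨hr0.trans hc.1, hc.2.trans_le hs.2⟩
  have hneg := hB c ⟨hr0.trans hc.1, hc.2.trans_le hs.2⟩ (hlB ⟨hrm.1.trans hc.1, hc.2⟩).1
  rw [hc', div_neg_iff] at hneg
  have := hmax (show r ∈ Icc 0 T from ⟨hr0.le, hrm.2.le.trans hs.2⟩)
  simp only [mem_ofPred_eq] at this
  rcases hneg with h | h <;> linarith [h.1, h.2, hrm.2]

lemma FluxSol.flux_sq_le (h : FluxSol N T m w) {D : ℝ}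
    (hD : ∀ x, ∀ t ∈ Ioo 0 T, euclNorm (w x t) ≤ D * m x t) (p : ℝ) :
    ∀ᵐ t, t ∈ Ioo 0 T → ∫ x in cube N, (1 + m x t) ^ (p - 2) * euclNorm (w x t) ^ 2
      ≤ D ^ 2 * powInt m p t := by
  have hW := h.integrableOn_flux_sq hD (p - 2)
  rw [IntegrableOn, restrict_QQ] at hW
  filter_upwards [(ae_restrict_iff' measurableSet_Ioo).1 hW.prod_left_ae] with t hWt ht
  rw [powInt, ← integral_const_mul]
  refine integral_mono (hWt ht) ((integrableOn_cube
    (h.continuous_rpow p (Ioo_subset_Icc_self ht))).const_mul _) fun x => ?_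
  have hn := h.one_add_pos x t
  have e : (1 + m x t) ^ p = (1 + m x t) ^ (p - 2) * (1 + m x t) ^ 2 := by
    rw [← Real.rpow_natCast, ← Real.rpow_add hn]; congr 1; push_cast; ring
  simp only [e]
  have h1 : euclNorm (w x t) ^ 2 ≤ (D * m x t) ^ 2 :=
    pow_le_pow_left₀ (euclNorm_nonneg _) (hD x t ht) 2
  have h2 : (D * m x t) ^ 2 ≤ D ^ 2 * (1 + m x t) ^ 2 := by
    have := h.nonneg x t
    rw [mul_pow]
    exact mul_le_mul_of_nonneg_left (by nlinarith) (sq_nonneg D)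
  have h3 := mul_le_mul_of_nonneg_left (h1.trans h2) (Real.rpow_pos_of_pos hn (p - 2)).le
  linarith

lemma integral_sq_rpow_le {v : RN N → ℝ} (hv : Continuous v) (hpos : ∀ x, 0 < v x) {β : ℝ}
    (hβ : 0 < β) : (∫ x in cube N, v x ^ (2 : ℝ)) ^ (1 + β)
      ≤ (∫ x in cube N, v x ^ (2 + 1 * β)) * (∫ x in cube N, v x ^ (1 : ℝ)) ^ β := by
  have hint := fun a => integrableOn_cube (continuous_rpow_of_pos hv hpos a)
  have hnn := fun a => integral_nonneg (μ := volume.restrict (cube N))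
    (f := fun x => v x ^ a) fun x => Real.rpow_nonneg (hpos x).le a
  have hβ1 : 0 < 1 + β := by linarith
  have key := integral_rpow_mul_rpow_le (hint (1 : ℝ)) (hint (2 + 1 * β))
    (fun x => Real.rpow_nonneg (hpos x).le _) (fun x => Real.rpow_nonneg (hpos x).le _)
    (θ := 1 / (1 + β)) (by positivity) (by rw [div_lt_one hβ1]; linarith)
  have e : ∀ x, (v x ^ (1 : ℝ)) ^ (1 - 1 / (1 + β)) * (v x ^ (2 + 1 * β)) ^ (1 / (1 + β))
      = v x ^ (2 : ℝ) := fun x => by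
    rw [← Real.rpow_mul (hpos x).le, ← Real.rpow_mul (hpos x).le, ← Real.rpow_add (hpos x)]
    congr 1; field_simp; ring
  simp only [e] at key
  refine (Real.rpow_le_rpow (hnn 2) key hβ1.le).trans (le_of_eq ?_)
  rw [Real.mul_rpow (Real.rpow_nonneg (hnn 1) _) (Real.rpow_nonneg (hnn _) _),
    ← Real.rpow_mul (hnn 1), ← Real.rpow_mul (hnn _), mul_comm]
  have e1 : 1 / (1 + β) * (1 + β) = 1 := by field_simp
  have e2 : (1 - 1 / (1 + β)) * (1 + β) = β := by field_simp; ring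
  rw [e1, e2, Real.rpow_one]

lemma exists_moser_step (hN : 1 ≤ N) {β : ℝ} (hβ0 : 0 < β) (hβ : β < 2 / N) (hT : 0 < T) :
    ∃ C : ℝ, 1 ≤ C ∧ ∀ {m : RN N → ℝ → ℝ} {w : RN N → ℝ → RN N} {D p A : ℝ},
      FluxSol N T m w → 1 ≤ D → (∀ x, ∀ t ∈ Ioo 0 T, euclNorm (w x t) ≤ D * m x t) → 2 ≤ p →
      (∀ t ∈ Icc 0 T, powInt m (p / 2) t ≤ A) → ∀ t ∈ Icc 0 T,
      powInt m p t ≤ max (powInt m p 0) (((p * D) ^ 2 * C) ^ (1 / β) * A ^ 2) := by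
  obtain ⟨C₀, hC₀, hMI⟩ := multiplicative_interpolation hN hβ0 hβ one_pos
  refine ⟨C₀ + 1, by linarith, fun {m w D p A} h hD1 hD hp hA t ht => ?_⟩
  have hA1 : 1 ≤ A := (h.one_le_powInt (by linarith) ht).trans (hA t ht)
  set C := C₀ + 1 with hC
  have hC1 : 1 ≤ C := by rw [hC]; linarith
  have hpD : 2 ≤ p * D := by nlinarith
  have hKpos : 0 < C * A ^ (2 * β) := by positivity
  have hener : ∀ t ∈ Ioo 0 T, powInt m p t ^ (1 + β) ≤ C * powEnergy m p t * A ^ (2 * β) := by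
    intro t ht
    have htI := Ioo_subset_Icc_self ht
    have hvpos : ∀ x, 0 < (1 + m x t) ^ (p / 2) := fun x =>
      Real.rpow_pos_of_pos (h.one_add_pos x t) _
    have h1 := integral_sq_rpow_le (h.continuous_rpow (p / 2) htI) hvpos hβ0
    have h2 := hMI _ (h.contDiff_rpow (p / 2) htI) (h.zperiodic_rpow _ _) hvpos
    simp only [← Real.rpow_mul (h.one_add_pos _ _).le, div_mul_cancel₀ p (two_ne_zero' ℝ),
      mul_one] at h1 h2
    have hE : 0 ≤ h1Energy fun x => (1 + m x t) ^ (p / 2) := h1Energy_nonneg _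
    have hI0 : 0 ≤ ∫ x in cube N, (1 + m x t) ^ (p / 2) := integral_nonneg fun x => (hvpos x).le
    have hI : ∫ x in cube N, (1 + m x t) ^ (p / 2) ≤ A := hA t htI
    have hIβ := Real.rpow_le_rpow hI0 hI hβ0.le
    calc powInt m p t ^ (1 + β) ≤ _ := h1
      _ ≤ (C₀ * powEnergy m p t * A ^ β) * A ^ β :=
        mul_le_mul (h2.trans (mul_le_mul_of_nonneg_left hIβ (mul_nonneg hC₀ hE))) hIβ
          (Real.rpow_nonneg hI0 _) (by have : 0 ≤ powEnergy m p t := hE; positivity)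
      _ = C₀ * powEnergy m p t * A ^ (2 * β) := by
        rw [mul_assoc, ← Real.rpow_add (by linarith)]; ring_nf
      _ ≤ _ := by
        refine mul_le_mul_of_nonneg_right (mul_le_mul_of_nonneg_right (by linarith) hE)
          (by positivity)
  have hderiv : ∀ t ∈ Ioo 0 T, powIntDeriv m p t ≤ (p * D) ^ 2 * powInt m p t
      - powInt m p t ^ (1 + β) / (C * A ^ (2 * β)) := by
    intro t ht
    have hcy := (h.continuousOn_powInt hT p).mono Ioo_subset_Icc_self
    have hg : ContinuousOn (fun t => powIntDeriv m p t - ((p * D) ^ 2 * powInt m p t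
        - powInt m p t ^ (1 + β) / (C * A ^ (2 * β)))) (Ioo 0 T) :=
      ((h.continuousOn_powIntDeriv hT p).mono Ioo_subset_Icc_self).sub
        ((continuousOn_const.mul hcy).sub ((hcy.rpow_const fun s _ => Or.inr (by linarith)).div_const _))
    refine sub_nonpos.1 (nonpos_of_ae_nonpos hg ?_ ht)
    filter_upwards [h.ae_powIntDeriv_le hT hD (by linarith : 1 < p), h.flux_sq_le hD p]
      with s hs1 hs2 hs
    specialize hs1 hs
    specialize hs2 hs
    have hsI := Ioo_subset_Icc_self hs
    have hy := h.powInt_pos p hsI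
    have hEs : powInt m p s ^ (1 + β) / (C * A ^ (2 * β)) ≤ powEnergy m p s := by
      rw [div_le_iff₀ hKpos]; linarith [hener s hs]
    have hEy : 0 ≤ powEnergy m p s := h1Energy_nonneg _
    have c1 : 1 ≤ 2 * (p - 1) / p := by rw [le_div_iff₀ (by linarith)]; linarith
    have c2 : 2 * (p - 1) / p ≤ 2 := by rw [div_le_iff₀ (by linarith)]; linarith
    have c3 : p * (p - 1) / 2 * (D ^ 2 * powInt m p s) ≤ (p * D) ^ 2 / 2 * powInt m p s := by
      have : 0 ≤ D ^ 2 * powInt m p s := by positivity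
      nlinarith
    have c4 := mul_le_mul_of_nonneg_left hs2 (by nlinarith : 0 ≤ p * (p - 1) / 2)
    have c5 : 2 * powInt m p s ≤ (p * D) ^ 2 / 2 * powInt m p s :=
      mul_le_mul_of_nonneg_right (by nlinarith) hy.le
    have c6 := mul_le_mul_of_nonneg_right c1 hEy
    have c7 := mul_le_mul_of_nonneg_right c2 hy.le
    rw [mul_sub] at hs1
    linarith
  refine le_of_barrier hT (h.continuousOn_powInt hT p) (fun t ht => h.hasDerivAt_powInt p ht)
    (le_max_left _ _) (fun t ht hlt => ?_) ht
  have hy := h.powInt_pos p (Ioo_subset_Icc_self ht)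
  refine (hderiv t ht).trans_lt ?_
  rw [sub_neg, lt_div_iff₀ hKpos, Real.rpow_add hy, Real.rpow_one]
  have h1 := (le_max_right _ _).trans_lt hlt
  have h2 := Real.rpow_lt_rpow (by positivity) h1 hβ0
  rw [Real.mul_rpow (by positivity) (by positivity), ← Real.rpow_mul (by positivity),
    one_div_mul_cancel hβ0.ne', Real.rpow_one, ← Real.rpow_natCast A 2,
    ← Real.rpow_mul (by linarith)] at h2
  push_cast at h2
  nlinarith

lemma exists_moser_bound (hN : 1 ≤ N) {β : ℝ} (hβ0 : 0 < β) (hβ : β < 2 / N) (hT : 0 < T)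
    {p₀ : ℝ} (hp₀ : 1 ≤ p₀) {A₀ N₀ : ℝ} (hA₀ : 1 ≤ A₀) (hN₀ : 1 ≤ N₀) :
    ∃ K : ℝ, 0 < K ∧ ∀ {m : RN N → ℝ → ℝ} {w : RN N → ℝ → RN N} {D : ℝ},
      FluxSol N T m w → 1 ≤ D → (∀ x, ∀ t ∈ Ioo 0 T, euclNorm (w x t) ≤ D * m x t) →
      (∀ t ∈ Icc 0 T, powInt m p₀ t ≤ A₀) → (∀ x, 1 + m x 0 ≤ N₀) →
      ∀ x, ∀ t ∈ Icc 0 T, 1 + m x t ≤ K * D ^ (2 / (β * p₀)) := by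
  obtain ⟨C, hC, hstep⟩ := exists_moser_step hN hβ0 hβ hT
  have hp0 : 0 < p₀ := by linarith
  have hs0 : 0 ≤ 1 / β * Real.log 4 := mul_nonneg (by positivity) (Real.log_nonneg (by norm_num))
  refine ⟨Real.exp ((Real.log A₀ + p₀ * Real.log N₀ + 1 / β * Real.log (p₀ ^ 2 * C)
    + 2 * (1 / β * Real.log 4)) / p₀), Real.exp_pos _, fun {m w D} h hD1 hD hA hN0 x t ht => ?_⟩
  have hDpos : 0 < D := by linarith
  set s := 1 / β * Real.log 4 with hs
  set S := 1 / β * Real.log (p₀ ^ 2 * C * D ^ 2) with hS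
  set X := Real.log A₀ + p₀ * Real.log N₀ + S + 2 * s with hX
  have hS0 : 0 ≤ S := mul_nonneg (by positivity) (Real.log_nonneg (by
    have h1 : 1 ≤ p₀ ^ 2 := one_le_pow₀ hp₀
    have h2 : 1 ≤ D ^ 2 := one_le_pow₀ hD1
    nlinarith [mul_le_mul h1 hC zero_le_one (by positivity : 0 ≤ p₀ ^ 2),
      mul_le_mul (mul_le_mul h1 hC zero_le_one (by positivity : 0 ≤ p₀ ^ 2)) h2 zero_le_one
        (by positivity : 0 ≤ p₀ ^ 2 * C)]))
  have hlA := Real.log_nonneg hA₀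
  have hlN := Real.log_nonneg hN₀
  have hX1 : S + 2 * s ≤ X := by rw [hX]; nlinarith
  have h0I : (0 : ℝ) ∈ Icc 0 T := left_mem_Icc.2 hT.le
  have hind : ∀ k : ℕ, ∀ t ∈ Icc 0 T,
      powInt m (p₀ * 2 ^ k) t ≤ Real.exp (2 ^ k * X - S - (k + 2) * s) := by
    intro k
    induction k with
    | zero =>
      intro t ht
      rw [pow_zero, mul_one]
      refine (hA t ht).trans ?_
      rw [← Real.log_le_iff_le_exp (by linarith), hX]
      push_cast
      nlinarith
    | succ k ih =>
      intro t ht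
      have h2k : (1 : ℝ) ≤ 2 ^ k := one_le_pow₀ one_le_two
      have hk2 : (k : ℝ) + 1 ≤ 2 ^ k := by exact_mod_cast Nat.lt_two_pow_self (n := k)
      have hp2 : 2 ≤ p₀ * 2 ^ (k + 1) := by rw [pow_succ]; nlinarith
      have e : p₀ * 2 ^ (k + 1) / 2 = p₀ * 2 ^ k := by rw [pow_succ]; ring
      refine (hstep h hD1 hD hp2 (A := Real.exp (2 ^ k * X - S - (k + 2) * s))
        (by rw [e]; exact ih) t ht).trans (max_le ?_ ?_)
      · have h1 : powInt m (p₀ * 2 ^ (k + 1)) 0 ≤ N₀ ^ (p₀ * 2 ^ (k + 1)) := by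
          have := isProbabilityMeasure_cube (N := N)
          have h2 : powInt m (p₀ * 2 ^ (k + 1)) 0 ≤ ∫ x in cube N, N₀ ^ (p₀ * 2 ^ (k + 1)) :=
            integral_mono (integrableOn_cube (h.continuous_rpow _ h0I)) (integrable_const _)
              fun x => Real.rpow_le_rpow (h.one_add_pos x 0).le (hN0 x) (by positivity)
          rwa [integral_const, probReal_univ, one_smul] at h2
        refine h1.trans ?_
        rw [Real.rpow_def_of_pos (by linarith), Real.exp_le_exp, hX, pow_succ]
        push_cast
        have : S + (k + 3) * s ≤ 2 ^ k * 2 * (S + 2 * s) := by nlinarith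
        nlinarith
      · have hb : 0 < (p₀ * 2 ^ (k + 1) * D) ^ 2 * C := by positivity
        have elog : Real.log ((p₀ * 2 ^ (k + 1) * D) ^ 2 * C)
            = Real.log (p₀ ^ 2 * C * D ^ 2) + (k + 1) * Real.log 4 := by
          have : (p₀ * 2 ^ (k + 1) * D) ^ 2 * C = p₀ ^ 2 * C * D ^ 2 * 4 ^ (k + 1) := by
            rw [show (4 : ℝ) = 2 ^ 2 by norm_num, ← pow_mul]; ring
          rw [this, Real.log_mul (by positivity) (by positivity), Real.log_pow]
          push_cast; ring
        rw [Real.rpow_def_of_pos hb, elog, ← Real.exp_nat_mul, ← Real.exp_add, Real.exp_le_exp,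
          pow_succ (2 : ℝ) k]
        push_cast
        have : (Real.log (p₀ ^ 2 * C * D ^ 2) + (k + 1) * Real.log 4) * (1 / β)
            = S + (k + 1) * s := by rw [hS, hs]; ring
        rw [this]
        linarith
  have hfin := le_of_integral_rpow_le (n := fun x => 1 + m x t) (Θ := Real.exp (X / p₀))
    (P := fun k : ℕ => p₀ * 2 ^ k)
    (continuous_const.add (h.contDiff ht).continuous)
    (fun x z => congrArg (1 + ·) (h.per t x z)) (fun x => h.one_add_pos x t) (Real.exp_pos _)
    ((tendsto_pow_atTop_atTop_of_one_lt one_lt_two).const_mul_atTop hp0)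
    (fun k => by
      refine (hind k t ht).trans ?_
      rw [← Real.exp_mul, Real.exp_le_exp]
      have : X / p₀ * (p₀ * 2 ^ k) = 2 ^ k * X := by field_simp
      rw [this]
      have : 0 ≤ ((k : ℝ) + 2) * s := by positivity
      linarith) x
  refine hfin.trans (le_of_eq ?_)
  rw [Real.rpow_def_of_pos hDpos, ← Real.exp_add]
  congr 1
  rw [hX, hS, Real.log_mul (by positivity) (by positivity), Real.log_pow]
  push_cast
  field_simp
  ring

end MoserIteration

section IntegralBounds

variable {N : ℕ} {T γ' : ℝ} {m : RN N → ℝ → ℝ} {w : RN N → ℝ → RN N}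

lemma kinQ_nonneg (mv : ℝ) (wv : RN N) : 0 ≤ kinQ γ' mv wv := by
  unfold kinQ
  split_ifs with h
  · exact mul_nonneg (Real.rpow_nonneg (euclNorm_nonneg _) _) (Real.rpow_nonneg h.le _)
  · exact le_rfl

lemma rpow_mul_rpow_le_add {k s a l : ℝ} (hk : 0 ≤ k) (hs : 0 ≤ s) (ha0 : 0 < a) (ha1 : a < 1)
    (hl : 0 < l) : k ^ a * s ^ (1 - a) ≤ l ^ ((1 - a) / a) * k + s / l := by
  have h1 : 0 ≤ l ^ ((1 - a) / a) * k := mul_nonneg (Real.rpow_nonneg hl.le _) hk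
  have h2 : 0 ≤ s / l := div_nonneg hs hl.le
  have h := Real.geom_mean_le_arith_mean2_weighted ha0.le (sub_nonneg.2 ha1.le) h1 h2 (by ring)
  rw [Real.mul_rpow (Real.rpow_nonneg hl.le _) hk, Real.div_rpow hs hl.le, ← Real.rpow_mul hl.le,
    div_mul_cancel₀ _ ha0.ne'] at h
  have hl' := Real.rpow_pos_of_pos hl (1 - a)
  have e : l ^ (1 - a) * k ^ a * (s ^ (1 - a) / l ^ (1 - a)) = k ^ a * s ^ (1 - a) := by
    field_simp
  rw [e] at h
  nlinarith

lemma flux_sq_le_kinQ_add {mv D : ℝ} {wv : RN N} (h2 : 2 < γ') (hm : 0 ≤ mv)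
    (hD : euclNorm wv ≤ D * mv) (p : ℝ) {l : ℝ} (hl : 0 < l) :
    (1 + mv) ^ (p - 2) * euclNorm wv ^ 2
      ≤ l ^ ((γ' - 2) / 2) * kinQ γ' mv wv + (1 + mv) ^ ((p * γ' - 2) / (γ' - 2)) / l := by
  have hn : 0 < 1 + mv := by linarith
  have hγ0 : 0 < γ' := by linarith
  have hs := Real.rpow_nonneg hn.le ((p * γ' - 2) / (γ' - 2))
  rcases hm.eq_or_lt with h0 | hpos
  · have hw : euclNorm wv = 0 :=
      le_antisymm (by rw [← h0, mul_zero] at hD; exact hD) (euclNorm_nonneg _)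
    rw [hw]
    have := mul_nonneg (Real.rpow_nonneg hl.le ((γ' - 2) / 2)) (kinQ_nonneg (γ' := γ') mv wv)
    have h3 := div_nonneg hs hl.le
    linarith
  have ha1 : 2 / γ' < 1 := by rw [div_lt_one hγ0]; exact h2
  have key := rpow_mul_rpow_le_add (kinQ_nonneg (γ' := γ') mv wv) hs (by positivity) ha1 hl
  have e1 : (1 - 2 / γ') / (2 / γ') = (γ' - 2) / 2 := by field_simp
  rw [e1] at key
  refine le_trans ?_ key
  have hw := euclNorm_nonneg wv
  rw [kinQ, if_pos hpos, Real.mul_rpow (Real.rpow_nonneg hw _) (Real.rpow_nonneg hm _),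
    ← Real.rpow_mul hw, ← Real.rpow_mul hm, ← Real.rpow_mul hn.le]
  have e2 : γ' * (2 / γ') = (2 : ℕ) := by push_cast; field_simp
  have hγ2 : γ' - 2 ≠ 0 := by linarith
  have e3 : (p * γ' - 2) / (γ' - 2) * (1 - 2 / γ') = p - 2 / γ' := by field_simp
  have e4 : (1 - γ') * (2 / γ') = 2 / γ' - 2 := by field_simp
  rw [e2, e3, e4, Real.rpow_natCast]
  have e5 : (1 + mv) ^ (p - 2) = (1 + mv) ^ (2 / γ' - 2) * (1 + mv) ^ (p - 2 / γ') := by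
    rw [← Real.rpow_add hn]; congr 1; ring
  have h6 : (1 + mv) ^ (2 / γ' - 2) ≤ mv ^ (2 / γ' - 2) :=
    Real.rpow_le_rpow_of_nonpos hpos (by linarith) (by linarith)
  rw [e5]
  have := mul_le_mul_of_nonneg_right h6
    (mul_nonneg (Real.rpow_nonneg hn.le (p - 2 / γ')) (sq_nonneg (euclNorm wv)))
  linarith

lemma sub_le_integral_of_deriv_le {y y' g : ℝ → ℝ} (hy : ContinuousOn y (Icc 0 T))
    (hd : ∀ t ∈ Ioo 0 T, HasDerivAt y (y' t) t) (hy' : ContinuousOn y' (Icc 0 T))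
    (hg : IntegrableOn g (Ioo 0 T)) (h : ∀ᵐ t, t ∈ Ioo 0 T → y' t ≤ g t)
    {t : ℝ} (ht : t ∈ Icc 0 T) : y t - y 0 ≤ ∫ s in Ioo 0 t, g s := by
  have hsub : Icc 0 t ⊆ Icc 0 T := Icc_subset_Icc_right ht.2
  have hint : IntegrableOn y' (Icc 0 t) :=
    (hy'.mono hsub).integrableOn_compact isCompact_Icc
  rw [← intervalIntegral.integral_eq_sub_of_hasDerivAt_of_le ht.1 (hy.mono hsub)
    (fun s hs => hd s ⟨hs.1, hs.2.trans_le ht.2⟩)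
    ((intervalIntegrable_iff_integrableOn_Icc_of_le ht.1).2 hint),
    intervalIntegral.integral_of_le ht.1, integral_Ioc_eq_integral_Ioo]
  refine setIntegral_mono_ae_restrict (hint.mono_set Ioo_subset_Icc_self)
    (hg.mono_set (Ioo_subset_Ioo_right ht.2)) ((ae_restrict_iff' measurableSet_Ioo).2 ?_)
  filter_upwards [h] with s hs hsI using hs ⟨hsI.1, hsI.2.trans_le ht.2⟩

/-- The kinetic energy density integrated over the torus at time `t`. -/
def kinSlice (γ' : ℝ) (m : RN N → ℝ → ℝ) (w : RN N → ℝ → RN N) (t : ℝ) : ℝ :=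
  ∫ x in cube N, kinQ γ' (m x t) (w x t)

lemma kinSlice_nonneg (t : ℝ) : 0 ≤ kinSlice γ' m w t := integral_nonneg fun _ => kinQ_nonneg _ _

lemma integrableOn_kinSlice
    (hk : IntegrableOn (fun q : RN N × ℝ => kinQ γ' (m q.1 q.2) (w q.1 q.2)) (QQ N T)) :
    IntegrableOn (kinSlice γ' m w) (Ioo 0 T) := by
  rw [IntegrableOn, restrict_QQ] at hk
  exact hk.integral_prod_right

lemma FluxSol.ae_flux_le_kinSlice (h : FluxSol N T m w) (h2 : 2 < γ') {D : ℝ}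
    (hD : ∀ x, ∀ t ∈ Ioo 0 T, euclNorm (w x t) ≤ D * m x t)
    (hk : IntegrableOn (fun q : RN N × ℝ => kinQ γ' (m q.1 q.2) (w q.1 q.2)) (QQ N T)) (p : ℝ) :
    ∀ᵐ t, t ∈ Ioo 0 T → ∀ l : ℝ, 0 < l →
      ∫ x in cube N, (1 + m x t) ^ (p - 2) * euclNorm (w x t) ^ 2
      ≤ l ^ ((γ' - 2) / 2) * kinSlice γ' m w t + powInt m ((p * γ' - 2) / (γ' - 2)) t / l := by
  have hW := h.integrableOn_flux_sq hD (p - 2)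
  rw [IntegrableOn, restrict_QQ] at hW hk
  filter_upwards [(ae_restrict_iff' measurableSet_Ioo).1 hW.prod_left_ae,
    (ae_restrict_iff' measurableSet_Ioo).1 hk.prod_left_ae] with t hWt hkt ht l hl
  have i1 := (hkt ht).const_mul (l ^ ((γ' - 2) / 2))
  have i2 := (integrableOn_cube (h.continuous_rpow ((p * γ' - 2) / (γ' - 2))
    (Ioo_subset_Icc_self ht))).div_const l
  rw [kinSlice, powInt, ← integral_const_mul, ← integral_div, ← integral_add i1 i2]
  exact integral_mono (hWt ht) (i1.add i2) fun x =>
    flux_sq_le_kinQ_add h2 (h.nonneg x t) (hD x t ht) p hl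

lemma FluxSol.powInt_le_rpow (h : FluxSol N T m w) {p N₀ : ℝ} (hp : 0 ≤ p)
    {t : ℝ} (ht : t ∈ Icc 0 T) (hN₀ : ∀ x, 1 + m x t ≤ N₀) : powInt m p t ≤ N₀ ^ p := by
  have := isProbabilityMeasure_cube (N := N)
  have h2 : powInt m p t ≤ ∫ x in cube N, N₀ ^ p :=
    integral_mono (integrableOn_cube (h.continuous_rpow _ ht)) (integrable_const _)
      fun x => Real.rpow_le_rpow (h.one_add_pos x t).le (hN₀ x) hp
  rwa [integral_const, probReal_univ, one_smul] at h2

lemma FluxSol.powInt_mono (h : FluxSol N T m w) {p q : ℝ} (hpq : p ≤ q)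
    {t : ℝ} (ht : t ∈ Icc 0 T) : powInt m p t ≤ powInt m q t :=
  integral_mono (integrableOn_cube (h.continuous_rpow _ ht))
    (integrableOn_cube (h.continuous_rpow _ ht))
    fun x => Real.rpow_le_rpow_of_exponent_le (by linarith [h.nonneg x t]) hpq

lemma exists_powInt_bound (hN : 1 ≤ N) (hT : 0 < T) (h2 : 2 < γ') {p : ℝ} (hp : 1 < p)
    (hpN : p * (N + 2 - γ') < N) (E N₀ : ℝ) :
    ∃ A : ℝ, 1 ≤ A ∧ ∀ {m : RN N → ℝ → ℝ} {w : RN N → ℝ → RN N} {D : ℝ},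
      FluxSol N T m w → (∀ x, ∀ t ∈ Ioo 0 T, euclNorm (w x t) ≤ D * m x t) →
      IntegrableOn (fun q : RN N × ℝ => kinQ γ' (m q.1 q.2) (w q.1 q.2)) (QQ N T) →
      ∫ q in QQ N T, kinQ γ' (m q.1 q.2) (w q.1 q.2) ≤ E →
      (∀ x, 1 + m x 0 ≤ N₀) → ∀ t ∈ Icc 0 T, powInt m p t ≤ A := by
  have hNpos : (0 : ℝ) < N := by exact_mod_cast hN
  have hp0 : 0 < p := by linarith
  have hg2 : 0 < γ' - 2 := by linarith
  set β : ℝ := 2 * (p - 1) / (p * (γ' - 2)) with hβ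
  have hβ0 : 0 < β := by rw [hβ]; exact div_pos (by linarith) (by positivity)
  have hβN : β < 2 / N := by
    rw [hβ, div_lt_div_iff₀ (by positivity) hNpos]; nlinarith
  obtain ⟨C, hC, hMI⟩ := multiplicative_interpolation hN hβ0 hβN two_pos
  set Λ : ℝ := p ^ 2 * (C + 1) / 4 with hΛ
  have hΛ0 : 0 < Λ := by positivity
  set C₂ : ℝ := p * (p - 1) / 2 * Λ ^ ((γ' - 2) / 2) with hC₂
  have hC₂0 : 0 ≤ C₂ := mul_nonneg (by nlinarith) (Real.rpow_nonneg hΛ0.le _)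
  refine ⟨max 1 (N₀ ^ p * Real.exp (2 * T + C₂ * E)), le_max_left _ _,
    fun {m w D} h hD hk hE hN₀ t ht => le_max_of_le_right ?_⟩
  have hr : (p * γ' - 2) / (γ' - 2) = p / 2 * (2 + 2 * β) := by rw [hβ]; field_simp; ring
  have hMI' : ∀ t ∈ Icc 0 T, powInt m ((p * γ' - 2) / (γ' - 2)) t
      ≤ C * powEnergy m p t * powInt m p t ^ β := by
    intro t ht
    have h1 := hMI _ (h.contDiff_rpow (p / 2) ht) (h.zperiodic_rpow _ _) fun x =>
      Real.rpow_pos_of_pos (h.one_add_pos x t) _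
    simp only [← Real.rpow_mul (h.one_add_pos _ _).le, div_mul_cancel₀ p (two_ne_zero' ℝ)] at h1
    rw [hr]
    exact h1
  have hder : ∀ᵐ t, t ∈ Ioo 0 T → powIntDeriv m p t / powInt m p t
      ≤ 2 + C₂ * kinSlice γ' m w t := by
    filter_upwards [h.ae_powIntDeriv_le hT hD hp, h.ae_flux_le_kinSlice h2 hD hk p]
      with s hs1 hs2 hs
    have hsI := Ioo_subset_Icc_self hs
    have hy1 := h.one_le_powInt hp0.le hsI
    have hy0 : 0 < powInt m p s := by linarith
    have hEn : 0 ≤ powEnergy m p s := h1Energy_nonneg _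
    have hyβ := Real.rpow_pos_of_pos hy0 β
    have hks := kinSlice_nonneg (γ' := γ') (m := m) (w := w) s
    specialize hs1 hs
    specialize hs2 hs (Λ * powInt m p s ^ β) (by positivity)
    have e1 : (Λ * powInt m p s ^ β) ^ ((γ' - 2) / 2)
        = Λ ^ ((γ' - 2) / 2) * powInt m p s ^ ((p - 1) / p) := by
      rw [Real.mul_rpow hΛ0.le hyβ.le, ← Real.rpow_mul hy0.le]
      congr 2
      rw [hβ]; field_simp
    have e2 : powInt m p s ^ ((p - 1) / p) ≤ powInt m p s := by
      refine (Real.rpow_le_rpow_of_exponent_le hy1 ?_).trans_eq (Real.rpow_one _)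
      rw [div_le_one hp0]; linarith
    have e3 : powInt m ((p * γ' - 2) / (γ' - 2)) s / (Λ * powInt m p s ^ β)
        ≤ 4 / p ^ 2 * powEnergy m p s := by
      rw [div_le_iff₀ (by positivity)]
      refine (hMI' s hsI).trans ?_
      have : 4 / p ^ 2 * powEnergy m p s * (Λ * powInt m p s ^ β)
          = (C + 1) * powEnergy m p s * powInt m p s ^ β := by
        rw [hΛ]; field_simp
      rw [this]
      exact mul_le_mul_of_nonneg_right (mul_le_mul_of_nonneg_right (by linarith) hEn) hyβ.le
    have hpp : 0 ≤ p * (p - 1) / 2 := by nlinarith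
    rw [e1] at hs2
    have e4 := mul_le_mul_of_nonneg_left (mul_le_mul_of_nonneg_left e2
      (Real.rpow_nonneg hΛ0.le ((γ' - 2) / 2))) hpp
    have e5 := mul_le_mul_of_nonneg_right e4 hks
    have e6 := mul_le_mul_of_nonneg_left (hs2.trans (add_le_add_right e3 _)) hpp
    have e7 : p * (p - 1) / 2 * (4 / p ^ 2 * powEnergy m p s)
        = 2 * (p - 1) / p * powEnergy m p s := by field_simp; ring
    have c2 : 2 * (p - 1) / p ≤ 2 := by rw [div_le_iff₀ (by linarith)]; linarith
    have c7 := mul_le_mul_of_nonneg_right c2 hy0.le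
    rw [div_le_iff₀ hy0, hC₂]
    rw [mul_add, e7] at e6
    rw [mul_sub] at hs1
    linarith
  have hy := h.continuousOn_powInt hT p
  have hyne : ∀ t ∈ Icc 0 T, powInt m p t ≠ 0 := fun t ht => (h.powInt_pos p ht).ne'
  have hci : IntegrableOn (fun _ : ℝ => (2 : ℝ)) (Ioo 0 T) := integrableOn_const (by simp)
  have hgi : IntegrableOn (fun t => 2 + C₂ * kinSlice γ' m w t) (Ioo 0 T) :=
    hci.add ((integrableOn_kinSlice hk).const_mul C₂)
  have hlog := sub_le_integral_of_deriv_le (y := fun t => Real.log (powInt m p t))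
    (y' := fun t => powIntDeriv m p t / powInt m p t) (g := fun t => 2 + C₂ * kinSlice γ' m w t)
    (hy.log hyne) (fun t ht => (h.hasDerivAt_powInt p ht).log (hyne t (Ioo_subset_Icc_self ht)))
    ((h.continuousOn_powIntDeriv hT p).div hy hyne) hgi hder ht
  have hint : ∫ s in Ioo 0 t, (2 + C₂ * kinSlice γ' m w s) ≤ 2 * T + C₂ * E := by
    refine (setIntegral_mono_set hgi (Eventually.of_forall fun s => ?_)
      (Ioo_subset_Ioo_right ht.2).eventuallyLE).trans ?_
    · have := mul_nonneg hC₂0 (kinSlice_nonneg (γ' := γ') (m := m) (w := w) s)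
      show (0 : ℝ) ≤ 2 + C₂ * kinSlice γ' m w s
      linarith
    · rw [integral_add hci ((integrableOn_kinSlice hk).const_mul C₂),
        integral_const_mul, setIntegral_const]
      have : ∫ t in Ioo 0 T, kinSlice γ' m w t = ∫ q in QQ N T, kinQ γ' (m q.1 q.2) (w q.1 q.2) :=
        (setIntegral_QQ_symm hk).symm
      rw [this, Real.volume_real_Ioo_of_le hT.le, smul_eq_mul]
      nlinarith
  have h0I : (0 : ℝ) ∈ Icc 0 T := left_mem_Icc.2 hT.le
  have hyt := h.powInt_pos p ht
  have hyz := h.powInt_pos p h0I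
  have hfin : Real.log (powInt m p t) ≤ Real.log (powInt m p 0) + (2 * T + C₂ * E) := by linarith
  rw [Real.log_le_iff_le_exp hyt, Real.exp_add, Real.exp_log hyz] at hfin
  exact hfin.trans (mul_le_mul_of_nonneg_right (h.powInt_le_rpow hp0.le h0I hN₀) (Real.exp_pos _).le)

lemma FluxSol.integrableOn_powInt (h : FluxSol N T m w) (p : ℝ) (hT : 0 < T) :
    IntegrableOn (powInt m p) (Ioo 0 T) :=
  ((h.continuousOn_powInt hT p).integrableOn_compact isCompact_Icc).mono_set Ioo_subset_Icc_self

lemma FluxSol.integrableOn_powEnergy (h : FluxSol N T m w) (p : ℝ) (hT : 0 < T) :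
    IntegrableOn (powEnergy m p) (Ioo 0 T) := by
  have hc : ContinuousOn (fun t => (∫ x in cube N, p ^ 2 / 4 * ((1 + m x t) ^ (p - 2)
      * ∑ i, pd i (fun y => m y t) x ^ 2))) (Icc 0 T) :=
    continuousOn_integral_slice hT (F := fun q : RN N × ℝ => p ^ 2 / 4 * ((1 + m q.1 q.2) ^ (p - 2)
      * ∑ i, pd i (fun y => m y q.2) q.1 ^ 2))
      (continuousOn_const.mul ((h.continuousOn_rpow _).mul
        (continuousOn_finsetSum _ fun i _ => (h.cont_d i).pow 2)))
  have hc' : ContinuousOn (powEnergy m p) (Icc 0 T) :=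
    (hc.add (h.continuousOn_powInt hT p)).congr fun t ht => h.powEnergy_eq p ht
  exact (hc'.integrableOn_compact isCompact_Icc).mono_set Ioo_subset_Icc_self

lemma rpow_le_split {n K a b : ℝ} (hn : 1 ≤ n) (hK : 0 < K) (ha : 0 < a) (hab : a + 1 < b) :
    n ^ (a + 1) ≤ K ^ (-(b - a - 1)) * n ^ b + K ^ a * n ^ (1 : ℝ) := by
  have hn0 : 0 < n := by linarith
  have h1 : 0 < K ^ (-(b - a - 1)) * n ^ b := by positivity
  have h2 : 0 < K ^ a * n ^ (1 : ℝ) := by positivity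
  rcases le_total K n with h | h
  · have e : n ^ (a + 1) = n ^ (-(b - a - 1)) * n ^ b := by
      rw [← Real.rpow_add hn0]; congr 1; ring
    have : n ^ (-(b - a - 1)) ≤ K ^ (-(b - a - 1)) :=
      Real.rpow_le_rpow_of_nonpos hK h (by linarith)
    rw [e]
    have := mul_le_mul_of_nonneg_right this (Real.rpow_pos_of_pos hn0 b).le
    linarith
  · have : n ^ a ≤ K ^ a := Real.rpow_le_rpow hn0.le h ha.le
    rw [Real.rpow_add hn0]
    have := mul_le_mul_of_nonneg_right this (Real.rpow_pos_of_pos hn0 1).le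
    linarith

lemma FluxSol.integral_powEnergy_le (h : FluxSol N T m w) (hT : 0 < T) (h2 : 2 < γ') {D : ℝ}
    (hD : ∀ x, ∀ t ∈ Ioo 0 T, euclNorm (w x t) ≤ D * m x t)
    (hk : IntegrableOn (fun q : RN N × ℝ => kinQ γ' (m q.1 q.2) (w q.1 q.2)) (QQ N T))
    {p r c P : ℝ} (hp : 1 < p) (hpr : p ≤ r) (hr : (p * γ' - 2) / (γ' - 2) = r)
    (hc : 2 * (p - 1) / p = c) (hP : p * (p - 1) / 2 = P) :
    c * ∫ s in Ioo 0 T, powEnergy m p s ≤ powInt m p 0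
      + (c + P) * (∫ s in Ioo 0 T, powInt m r s) + P * ∫ s in Ioo 0 T, kinSlice γ' m w s := by
  have hc0 : 0 < c := by rw [← hc]; exact div_pos (by linarith) (by linarith)
  have hP0 : 0 < P := by rw [← hP]; nlinarith
  have iE := integrableOn_kinSlice hk
  have iH := h.integrableOn_powEnergy p hT
  have iz := h.integrableOn_powInt r hT
  have hTI : T ∈ Icc 0 T := right_mem_Icc.2 hT.le
  have hder : ∀ᵐ t, t ∈ Ioo 0 T → powIntDeriv m p t
      ≤ (c + P) * powInt m r t - c * powEnergy m p t + P * kinSlice γ' m w t := by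
    filter_upwards [h.ae_powIntDeriv_le hT hD hp, h.ae_flux_le_kinSlice h2 hD hk p]
      with s hs1 hs2 hs
    specialize hs1 hs
    specialize hs2 hs 1 one_pos
    rw [Real.one_rpow, one_mul, div_one, hr] at hs2
    have e1 := mul_le_mul_of_nonneg_left hs2 hP0.le
    have e2 := mul_le_mul_of_nonneg_left (h.powInt_mono hpr (Ioo_subset_Icc_self hs)) hc0.le
    rw [hc, hP] at hs1
    linarith
  have j12 : IntegrableOn (fun t => (c + P) * powInt m r t - c * powEnergy m p t)
    (Ioo 0 T) := (iz.const_mul _).sub (iH.const_mul _)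
  have hfun := sub_le_integral_of_deriv_le (h.continuousOn_powInt hT p)
    (fun t ht => h.hasDerivAt_powInt p ht) (h.continuousOn_powIntDeriv hT p)
    (j12.add (iE.const_mul P)) hder hTI
  have eint : ∫ s in Ioo 0 T, ((c + P) * powInt m r s - c * powEnergy m p s
      + P * kinSlice γ' m w s) = (c + P) * (∫ s in Ioo 0 T, powInt m r s)
      - c * (∫ s in Ioo 0 T, powEnergy m p s) + P * ∫ s in Ioo 0 T, kinSlice γ' m w s := by
    rw [integral_add j12 (iE.const_mul P), integral_sub (iz.const_mul _) (iH.const_mul _),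
      integral_const_mul, integral_const_mul, integral_const_mul]
  have hfun' := hfun.trans eint.le
  have hyT := h.powInt_pos p hTI
  linarith

lemma exists_powInt_le_powEnergy (hN : 1 ≤ N) {α p β N₀ : ℝ} (hα : 0 < α) (hp : 0 < p)
    (hβ0 : 0 < β) (hβN : β < 2 / N) (hδ : α + 1 < p + β) (hN₀ : 1 ≤ N₀) :
    ∃ C, 0 ≤ C ∧ ∀ {K : ℝ}, 0 < K → ∀ {m : RN N → ℝ → ℝ} {w : RN N → ℝ → RN N} {T t : ℝ},
      FluxSol N T m w → t ∈ Icc 0 T → powInt m 1 t ≤ N₀ →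
      powInt m (α + 1) t ≤ K ^ (-(p + β - α - 1)) * (C * powEnergy m p t) + K ^ α * N₀ := by
  obtain ⟨C, hC, hMI⟩ := multiplicative_interpolation hN hβ0 hβN (σ := 2 / p) (by positivity)
  refine ⟨C * N₀ ^ β, by positivity, fun {K} hK0 m w T t h htI hmass => ?_⟩
  have hEn : 0 ≤ powEnergy m p t := h1Energy_nonneg _
  have h1 := hMI _ (h.contDiff_rpow (p / 2) htI) (h.zperiodic_rpow _ _) fun x =>
    Real.rpow_pos_of_pos (h.one_add_pos x t) _
  have e1 : p / 2 * (2 + 2 / p * β) = p + β := by field_simp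
  have e2 : p / 2 * (2 / p) = 1 := by field_simp
  simp only [← Real.rpow_mul (h.one_add_pos _ _).le, e1, e2] at h1
  have h1' : powInt m (p + β) t ≤ C * powEnergy m p t * powInt m 1 t ^ β := h1
  have h3 := Real.rpow_le_rpow (h.powInt_pos 1 htI).le hmass hβ0.le
  have h4 : powInt m (p + β) t ≤ C * N₀ ^ β * powEnergy m p t := by
    refine h1'.trans ((mul_le_mul_of_nonneg_left h3 (mul_nonneg hC hEn)).trans_eq ?_)
    ring
  have h5 : powInt m (α + 1) t
      ≤ K ^ (-(p + β - α - 1)) * powInt m (p + β) t + K ^ α * powInt m 1 t := by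
    have ja := (integrableOn_cube (h.continuous_rpow (p + β) htI)).const_mul
      (K ^ (-(p + β - α - 1)))
    have jb := (integrableOn_cube (h.continuous_rpow 1 htI)).const_mul (K ^ α)
    rw [powInt, powInt, powInt, ← integral_const_mul, ← integral_const_mul, ← integral_add ja jb]
    exact integral_mono (integrableOn_cube (h.continuous_rpow _ htI)) (ja.add jb) fun x =>
      rpow_le_split (by linarith [h.nonneg x t]) hK0 hα hδ
  exact h5.trans (add_le_add
    (mul_le_mul_of_nonneg_left h4 (Real.rpow_pos_of_pos hK0 _).le)
    (mul_le_mul_of_nonneg_left hmass (Real.rpow_pos_of_pos hK0 α).le))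

lemma exists_kinetic_bound {α : ℝ} (hN : 1 ≤ N) (hT : 0 < T) (h2 : 2 < γ') (hα : 0 < α)
    (hsub : α < γ' / N) {CE N₀ : ℝ} (hCE : 0 ≤ CE) (hN₀ : 1 ≤ N₀) :
    ∃ E : ℝ, ∀ {m : RN N → ℝ → ℝ} {w : RN N → ℝ → RN N} {D : ℝ},
      FluxSol N T m w → (∀ x, ∀ t ∈ Ioo 0 T, euclNorm (w x t) ≤ D * m x t) →
      IntegrableOn (fun q : RN N × ℝ => kinQ γ' (m q.1 q.2) (w q.1 q.2)) (QQ N T) →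
      ∫ q in QQ N T, kinQ γ' (m q.1 q.2) (w q.1 q.2)
        ≤ CE * (1 + ∫ q in QQ N T, (1 + m q.1 q.2) ^ (α + 1)) →
      (∀ x, 1 + m x 0 ≤ N₀) → ∫ q in QQ N T, kinQ γ' (m q.1 q.2) (w q.1 q.2) ≤ E := by
  have hNpos : (0 : ℝ) < N := by exact_mod_cast hN
  have hγ0 : 0 < γ' := by linarith
  have hg2 : 0 < γ' - 2 := by linarith
  obtain ⟨p, hpdef⟩ : ∃ p : ℝ, p = 1 + α * (γ' - 2) / γ' := ⟨_, rfl⟩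
  have hp1 : 1 < p := by
    have : 0 < α * (γ' - 2) / γ' := by positivity
    linarith
  have hp0 : 0 < p := by linarith
  have hpα : p ≤ α + 1 := by
    have : α * (γ' - 2) / γ' ≤ α := by rw [div_le_iff₀ hγ0]; nlinarith
    linarith
  have hr : (p * γ' - 2) / (γ' - 2) = α + 1 := by rw [hpdef]; field_simp; ring
  have h2α : 2 * α / γ' < 2 / N := by
    rw [lt_div_iff₀ hNpos] at hsub
    rw [div_lt_div_iff₀ hγ0 hNpos]; linarith
  obtain ⟨β, hβ1, hβN⟩ := exists_between h2α
  have hβ0 : 0 < β := lt_trans (by positivity) hβ1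
  have hδ : α + 1 < p + β := by
    have : α - α * (γ' - 2) / γ' = 2 * α / γ' := by field_simp; ring
    linarith
  obtain ⟨C, hC, hMI⟩ := exists_powInt_le_powEnergy hN hα hp0 hβ0 hβN hδ hN₀
  obtain ⟨c, hc⟩ : ∃ c, 2 * (p - 1) / p = c := ⟨_, rfl⟩
  have hc0 : 0 < c := by rw [← hc]; exact div_pos (by linarith) hp0
  obtain ⟨P, hP⟩ : ∃ P, p * (p - 1) / 2 = P := ⟨_, rfl⟩
  have hP0 : 0 < P := by rw [← hP]; nlinarith
  have hN₀p : 0 < N₀ ^ p := Real.rpow_pos_of_pos (by linarith) p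
  obtain ⟨C₁, hC₁⟩ : ∃ C₁, C₁ = (N₀ ^ p + c + P + P * CE) / c := ⟨_, rfl⟩
  have hC₁0 : 0 < C₁ := by rw [hC₁]; positivity
  obtain ⟨C₃, hC₃⟩ : ∃ C₃, C₃ = (C + 1) * C₁ := ⟨_, rfl⟩
  have hC₃0 : 0 < C₃ := by rw [hC₃]; positivity
  obtain ⟨δ, hδdef⟩ : ∃ δ, p + β - α - 1 = δ := ⟨_, rfl⟩
  have hδ0 : 0 < δ := by linarith
  obtain ⟨K, hK⟩ : ∃ K, K = (2 * C₃) ^ (1 / δ) := ⟨_, rfl⟩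
  have hK0 : 0 < K := by rw [hK]; positivity
  have hKδ : K ^ (-δ) * C₃ = 1 / 2 := by
    rw [hK, Real.rpow_neg (by positivity), ← Real.rpow_mul (by positivity),
      one_div_mul_cancel hδ0.ne', Real.rpow_one]
    field_simp
  rw [hδdef] at hMI
  refine ⟨CE * (1 + (1 + 2 * (K ^ α * N₀ * T))), fun {m w D} h hD hk hE hN₀' => ?_⟩
  have h0I : (0 : ℝ) ∈ Icc 0 T := left_mem_Icc.2 hT.le
  have hZeq : ∫ q in QQ N T, (1 + m q.1 q.2) ^ (α + 1) = ∫ t in Ioo 0 T, powInt m (α + 1) t :=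
    setIntegral_QQ_symm (integrableOn_QQ (h.continuousOn_rpow (α + 1)))
  have hEeq : ∫ q in QQ N T, kinQ γ' (m q.1 q.2) (w q.1 q.2) = ∫ t in Ioo 0 T, kinSlice γ' m w t :=
    setIntegral_QQ_symm hk
  have hZ0 : 0 ≤ ∫ t in Ioo 0 T, powInt m (α + 1) t :=
    setIntegral_nonneg measurableSet_Ioo fun t ht => (h.powInt_pos _ (Ioo_subset_Icc_self ht)).le
  have hEnergy := h.integral_powEnergy_le hT h2 hD hk hp1 hpα hr hc hP
  have iH := h.integrableOn_powEnergy p hT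
  have hmass : ∀ t ∈ Icc 0 T, powInt m 1 t ≤ N₀ := fun t ht => by
    rw [h.powInt_one hT ht]
    exact (h.powInt_le_rpow zero_le_one h0I hN₀').trans_eq (Real.rpow_one _)
  have hci : IntegrableOn (fun _ : ℝ => K ^ α * N₀) (Ioo 0 T) := integrableOn_const (by simp)
  have hZle := setIntegral_mono_on (h.integrableOn_powInt (α + 1) hT)
    (((iH.const_mul C).const_mul (K ^ (-δ))).add hci) measurableSet_Ioo fun t ht =>
      hMI hK0 h (Ioo_subset_Icc_self ht) (hmass t (Ioo_subset_Icc_self ht))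
  have eint2 : ∫ t in Ioo 0 T, (K ^ (-δ) * (C * powEnergy m p t) + K ^ α * N₀)
      = K ^ (-δ) * (C * (∫ s in Ioo 0 T, powEnergy m p s)) + K ^ α * N₀ * T := by
    rw [integral_add ((iH.const_mul C).const_mul _) hci, integral_const_mul, integral_const_mul,
      setIntegral_const, Real.volume_real_Ioo_of_le hT.le, smul_eq_mul]
    ring
  have hZle' := hZle.trans eint2.le
  rw [hZeq] at hE
  refine hE.trans (mul_le_mul_of_nonneg_left (add_le_add_right ?_ 1) hCE)
  rw [hEeq] at hE
  have hEn0 : 0 ≤ ∫ s in Ioo 0 T, powEnergy m p s :=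
    setIntegral_nonneg measurableSet_Ioo fun t _ => h1Energy_nonneg _
  clear hZle eint2 hMI hmass
  generalize (∫ t in Ioo 0 T, powInt m (α + 1) t) = Z at *
  generalize (∫ s in Ioo 0 T, powEnergy m p s) = V at *
  generalize (∫ t in Ioo 0 T, kinSlice γ' m w t) = E at *
  have hy0 := h.powInt_le_rpow hp0.le h0I hN₀'
  have hH : V ≤ C₁ * (1 + Z) := by
    rw [hC₁, div_mul_eq_mul_div, le_div_iff₀ hc0]
    have h1 := mul_le_mul_of_nonneg_left hE hP0.le
    have h2 := mul_nonneg hN₀p.le hZ0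
    linarith
  have hKp : 0 < K ^ (-δ) := Real.rpow_pos_of_pos hK0 _
  have h8 : K ^ (-δ) * (C * V) ≤ K ^ (-δ) * C₃ * (1 + Z) := by
    rw [mul_assoc, hC₃]
    refine mul_le_mul_of_nonneg_left ?_ hKp.le
    have h1 := mul_le_mul_of_nonneg_left hH hC
    have h2 : 0 ≤ C₁ * (1 + Z) := by positivity
    linarith
  rw [hKδ] at h8
  linarith

end IntegralBounds

section Energy

variable {N : ℕ} {T γ' α : ℝ} {m₀ : RN N → ℝ}

lemma continuous_grad {u : RN N → ℝ} (hu : ContDiff ℝ 1 u) : Continuous (grad u) :=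
  continuous_pi fun i => continuous_pd hu i

lemma zperiodic_grad {u : RN N → ℝ} (hu : ZPeriodic u) : ZPeriodic (grad u) := fun x z =>
  funext fun i => zperiodic_pd hu i x z

lemma traceId_const (hT : 0 < T) (hm : ContDiff ℝ 1 m₀) (hper : ZPeriodic m₀) {φ : RN N → ℝ → ℝ}
    (hφ : IsTest N φ) :
    intQ N T (fun x t => m₀ x * deriv (φ x) t + dotp (grad m₀ x) (grad (fun y => φ y t) x)
        + m₀ x * lap (fun y => φ y t) x)
      + (∫ x in cube N, m₀ x * φ x 0) - (∫ x in cube N, m₀ x * φ x T) = 0 := by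
  obtain ⟨hsm, hφper⟩ := hφ
  have hpdsm := fun i => contDiff_pd_slice hsm i
  have hpc : ∀ i, Continuous fun q : RN N × ℝ => pd i (fun y => φ y q.2) q.1 := fun i =>
    (hpdsm i).continuous
  have hlc : Continuous fun q : RN N × ℝ => lap (fun y => φ y q.2) q.1 :=
    continuous_finsetSum _ fun i _ => (contDiff_pd_slice (hpdsm i) i).continuous
  have hdt : ∀ x t, deriv (φ x) t = fderiv ℝ (fun q : RN N × ℝ => φ q.1 q.2) (x, t) (0, 1) :=
    fun x t => (hasDerivAt_slice hsm x t).deriv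
  have hdc : Continuous fun q : RN N × ℝ => deriv (φ q.1) q.2 := by
    simp only [hdt]
    exact (hsm.continuous_fderiv (by simp)).clm_apply continuous_const
  have hmc : Continuous fun q : RN N × ℝ => m₀ q.1 := hm.continuous.comp continuous_fst
  have i1 : IntegrableOn (fun q : RN N × ℝ => m₀ q.1 * deriv (φ q.1) q.2) (QQ N T) :=
    integrableOn_QQ (hmc.mul hdc).continuousOn
  have c2 : Continuous fun q : RN N × ℝ => dotp (grad m₀ q.1) (grad (fun y => φ y q.2) q.1) :=
    continuous_finsetSum _ fun i _ => ((continuous_pd hm i).comp continuous_fst).mul (hpc i)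
  have i2 := integrableOn_QQ (T := T) c2.continuousOn
  have i3 : IntegrableOn (fun q : RN N × ℝ => m₀ q.1 * lap (fun y => φ y q.2) q.1) (QQ N T) :=
    integrableOn_QQ (hmc.mul hlc).continuousOn
  have i12 : IntegrableOn (fun q : RN N × ℝ => m₀ q.1 * deriv (φ q.1) q.2
      + dotp (grad m₀ q.1) (grad (fun y => φ y q.2) q.1)) (QQ N T) := i1.add i2
  have e1 : ∫ q in QQ N T, m₀ q.1 * deriv (φ q.1) q.2
      = (∫ x in cube N, m₀ x * φ x T) - ∫ x in cube N, m₀ x * φ x 0 := by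
    have hs : ∀ t, Continuous fun x => m₀ x * φ x t := fun t =>
      hm.continuous.mul (hsm.continuous.comp (f := fun x => (x, t)) (by fun_prop))
    rw [setIntegral_QQ i1, ← integral_sub ((hs T).continuousOn.integrableOn_compact isCompact_cube)
      ((hs 0).continuousOn.integrableOn_compact isCompact_cube)]
    refine integral_congr_ae (Eventually.of_forall fun x => ?_)
    have key := intervalIntegral.integral_eq_sub_of_hasDerivAt (a := 0) (b := T)
      (f := fun t => m₀ x * φ x t) (f' := fun t => m₀ x * deriv (φ x) t)
      (fun t _ => ((hasDerivAt_slice hsm x t).const_mul (m₀ x)).congr_deriv (by rw [hdt]))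
      ((continuous_const.mul (hdc.comp (f := fun t => (x, t)) (by fun_prop))).intervalIntegrable _ _)
    rw [intervalIntegral.integral_of_le hT.le, integral_Ioc_eq_integral_Ioo] at key
    exact key
  have e3 : ∫ q in QQ N T, m₀ q.1 * lap (fun y => φ y q.2) q.1
      = -∫ q in QQ N T, dotp (grad m₀ q.1) (grad (fun y => φ y q.2) q.1) := by
    rw [setIntegral_QQ_symm i3, setIntegral_QQ_symm i2, ← integral_neg]
    refine setIntegral_congr_fun measurableSet_Ioo fun t _ => ?_
    refine integral_mul_lap hm ?_ hper (hφper t)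
    exact (hsm.comp (g := fun q : RN N × ℝ => φ q.1 q.2) (f := fun x : RN N => (x, t))
      (by fun_prop)).of_le (by norm_cast)
  rw [intQ, integral_add i12 i3, integral_add i1 i2, e1, e3]
  ring

/-- The stationary density `m₀`, transported by the flux `∇m₀`, is admissible. -/
lemma memK_const (hT : 0 < T) (hγ' : 0 < γ') (hm : ContDiff ℝ 1 m₀) (hper : ZPeriodic m₀)
    (hpos : ∀ x, 0 < m₀ x) :
    MemK N T α γ' m₀ (fun x _ => m₀ x) (fun x _ => grad m₀ x) where
  per_m _ := hper
  per_w _ := zperiodic_grad hper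
  nonneg x _ := (hpos x).le
  lp_m := integrableOn_QQ ((continuous_rpow_of_pos hm.continuous hpos _).comp
    continuous_fst).continuousOn
  l1_w := (((continuous_grad hm).comp continuous_fst).continuousOn.integrableOn_compact
    (isCompact_cube.prod isCompact_Icc)).mono_set (prod_mono le_rfl Ioo_subset_Icc_self)
  vanish := Eventually.of_forall fun q hq => absurd hq (hpos q.1).ne'
  kin_int := by
    simp only [kinQ, hpos, if_true]
    exact integrableOn_QQ (((continuous_euclNorm.comp (continuous_grad hm)).rpow_const
      fun _ => Or.inr hγ'.le).mul (continuous_rpow_of_pos hm.continuous hpos _)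
      |>.comp continuous_fst).continuousOn
  traceInt := hm.continuous.continuousOn.integrableOn_compact isCompact_cube
  fp φ hφ h0 := by
    have := traceId_const hT hm hper hφ
    simpa only [h0, mul_zero, integral_zero, sub_zero] using this
  traceId φ hφ := traceId_const hT hm hper hφ

lemma kinQ_le_mLag {L : RN N → ℝ} {c C : ℝ} (hL : ∀ q, c * euclNorm q ^ γ' - C ≤ L q) {mv : ℝ}
    (hm : 0 ≤ mv) (wv : RN N) : c * kinQ γ' mv wv ≤ mLag L mv wv + C * mv := by
  rcases hm.eq_or_lt with rfl | hm
  · simp [kinQ, mLag]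
  rw [kinQ, mLag, if_pos hm, if_pos hm]
  have h := mul_le_mul_of_nonneg_left (hL ((-mv⁻¹) • wv)) hm.le
  have e : mv * euclNorm ((-mv⁻¹) • wv) ^ γ' = euclNorm wv ^ γ' * mv ^ (1 - γ') := by
    rw [euclNorm_smul, abs_neg, abs_of_pos (inv_pos.2 hm),
      Real.mul_rpow (inv_pos.2 hm).le (euclNorm_nonneg _), Real.inv_rpow hm.le,
      Real.rpow_sub hm, Real.rpow_one]
    ring
  rw [← e]
  linarith

lemma abs_mLag_le {L : RN N → ℝ} {R B : ℝ} (hL : ∀ q, euclNorm q ≤ R → |L q| ≤ B) {mv : ℝ}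
    (hm : 0 ≤ mv) {wv : RN N} (hw : euclNorm wv ≤ R * mv) : |mLag L mv wv| ≤ mv * B := by
  rcases hm.eq_or_lt with rfl | hm
  · simp [mLag]
  rw [mLag, if_pos hm, abs_mul, abs_of_pos hm]
  refine mul_le_mul_of_nonneg_left (hL _ ?_) hm.le
  rw [euclNorm_smul, abs_neg, abs_of_pos (inv_pos.2 hm), inv_mul_le_iff₀ hm, mul_comm]
  exact hw

lemma abs_Fint_le {f : RN N → ℝ → ℝ} {C : ℝ} (hC : 0 ≤ C) (hα : 0 < α)
    (hf : ∀ x s, 0 ≤ s → |f x s| ≤ C * (1 + s) ^ α) (x : RN N) {mv : ℝ} (hm : 0 ≤ mv) :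
    |Fint f x mv| ≤ C * (1 + mv) ^ (α + 1) := by
  have h := intervalIntegral.norm_integral_le_of_norm_le_const (a := 0) (b := mv) (f := f x)
    (C := C * (1 + mv) ^ α) fun s hs => by
      rw [uIoc_of_le hm] at hs
      exact (hf x s hs.1.le).trans (mul_le_mul_of_nonneg_left
        (Real.rpow_le_rpow (by linarith [hs.1]) (by linarith [hs.2]) hα.le) hC)
  rw [sub_zero, abs_of_nonneg hm] at h
  refine h.trans ?_
  rw [Real.rpow_add (by linarith), Real.rpow_one, mul_assoc]
  have : 0 ≤ (1 + mv) ^ α := by positivity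
  gcongr
  linarith

lemma continuousOn_Fint {f : RN N → ℝ → ℝ}
    (hf : ContinuousOn (fun q : RN N × ℝ => f q.1 q.2) ((univ : Set (RN N)) ×ˢ Ici (0 : ℝ))) :
    ContinuousOn (fun q : RN N × ℝ => Fint f q.1 q.2) ((univ : Set (RN N)) ×ˢ Ici (0 : ℝ)) := by
  have hg : Continuous fun r : (RN N × ℝ) × ℝ => f r.1.1 (max r.2 0) :=
    hf.comp_continuous (f := fun r : (RN N × ℝ) × ℝ => (r.1.1, max r.2 0)) (by fun_prop)
      fun r => ⟨mem_univ _, mem_Ici.2 (le_max_right _ _)⟩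
  have hc : Continuous fun q : RN N × ℝ => ∫ σ in (0 : ℝ)..q.2, f q.1 (max σ 0) :=
    intervalIntegral.continuous_parametric_intervalIntegral_of_continuous (μ := volume)
      (f := fun (q : RN N × ℝ) σ => f q.1 (max σ 0)) hg continuous_snd
  refine hc.continuousOn.congr fun q hq => ?_
  refine intervalIntegral.integral_congr fun σ hσ => ?_
  rw [uIcc_of_le hq.2] at hσ
  simp only [max_eq_left hσ.1]

lemma measurable_mLag {L : RN N → ℝ} (hL : Measurable L) :
    Measurable fun q : ℝ × RN N => mLag L q.1 q.2 :=
  Measurable.ite (measurableSet_lt measurable_const measurable_fst)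
    (measurable_fst.mul (hL.comp (measurable_fst.inv.neg.smul measurable_snd))) measurable_const

/-- A coupling whose derivative grows at most like `(1 + s)^(α - 1)` grows at most
like `(1 + s)^α`. -/
lemma exists_coupling_bound {c : ℝ} {f f' : RN N → ℝ → ℝ} (hα : 0 < α) (hc : 0 < c)
    (hfcont : ContinuousOn (fun q : RN N × ℝ => f q.1 q.2) ((univ : Set (RN N)) ×ˢ Ici (0 : ℝ)))
    (hfper : ∀ s, ZPeriodic fun x => f x s) (hfnn : ∀ x s, 0 ≤ s → 0 ≤ f x s)
    (hfder : ∀ x s, 0 ≤ s → HasDerivAt (f x) (f' x s) s)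
    (hfb : ∀ x s, 0 ≤ s → |f' x s| ≤ c * (s + 1) ^ (α - 1)) :
    ∃ C, 1 ≤ C ∧ ∀ x s, 0 ≤ s → |f x s| ≤ C * (1 + s) ^ α := by
  obtain ⟨M, hM⟩ := exists_bound_of_periodic (T := 0) (g := f) hfper
    (hfcont.mono (prod_mono le_rfl Icc_subset_Ici_self))
  refine ⟨1 + |M| + c / α, ?_, fun x s hs => ?_⟩
  · have := abs_nonneg M
    have : 0 < c / α := by positivity
    linarith
  have hd : ∀ r, 0 ≤ r → HasDerivAt (fun r => f x r - c / α * (1 + r) ^ α)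
      (f' x r - c * (1 + r) ^ (α - 1)) r := fun r hr => by
    have h1 : HasDerivAt (fun r : ℝ => 1 + r) 1 r := (hasDerivAt_id r).const_add 1
    have h2 := (h1.rpow_const (p := α) (Or.inl (by linarith))).const_mul (c / α)
    refine ((hfder x r hr).sub h2).congr_deriv ?_
    field_simp
  have hanti : AntitoneOn (fun r => f x r - c / α * (1 + r) ^ α) (Ici 0) := by
    refine antitoneOn_of_deriv_nonpos (convex_Ici 0)
      (fun r hr => (hd r hr).continuousAt.continuousWithinAt)
      (fun r hr => (hd r (interior_subset hr)).differentiableAt.differentiableWithinAt)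
      fun r hr => ?_
    have hr' := interior_subset hr
    rw [(hd r hr').deriv]
    have := (le_abs_self _).trans (hfb x r hr')
    rw [add_comm r 1] at this
    linarith
  have h := hanti self_mem_Ici hs hs
  simp only [add_zero, Real.one_rpow, mul_one] at h
  have h0 := (le_abs_self _).trans ((hM x 0 ⟨le_rfl, le_rfl⟩).trans (le_abs_self M))
  have h1 : 1 ≤ (1 + s) ^ α := Real.one_le_rpow (by linarith) hα.le
  rw [abs_of_nonneg (hfnn x s hs)]
  have hca : 0 < c / α := by positivity
  nlinarith [abs_nonneg M]

lemma le_lpen {L : RN N → ℝ} {η : ℝ} (hη : 0 ≤ η) (q : RN N) : L q ≤ Lpen L η q := by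
  have := Real.rpow_nonneg (euclNorm_nonneg q) ((N : ℝ) + 3)
  rw [Lpen]
  have : 0 ≤ η / ((N : ℝ) + 3) * euclNorm q ^ ((N : ℝ) + 3) := by positivity
  linarith

lemma abs_lpen_le {C R : ℝ} {L : RN N → ℝ} (hγ' : 0 < γ') (hC : 0 < C)
    (hL : ∀ q, C⁻¹ * euclNorm q ^ γ' - C ≤ L q ∧ L q ≤ C * (euclNorm q ^ γ' + 1))
    {η : ℝ} (hη : η ∈ Ioc (0 : ℝ) 1) (q : RN N) (hq : euclNorm q ≤ R) :
    |Lpen L η q| ≤ C * (R ^ γ' + 1) + R ^ ((N : ℝ) + 3) := by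
  have hn := euclNorm_nonneg q
  have h1 := Real.rpow_le_rpow hn hq hγ'.le
  have h2 := Real.rpow_le_rpow hn hq (by positivity : (0 : ℝ) ≤ (N : ℝ) + 3)
  have h3 := Real.rpow_nonneg hn γ'
  have h4 := Real.rpow_nonneg hn ((N : ℝ) + 3)
  have h5 : η / ((N : ℝ) + 3) ≤ 1 := by
    rw [div_le_one (by positivity)]
    have : (0 : ℝ) ≤ N := N.cast_nonneg
    linarith [hη.2]
  have h6 : 0 ≤ C⁻¹ * euclNorm q ^ γ' := by positivity
  have h7 := le_lpen (L := L) hη.1.le q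
  have h8 := mul_le_mul_of_nonneg_left h1 hC.le
  have h9 := mul_nonneg hC.le (h3.trans h1)
  refine abs_le.2 ⟨by linarith [(hL q).1], ?_⟩
  rw [Lpen]
  have := mul_le_mul_of_nonneg_right h5 h4
  linarith [(hL q).2]

/-- Minimality against the stationary competitor bounds the kinetic energy. -/
lemma exists_energy_bound {CL Cf N₀ : ℝ} {L uT : RN N → ℝ} {f : RN N → ℝ → ℝ} (hT : 0 < T)
    (hγ' : 0 < γ') (hα : 0 < α) (hCL : 0 < CL) (hLc : Continuous L)
    (hL : ∀ q, CL⁻¹ * euclNorm q ^ γ' - CL ≤ L q ∧ L q ≤ CL * (euclNorm q ^ γ' + 1))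
    (hfcont : ContinuousOn (fun q : RN N × ℝ => f q.1 q.2) ((univ : Set (RN N)) ×ˢ Ici (0 : ℝ)))
    (hCf : 0 ≤ Cf) (hf : ∀ x s, 0 ≤ s → |f x s| ≤ Cf * (1 + s) ^ α)
    (hm : ContDiff ℝ 1 m₀) (hper : ZPeriodic m₀) (hpos : ∀ x, 0 < m₀ x)
    (huT : Continuous uT) (huTper : ZPeriodic uT) (hN₀ : ∀ x, 1 + m₀ x ≤ N₀) :
    ∃ CE, 0 ≤ CE ∧ ∀ η ∈ Ioc (0 : ℝ) 1, ∀ {m : RN N → ℝ → ℝ} {w : RN N → ℝ → RN N} {D : ℝ},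
      FluxSol N T m w → (∀ x, ∀ t ∈ Ioo 0 T, euclNorm (w x t) ≤ D * m x t) →
      (∀ x, m x 0 = m₀ x) → MinimisesE N T α γ' m₀ (Lpen L η) (Fint f) uT m w →
      ∫ q in QQ N T, kinQ γ' (m q.1 q.2) (w q.1 q.2)
        ≤ CE * (1 + ∫ q in QQ N T, (1 + m q.1 q.2) ^ (α + 1)) := by
  obtain ⟨U, hU⟩ := exists_bound_of_periodic (T := 0) (g := fun x _ => uT x) (fun _ => huTper)
    (huT.comp continuous_fst).continuousOn
  replace hU : ∀ x, |uT x| ≤ U := fun x => hU x 0 ⟨le_rfl, le_rfl⟩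
  obtain ⟨R, hR⟩ := exists_bound_of_periodic (T := 0)
    (g := fun x _ => euclNorm (grad m₀ x) / m₀ x)
    (fun _ x z => by simp only [zperiodic_grad hper x z, hper x z])
    (((continuous_euclNorm.comp (continuous_grad hm)).div hm.continuous
      fun x => (hpos x).ne').comp continuous_fst).continuousOn
  replace hR : ∀ x, euclNorm (grad m₀ x) ≤ R * m₀ x := fun x => by
    rw [← div_le_iff₀ (hpos x)]
    exact (le_abs_self _).trans (hR x 0 ⟨le_rfl, le_rfl⟩)
  have hU0 : 0 ≤ U := (abs_nonneg _).trans (hU 0)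
  have hN₀0 : 0 ≤ N₀ := by linarith [hN₀ 0, hpos 0]
  obtain ⟨B, hB⟩ : ∃ B, B = CL * (R ^ γ' + 1) + R ^ ((N : ℝ) + 3) := ⟨_, rfl⟩
  have hB' : ∀ η ∈ Ioc (0 : ℝ) 1, ∀ q : RN N, euclNorm q ≤ R → |Lpen L η q| ≤ B :=
    fun η hη q hq => (abs_lpen_le hγ' hCL hL hη q hq).trans_eq hB.symm
  have hR0 : 0 ≤ R := by
    have := (euclNorm_nonneg _).trans (hR 0)
    exact nonneg_of_mul_nonneg_left this (hpos 0)
  have hB0 : 0 ≤ B := (abs_nonneg _).trans (hB' 1 ⟨one_pos, le_rfl⟩ 0 (by rwa [euclNorm_zero]))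
  obtain ⟨E₀, hE₀⟩ : ∃ E₀, E₀ = (N₀ * B + Cf * N₀ ^ (α + 1)) * volume.real (QQ N T)
    + ∫ x in cube N, uT x * m₀ x := ⟨_, rfl⟩
  refine ⟨CL * (|E₀| + U * N₀ + (CL + Cf)), by positivity, fun η hη m w D h hD hm0 hmin => ?_⟩
  have hcomp := hmin.2 _ _ (memK_const (α := α) hT hγ' hm hper hpos)
  have hle : energyF N T (Lpen L η) (Fint f) uT (fun x _ => m₀ x) (fun x _ => grad m₀ x) ≤ E₀ := by
    rw [hE₀, energyF, intQ]
    refine add_le_add ((Real.le_norm_self _).trans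
      (norm_setIntegral_le_of_norm_le_const ?_ fun q _ => ?_)) le_rfl
    · exact ((isCompact_cube.prod isCompact_Icc).measure_lt_top).trans_le'
        (measure_mono (prod_mono le_rfl Ioo_subset_Icc_self))
    · have h1 := abs_mLag_le (hB' η hη) (hpos q.1).le (hR q.1)
      have h2 := abs_Fint_le hCf hα hf q.1 (hpos q.1).le
      have h3 := mul_le_mul_of_nonneg_right (by linarith [hN₀ q.1] : m₀ q.1 ≤ N₀) hB0
      have h4 := mul_le_mul_of_nonneg_left (Real.rpow_le_rpow (by linarith [hpos q.1])
        (hN₀ q.1) (by linarith : 0 ≤ α + 1)) hCf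
      exact (abs_sub _ _).trans (by linarith)
  have hLpc : Continuous (Lpen L η) := hLc.add (continuous_const.mul
    (continuous_euclNorm.rpow_const fun _ => Or.inr (by positivity)))
  have ik := hmin.1.kin_int
  have iL : IntegrableOn (fun q : RN N × ℝ => mLag (Lpen L η) (m q.1 q.2) (w q.1 q.2))
      (QQ N T) := by
    refine Integrable.mono' (integrableOn_QQ (h.cont.mul continuousOn_const :
      ContinuousOn (fun q : RN N × ℝ => m q.1 q.2
        * (CL * (D ^ γ' + 1) + D ^ ((N : ℝ) + 3))) _)) ?_ ?_
    · exact ((measurable_mLag hLpc.measurable).comp_aemeasurable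
        ((integrableOn_QQ h.cont).aestronglyMeasurable.aemeasurable.prodMk
          h.flux.aestronglyMeasurable.aemeasurable)).aestronglyMeasurable
    · refine ae_restrict_of_forall_mem measurableSet_QQ fun q hq => ?_
      exact abs_mLag_le (abs_lpen_le hγ' hCL hL hη) (h.nonneg _ _) (hD _ _ hq.2)
  have iF : IntegrableOn (fun q : RN N × ℝ => Fint f q.1 (m q.1 q.2)) (QQ N T) :=
    integrableOn_QQ ((continuousOn_Fint hfcont).comp (continuousOn_fst.prodMk h.cont)
      fun q _ => ⟨mem_univ _, h.nonneg _ _⟩)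
  have iZ := integrableOn_QQ (h.continuousOn_rpow (α + 1))
  have iS : IntegrableOn (fun q : RN N × ℝ => mLag (Lpen L η) (m q.1 q.2) (w q.1 q.2)
      - Fint f q.1 (m q.1 q.2)) (QQ N T) := iL.sub iF
  have hpt : ∀ q ∈ QQ N T, CL⁻¹ * kinQ γ' (m q.1 q.2) (w q.1 q.2)
      ≤ (mLag (Lpen L η) (m q.1 q.2) (w q.1 q.2) - Fint f q.1 (m q.1 q.2))
        + (CL + Cf) * (1 + m q.1 q.2) ^ (α + 1) := by
    intro q _
    have hmn := h.nonneg q.1 q.2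
    have h1 := kinQ_le_mLag (fun p => (hL p).1.trans (le_lpen hη.1.le p)) hmn (w q.1 q.2)
    have h2 := (le_abs_self _).trans (abs_Fint_le hCf hα hf q.1 hmn)
    have h3 : m q.1 q.2 ≤ (1 + m q.1 q.2) ^ (α + 1) := by
      refine (by linarith : m q.1 q.2 ≤ 1 + m q.1 q.2).trans ?_
      exact Real.self_le_rpow_of_one_le (by linarith) (by linarith)
    have h4 := mul_le_mul_of_nonneg_left h3 hCL.le
    linarith
  have hint := setIntegral_mono_on (ik.const_mul CL⁻¹) (iS.add (iZ.const_mul (CL + Cf)))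
    measurableSet_QQ hpt
  have eint : ∫ q in QQ N T, ((mLag (Lpen L η) (m q.1 q.2) (w q.1 q.2) - Fint f q.1 (m q.1 q.2))
        + (CL + Cf) * (1 + m q.1 q.2) ^ (α + 1))
      = intQ N T (fun x t => mLag (Lpen L η) (m x t) (w x t) - Fint f x (m x t))
        + (CL + Cf) * ∫ q in QQ N T, (1 + m q.1 q.2) ^ (α + 1) := by
    rw [integral_add iS (iZ.const_mul _), integral_const_mul, intQ]
  replace hint := hint.trans eint.le
  rw [integral_const_mul] at hint
  have hTI : T ∈ Icc 0 T := right_mem_Icc.2 hT.le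
  have h0I : (0 : ℝ) ∈ Icc 0 T := left_mem_Icc.2 hT.le
  have hfin : -(U * N₀) ≤ ∫ x in cube N, uT x * m x T := by
    have hp := h.powInt_le_rpow zero_le_one h0I (fun x => by rw [hm0]; exact hN₀ x)
    rw [Real.rpow_one, ← h.powInt_one hT hTI] at hp
    have i1 := (integrableOn_cube (h.continuous_rpow 1 hTI)).const_mul (-U)
    have i2 := integrableOn_cube (huT.mul (h.contDiff hTI).continuous)
    have hle2 : ∫ x in cube N, -U * (1 + m x T) ^ (1 : ℝ) ≤ ∫ x in cube N, uT x * m x T :=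
      integral_mono i1 i2 fun x => by
        have := h.nonneg x T
        have h1 := mul_le_mul_of_nonneg_right (neg_le_of_abs_le (hU x)) this
        simp only [Real.rpow_one]
        linarith
    rw [integral_const_mul] at hle2
    have := mul_le_mul_of_nonneg_left hp hU0
    rw [powInt] at this
    linarith
  have hZ0 : 0 ≤ ∫ q in QQ N T, (1 + m q.1 q.2) ^ (α + 1) :=
    setIntegral_nonneg measurableSet_QQ fun q _ => (Real.rpow_pos_of_pos (h.one_add_pos _ _) _).le
  rw [inv_mul_le_iff₀ hCL] at hint
  refine hint.trans ?_
  rw [mul_assoc]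
  refine mul_le_mul_of_nonneg_left ?_ hCL.le
  have h5 := hcomp.trans hle
  rw [energyF] at h5
  have h6 := le_abs_self E₀
  have h7 : 0 ≤ (|E₀| + U * N₀) * ∫ q in QQ N T, (1 + m q.1 q.2) ^ (α + 1) := by positivity
  linarith

end Energy

section Conclusion

variable {N : ℕ} {T α γ' : ℝ}

lemma ClassicalSol.fluxSol {h : RN N → ℝ} {fc : RN N → ℝ → ℝ → ℝ} {m₀ uT : RN N → ℝ}
    {u m : RN N → ℝ → ℝ} {w : RN N → ℝ → RN N} (hs : ClassicalSol N T h fc m₀ uT u m)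
    (hk : MemK N T α γ' m₀ m w) : FluxSol N T m w where
  per := hs.per_m
  nonneg := hk.nonneg
  cont := hs.cont_m
  cont_t := hs.cont_mt
  cont_d := hs.cont_dm
  tdiff := hs.tdiff_m
  xdiff t ht := (hs.xdiff_m t ht).1
  flux := hk.l1_w
  weak φ hφ h0 hT := by
    have := hk.fp φ hφ hT
    simpa only [h0, mul_zero, integral_zero, add_zero] using this

lemma exists_exponents (hN : 1 ≤ N) (hα : 0 < α) (h2 : 2 < γ') (hle : γ' ≤ (N : ℝ) + 2)
    (hsub : γ' < (N : ℝ) + 2 → α < (γ' - 2) / ((N : ℝ) + 2 - γ')) :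
    ∃ β p : ℝ, 0 < β ∧ β < 2 / N ∧ 1 < p ∧ p * ((N : ℝ) + 2 - γ') < N ∧
      α / (γ' - 2) * (2 / (β * p)) < 1 := by
  have hNpos : (0 : ℝ) < N := by exact_mod_cast hN
  have hg2 : 0 < γ' - 2 := by linarith
  obtain ⟨s, hs⟩ : ∃ s, s = α / (γ' - 2) := ⟨_, rfl⟩
  have hs0 : 0 < s := by rw [hs]; positivity
  obtain ⟨p, hp1, hps, hpN⟩ : ∃ p, 1 < p ∧ s * N < p ∧ p * ((N : ℝ) + 2 - γ') < N := by
    rcases hle.eq_or_lt with h | h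
    · exact ⟨1 + s * N + 1, by nlinarith, by linarith, by rw [h, sub_self, mul_zero]; exact hNpos⟩
    · have hd : 0 < (N : ℝ) + 2 - γ' := by linarith
      have hsd : s * ((N : ℝ) + 2 - γ') < 1 := by
        have := hsub h
        rw [lt_div_iff₀ hd] at this
        rw [hs, div_mul_eq_mul_div, div_lt_one hg2]
        exact this
      have h1 : max 1 (s * N) < N / ((N : ℝ) + 2 - γ') := by
        rw [max_lt_iff, lt_div_iff₀ hd, lt_div_iff₀ hd]
        constructor <;> nlinarith
      obtain ⟨p, hp, hp'⟩ := exists_between h1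
      rw [max_lt_iff] at hp
      exact ⟨p, hp.1, hp.2, (lt_div_iff₀ hd).1 hp'⟩
  have hp0 : 0 < p := by linarith
  obtain ⟨β, hβ, hβN⟩ : ∃ β, 2 * s / p < β ∧ β < 2 / N := by
    refine exists_between ?_
    rw [div_lt_div_iff₀ hp0 hNpos]
    linarith
  have hβ0 : 0 < β := lt_trans (by positivity) hβ
  refine ⟨β, p, hβ0, hβN, hp1, hpN, ?_⟩
  rw [← hs, mul_div_assoc', div_lt_one (by positivity)]
  rw [div_lt_iff₀ hp0] at hβ
  linarith

lemma FluxSol.exists_forall_le {m : RN N → ℝ → ℝ} {w : RN N → ℝ → RN N} (h : FluxSol N T m w)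
    (hT : 0 < T) : ∃ x₀, ∃ t₀ ∈ Icc 0 T, ∀ x, ∀ t ∈ Icc 0 T, m x t ≤ m x₀ t₀ := by
  obtain ⟨⟨x₀, t₀⟩, ⟨-, ht₀⟩, hmax⟩ := ((isCompact_cube (N := N)).prod
    (isCompact_Icc (a := 0) (b := T))).exists_isMaxOn
    ⟨(0, 0), ⟨⟨le_rfl, zero_le_one⟩, ⟨le_rfl, hT.le⟩⟩⟩
    (h.cont.mono (prod_mono (subset_univ _) le_rfl))
  refine ⟨x₀, t₀, ht₀, fun x t ht => ?_⟩
  refine (h.per t).forall_of_cube (P := fun r => r ≤ m x₀ t₀) (fun z hz => ?_) x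
  exact hmax (a := (z, t)) ⟨hz, ht⟩

lemma le_of_le_mul_rpow {y K D a b : ℝ} (hy : 0 < y) (hD : 0 ≤ D) (hab : a * b < 1)
    (h : y ≤ K * (D * y ^ a) ^ b) : y ≤ (K * D ^ b) ^ (1 / (1 - a * b)) := by
  have hd : 0 < 1 - a * b := by linarith
  rw [Real.mul_rpow hD (Real.rpow_nonneg hy.le _), ← Real.rpow_mul hy.le, ← mul_assoc] at h
  have hself : y ^ (1 - a * b) ≤ K * D ^ b := by
    rw [Real.rpow_sub hy, Real.rpow_one, div_le_iff₀ (Real.rpow_pos_of_pos hy _)]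
    exact h
  have hfin := Real.rpow_le_rpow (Real.rpow_nonneg hy.le _) hself (one_div_pos.2 hd).le
  rwa [← Real.rpow_mul hy.le, mul_one_div_cancel hd.ne', Real.rpow_one] at hfin

lemma abs_le_of_growth {h : RN N → ℝ} {γ C C' : ℝ} (hC : 0 ≤ C) (hCC : C ≤ C') {q : RN N}
    (hl : -C ≤ h q) (hu : h q ≤ C * (euclNorm q ^ γ + 1)) :
    |h q| ≤ C' * (euclNorm q ^ γ + 1) := by
  have h1 := Real.rpow_nonneg (euclNorm_nonneg q) γ
  have h2 := mul_le_mul_of_nonneg_right hCC (by linarith : 0 ≤ euclNorm q ^ γ + 1)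
  have h3 := mul_nonneg hC h1
  exact abs_le.2 ⟨by linarith, by linarith⟩

end Conclusion

set_option maxHeartbeats 1000000 in
/-- **Lemma 3.7**: uniform `L^∞` bounds, independent of the penalisation parameter
`η ∈ (0,1]`, for the minimising solutions of the penalised MFG systems, under
`α < min(γ'/N, (γ'-2)/(N+2-γ'))`. -/
theorem penalised_Linfty_bound (N : ℕ) (hN : 1 ≤ N) (T : ℝ) (hT : 0 < T)
    (γ γ' C_H C_L c_f α : ℝ)
    (H : RN N → ℝ) (f f' : RN N → ℝ → ℝ) (m₀ uT : RN N → ℝ)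
    (hγ : 1 < γ) (hγ' : γ' = γ / (γ - 1))
    (hCH : 0 < C_H) (hHconv : ConvexOn ℝ Set.univ H) (hHreg : ContDiff ℝ 3 H)
    (hHgrowth : ∀ p, C_H⁻¹ * euclNorm p ^ γ ≤ H p ∧ H p ≤ C_H * (euclNorm p ^ γ + 1))
    (hCL : 0 < C_L)
    (hLgrowth : ∀ q, C_L⁻¹ * euclNorm q ^ γ' - C_L ≤ Leg H q ∧
      Leg H q ≤ C_L * (euclNorm q ^ γ' + 1))
    (hα : 0 < α) (hcf : 0 < c_f)
    (hfcont : ContinuousOn (fun q : RN N × ℝ => f q.1 q.2)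
      ((Set.univ : Set (RN N)) ×ˢ Ici (0:ℝ)))
    (hfper : ∀ s, ZPeriodic fun x => f x s)
    (hfnn : ∀ x s, 0 ≤ s → 0 ≤ f x s)
    (hfder : ∀ x s, 0 ≤ s → HasDerivAt (f x) (f' x s) s)
    (hfb : ∀ x s, 0 ≤ s → |f' x s| ≤ c_f * (s + 1) ^ (α - 1))
    (hm₀reg : ContDiff ℝ 2 m₀) (hm₀per : ZPeriodic m₀) (hm₀pos : ∀ x, 0 < m₀ x)
    (hm₀int : (∫ x in cube N, m₀ x) = 1)
    (huTreg : ContDiff ℝ 2 uT) (huTper : ZPeriodic uT)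
    (h2 : 2 < γ') (hle : γ' ≤ (N : ℝ) + 2) (hsub : α < γ' / N)
    (hsub2 : γ' < (N : ℝ) + 2 → α < (γ' - 2) / ((N : ℝ) + 2 - γ'))
    (us ms : ℝ → RN N → ℝ → ℝ)
    (hsol : ∀ η ∈ Ioc (0:ℝ) 1,
      ClassicalSol N T (Hpen (Leg H) η) (fun x _ mv => -f x mv) m₀ uT (us η) (ms η) ∧
      MinimisesE N T α γ' m₀ (Lpen (Leg H) η) (Fint f) uT (ms η)
        (fun x t => (-(ms η x t)) • grad (Hpen (Leg H) η) (grad (fun y => us η y t) x))) :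
    ∃ C > (0:ℝ), ∀ η ∈ Ioc (0:ℝ) 1, ∀ x : RN N, ∀ t ∈ Icc (0:ℝ) T,
      |ms η x t| ≤ C := by
  obtain ⟨β, p, hβ0, hβN, hp1, hpN, hexp⟩ := exists_exponents hN hα h2 hle hsub2
  have hγ'0 : 0 < γ' := by linarith
  have hg2 : 0 < γ' - 2 := by linarith
  have hm₀C : ContDiff ℝ 1 m₀ := hm₀reg.of_le (by norm_num)
  have hab : γ.HolderConjugate γ' := hγ' ▸ Real.HolderConjugate.conjExponent hγ
  have hLc : Continuous (Leg H) := continuous_leg hab (inv_pos.2 hCH) fun q => (hHgrowth q).1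
  obtain ⟨Ch, hCh1, hCh⟩ := hpen_bounds hγ hγ' hCL hLgrowth
  obtain ⟨Cf, hCf1, hCf⟩ := exists_coupling_bound hα hcf hfcont hfper hfnn hfder hfb
  obtain ⟨S, hS⟩ := exists_bound_of_periodic (T := 0) (g := fun x _ => 1 + m₀ x)
    (fun _ x z => by simp only [hm₀per x z])
    ((continuous_const.add hm₀C.continuous).comp continuous_fst).continuousOn
  have hN₀ : ∀ x, 1 + m₀ x ≤ S := fun x => (le_abs_self _).trans (hS x 0 ⟨le_rfl, le_rfl⟩)
  have hS1 : 1 ≤ S := by linarith [hN₀ 0, hm₀pos 0]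
  have hC1 : 1 ≤ max Ch Cf := le_max_of_le_left hCh1
  obtain ⟨D₀, hD₀1, hdrift⟩ := exists_drift_bound (m₀ := m₀) hN hT hγ hγ' h2 hC1 hα
    (fun x s hs => (hCf x s hs).trans (mul_le_mul_of_nonneg_right (le_max_right _ _)
      (Real.rpow_nonneg (by linarith) _))) huTreg huTper
  obtain ⟨CE, hCE0, henergy⟩ := exists_energy_bound hT hγ'0 hα hCL hLc hLgrowth hfcont
    (by linarith) hCf hm₀C hm₀per hm₀pos huTreg.continuous huTper hN₀
  obtain ⟨E, hE⟩ := exists_kinetic_bound hN hT h2 hα hsub hCE0 hS1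
  obtain ⟨A, hA1, hA⟩ := exists_powInt_bound hN hT h2 hp1 hpN E S
  obtain ⟨K, hK0, hK⟩ := exists_moser_bound hN hβ0 hβN hT hp1.le hA1 hS1
  obtain ⟨a, ha⟩ : ∃ a, a = α / (γ' - 2) := ⟨_, rfl⟩
  obtain ⟨b, hb⟩ : ∃ b, b = 2 / (β * p) := ⟨_, rfl⟩
  rw [← ha, ← hb] at hexp
  rw [← hb] at hK
  rw [← ha] at hdrift
  have ha0 : 0 < a := by rw [ha]; positivity
  have hpos : 0 < (K * D₀ ^ b) ^ (1 / (1 - a * b)) := Real.rpow_pos_of_pos (mul_pos hK0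
    (Real.rpow_pos_of_pos (zero_lt_one.trans_le hD₀1) _)) _
  refine ⟨_, hpos, ?_⟩
  intro η hη x t ht
  obtain ⟨hsolη, hmin⟩ := hsol η hη
  have hflux := hsolη.fluxSol hmin.1
  obtain ⟨x₀, t₀, ht₀, hmax⟩ := hflux.exists_forall_le hT
  have hM1 : 1 ≤ 1 + ms η x₀ t₀ := le_add_of_nonneg_right (hflux.nonneg _ _)
  have hD := hdrift (Hpen (Leg H) η) (us η) (ms η) (ms η x₀ t₀)
    (fun q => abs_le_of_growth (zero_le_one.trans hCh1) (le_max_left Ch Cf)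
      ((hCh η hη.1.le).1 q).1 ((hCh η hη.1.le).1 q).2)
    (fun q i => ((hCh η hη.1.le).2 q i).trans (mul_le_mul_of_nonneg_right (le_max_left _ _)
      (Real.rpow_nonneg (add_nonneg zero_le_one (euclNorm_nonneg q)) _)))
    hsolη hflux.nonneg hmax
  have hm0 : ∀ y, 1 + ms η y 0 ≤ S := fun y => by rw [hsolη.init]; exact hN₀ y
  have hkin := hE hflux hD hmin.1.kin_int (henergy η hη hflux hD hsolη.init hmin) hm0
  have hpow := hA hflux hD hmin.1.kin_int hkin hm0
  have hsup := hK hflux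
    (one_le_mul_of_one_le_of_one_le hD₀1 (Real.one_le_rpow hM1 ha0.le)) hD hpow hm0 x₀ t₀ ht₀
  rw [abs_of_nonneg (hflux.nonneg x t)]
  exact (hmax x t ht).trans ((le_add_of_nonneg_left zero_le_one).trans
    (le_of_le_mul_rpow (zero_lt_one.trans_le hM1) (zero_le_one.trans hD₀1) hexp hsup))
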